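/- arXiv:0803.4361 — 3 statements merged into one kernel-verified Lean document; each statement's English description precedes it below -/
import Mathlib

section
/- Let X be a complex Banach space of dimension at least 2 and let J be a uniformly closed Jordan algebra of compact operators on X (a linear subspace of B(X), closed in the operator-norm topology, closed under the Jordan product {A,B} = AB + BA, all of whose elements are compact). If J contains no nonzero finite-rank operator, then J is reducible: there exists a closed subspace M of X with M ≠ {0} and M ≠ X such that A(M) ⊆ M for every A ∈ J. -/
open Filter Topology Metric

section BanachAlgebra

variable {A : Type*} [NormedRing A] [NormedAlgebra ℂ A] [CompleteSpace A]

/-- A countable set misses some circle of radius in a prescribed interval. -/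
theorem exists_circle_avoiding_countable {s : Set ℂ} (hs : s.Countable) (c : ℂ) {ε₁ ε₂ : ℝ}
    (hε : ε₁ < ε₂) : ∃ δ, ε₁ < δ ∧ δ < ε₂ ∧ ∀ z ∈ s, ‖z - c‖ ≠ δ := by
  by_contra! H
  refine (Cardinal.Real.Ioo_countable_iff (x := ε₁) (y := ε₂)).not.2 (not_le.2 hε)
    ((hs.image fun z => ‖z - c‖).mono ?_)
  rintro δ ⟨h1, h2⟩
  exact H δ h1 h2

theorem isUnit_of_norm_sub_lt {R : Type*} [NormedRing R] [CompleteSpace R] {x y z : R}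
    (hxz : x * z = 1) (hzx : z * x = 1) {M : ℝ} (hz : ‖z‖ ≤ M) (h : ‖y - x‖ * M < 1) :
    IsUnit y := by
  have h1 : IsUnit (1 - z * (x - y)) := by
    refine isUnit_one_sub_of_norm_lt_one ((norm_mul_le _ _).trans_lt ?_)
    rw [norm_sub_rev, mul_comm]
    exact (mul_le_mul_of_nonneg_left hz (norm_nonneg _)).trans_lt h
  have h2 : y = x * (1 - z * (x - y)) := by
    rw [mul_sub, ← mul_assoc, hxz]; simp
  rw [h2]
  exact IsUnit.mul ⟨⟨x, z, hxz, hzx⟩, rfl⟩ h1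

omit [CompleteSpace A] in
theorem resolvent_mul_sub {a : A} {z : ℂ} (hz : z ∈ resolventSet ℂ a) :
    resolvent a z * (algebraMap ℂ A z - a) = 1 := Ring.inverse_mul_cancel _ hz

omit [CompleteSpace A] in
theorem sub_mul_resolvent {a : A} {z : ℂ} (hz : z ∈ resolventSet ℂ a) :
    (algebraMap ℂ A z - a) * resolvent a z = 1 := Ring.mul_inverse_cancel _ hz

theorem continuousOn_resolvent (a : A) : ContinuousOn (resolvent a) (resolventSet ℂ a) :=
  fun _ hz => (spectrum.hasDerivAt_resolvent_const_left hz).continuousAt.continuousWithinAt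

/-- Lower semicontinuity of the spectrum at elements whose spectrum is countable. -/
theorem exists_mem_spectrum_near {S : A} (hS : (spectrum ℂ S).Countable) {μ : ℂ}
    (hμ : μ ∈ spectrum ℂ S) {ε : ℝ} (hε : 0 < ε) :
    ∀ᶠ s in 𝓝 S, ∃ ν ∈ spectrum ℂ s, ‖ν - μ‖ < ε := by
  obtain ⟨δ, hδ0, hδε, hδ⟩ := exists_circle_avoiding_countable hS μ hε
  have hsub : sphere μ δ ⊆ resolventSet ℂ S := by
    intro z hz
    by_contra h
    exact hδ z h (by simpa [dist_eq_norm] using hz)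
  obtain ⟨M, hM⟩ := (isCompact_sphere μ δ).exists_bound_of_continuousOn
    ((continuousOn_resolvent S).mono hsub)
  have hMpos : 0 < max M 1 := lt_max_of_lt_right one_pos
  rw [Metric.eventually_nhds_iff]
  refine ⟨1 / (2 * max M 1), by positivity, fun s hs => ?_⟩
  rw [dist_eq_norm] at hs
  by_contra! H
  have hs' : ‖s - S‖ * (2 * max M 1) < 1 := by
    rwa [lt_div_iff₀ (by positivity)] at hs
  have hres : closedBall μ δ ⊆ resolventSet ℂ s := by
    intro z hz
    by_contra h
    have := H z h
    rw [mem_closedBall, dist_eq_norm] at hz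
    linarith
  have hbound : ∀ z ∈ sphere μ δ, ‖resolvent s z‖ ≤ 2 * max M 1 := by
    intro z hz
    have e1 := resolvent_mul_sub (hres (sphere_subset_closedBall hz))
    have e2 := sub_mul_resolvent (hsub hz)
    have e3 : resolvent s z = resolvent S z + resolvent s z * (s - S) * resolvent S z := by
      have : s - S = (algebraMap ℂ A z - S) - (algebraMap ℂ A z - s) := by abel
      rw [this, mul_sub, e1, sub_mul, mul_assoc, e2]
      simp
    have h4 : ‖resolvent S z‖ ≤ max M 1 := (hM z hz).trans (le_max_left _ _)
    have h5 : ‖resolvent s z‖ ≤ ‖resolvent S z‖ + ‖resolvent s z‖ * ‖s - S‖ * ‖resolvent S z‖ := by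
      conv_lhs => rw [e3]
      refine (norm_add_le _ _).trans (by gcongr; exact norm_mul₃_le)
    have h6 : ‖resolvent s z‖ * ‖s - S‖ * ‖resolvent S z‖
        ≤ ‖resolvent s z‖ * (‖s - S‖ * max M 1) := by
      rw [mul_assoc]; gcongr
    nlinarith [norm_nonneg (resolvent s z)]
  have hdiff : DiffContOnCl ℂ (resolvent s) (ball μ δ) := by
    refine DifferentiableOn.diffContOnCl fun z hz => ?_
    rw [closure_ball _ hδ0.ne'] at hz
    exact (spectrum.hasDerivAt_resolvent_const_left
      (hres hz)).differentiableAt.differentiableWithinAt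
  have hcentre : ‖resolvent s μ‖ ≤ 2 * max M 1 := by
    refine Complex.norm_le_of_forall_mem_frontier_norm_le isBounded_ball hdiff ?_
      (subset_closure (mem_ball_self hδ0))
    rwa [frontier_ball _ hδ0.ne']
  have hμs : μ ∈ resolventSet ℂ s := hres (mem_closedBall_self hδ0.le)
  refine hμ (isUnit_of_norm_sub_lt (sub_mul_resolvent hμs) (resolvent_mul_sub hμs) hcentre ?_)
  convert hs' using 3
  abel

/-- The spectrum of a product of commuting elements lies in the product of the spectra. -/
theorem Commute.exists_spectrum_mul {a b : A} (hab : Commute a b) {ν : ℂ}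
    (hν : ν ∈ spectrum ℂ (a * b)) : ∃ s ∈ spectrum ℂ a, ∃ t ∈ spectrum ℂ b, ν = s * t := by
  set C : Subalgebra ℂ A := Subalgebra.centralizer ℂ (Set.centralizer {a, b}) with hC
  have hmemC : ∀ x, x ∈ C ↔ ∀ g ∈ Set.centralizer {a, b}, g * x = x * g :=
    fun x => Subalgebra.mem_centralizer_iff ℂ
  have ha1 : a ∈ Set.centralizer {a, b} := by
    rw [Set.mem_centralizer_iff]; rintro m (rfl | rfl)
    · rfl
    · exact hab.eq.symm
  have hb1 : b ∈ Set.centralizer {a, b} := by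
    rw [Set.mem_centralizer_iff]; rintro m (rfl | rfl)
    · exact hab.eq
    · rfl
  have haC : a ∈ C := (hmemC a).2 fun g hg => ((Set.mem_centralizer_iff.1 hg) a (by simp)).symm
  have hbC : b ∈ C := (hmemC b).2 fun g hg => ((Set.mem_centralizer_iff.1 hg) b (by simp)).symm
  have hcomm : ∀ x y : C, x * y = y * x := by
    rintro ⟨x, hx⟩ ⟨y, hy⟩
    have hx' : x ∈ Set.centralizer {a, b} := by
      rw [Set.mem_centralizer_iff]; rintro m (rfl | rfl)
      · exact (hmemC x).1 hx _ ha1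
      · exact (hmemC x).1 hx _ hb1
    exact Subtype.ext ((hmemC y).1 hy x hx')
  let _ : NormedCommRing C := { (inferInstance : NormedRing C) with mul_comm := hcomm }
  have hclosed : IsClosed (C : Set A) := by
    rw [hC, Subalgebra.coe_centralizer]
    exact Set.isClosed_centralizer _
  have : CompleteSpace C := hclosed.completeSpace_coe
  have hunit : ∀ x : C, IsUnit (x : A) → IsUnit x := by
    rintro ⟨x, hx⟩ ⟨u, hu⟩
    simp only at hu
    subst hu
    have hinv : ((u⁻¹ : Aˣ) : A) ∈ C := (hmemC _).2 fun g hg => by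
      have : Commute g (u : A) := (hmemC _).1 hx g hg
      exact this.units_inv_right.eq
    exact ⟨⟨⟨u, hx⟩, ⟨_, hinv⟩, Subtype.ext u.mul_inv, Subtype.ext u.inv_mul⟩, rfl⟩
  have hνC : ν ∈ spectrum ℂ ((⟨a, haC⟩ : C) * ⟨b, hbC⟩) := by
    intro h
    exact hν (IsUnit.map C.val h)
  have hsub : ∀ x : C, spectrum ℂ x ⊆ spectrum ℂ (x : A) := by
    intro x z hz h
    exact hz (hunit _ h)
  obtain ⟨f, hf⟩ := WeakDual.CharacterSpace.mem_spectrum_iff_exists.1 hνC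
  refine ⟨f ⟨a, haC⟩, hsub _ (AlgHom.apply_mem_spectrum f _), f ⟨b, hbC⟩,
    hsub _ (AlgHom.apply_mem_spectrum f _), ?_⟩
  rw [← hf, map_mul]

/-- Elements with spectrum inside a disc have geometrically bounded powers. -/
theorem eventually_norm_pow_lt_of_spectrum {a : A} {c : ℝ} (hc : 0 < c)
    (h : ∀ z ∈ spectrum ℂ a, ‖z‖ < c) : ∀ᶠ n : ℕ in atTop, ‖a ^ n‖ < c ^ n := by
  have hr : spectralRadius ℂ a < ENNReal.ofReal c := by
    rcases (spectrum ℂ a).eq_empty_or_nonempty with he | hne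
    · rw [spectralRadius, he]; simpa using hc
    · rw [← ENNReal.ofNNReal_toNNReal]
      refine spectrum.spectralRadius_lt_of_forall_lt_of_nonempty hne fun k hk => ?_
      rw [← NNReal.coe_lt_coe, Real.coe_toNNReal _ hc.le]
      exact h k hk
  have := (spectrum.pow_nnnorm_pow_one_div_tendsto_nhds_spectralRadius a).eventually_lt_const hr
  filter_upwards [this, eventually_gt_atTop 0] with n hn hn0
  have hn' : (0 : ℝ) < n := by exact_mod_cast hn0
  rw [one_div, ENNReal.rpow_inv_lt_iff hn', ENNReal.ofReal_rpow_of_nonneg hc.le hn'.le,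
    Real.rpow_natCast, ← enorm_eq_nnnorm, ← ofReal_norm] at hn
  exact (ENNReal.ofReal_lt_ofReal_iff_of_nonneg (norm_nonneg _)).1 hn

end BanachAlgebra

section SpectralSplitting

variable {E : Type*} [NormedAddCommGroup E] [NormedSpace ℂ E] [CompleteSpace E]

omit [CompleteSpace E] in
theorem smul_resolvent_apply_sub {T : E →L[ℂ] E} {w : ℂ} (hw : w ∈ resolventSet ℂ T) (x : E) :
    w • resolvent T w x - T (resolvent T w x) = x := by
  have h : (algebraMap ℂ (E →L[ℂ] E) w - T) (resolvent T w x) = x :=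
    DFunLike.congr_fun (sub_mul_resolvent hw) x
  rwa [sub_apply, ContinuousLinearMap.algebraMap_apply] at h

omit [CompleteSpace E] in
theorem resolvent_apply_smul_sub {T : E →L[ℂ] E} {w : ℂ} (hw : w ∈ resolventSet ℂ T) (x : E) :
    resolvent T w (w • x - T x) = x := by
  have h : resolvent T w ((algebraMap ℂ (E →L[ℂ] E) w - T) x) = x :=
    DFunLike.congr_fun (resolvent_mul_sub hw) x
  rwa [sub_apply, ContinuousLinearMap.algebraMap_apply] at h

omit [CompleteSpace E] in
theorem mem_resolventSet_restrict_iff {T : E →L[ℂ] E} {J : Submodule ℂ E}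
    (hinv : ∀ j ∈ J, T j ∈ J) {w : ℂ} (hw : w ∈ resolventSet ℂ T) :
    w ∈ resolventSet ℂ (T.restrict hinv : J →L[ℂ] J) ↔ ∀ j ∈ J, resolvent T w j ∈ J := by
  constructor
  · intro hw2 j hj
    have h3 : w • ((resolvent (T.restrict hinv) w ⟨j, hj⟩ : J) : E)
        - T ((resolvent (T.restrict hinv) w ⟨j, hj⟩ : J) : E) = j :=
      congrArg Subtype.val (smul_resolvent_apply_sub hw2 ⟨j, hj⟩)
    have h4 := resolvent_apply_smul_sub hw ((resolvent (T.restrict hinv) w ⟨j, hj⟩ : J) : E)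
    rw [h3] at h4
    rw [h4]
    exact Subtype.property _
  · intro h
    refine ⟨⟨algebraMap ℂ _ w - T.restrict hinv, (resolvent T w).restrict h, ?_, ?_⟩, rfl⟩
    · ext x
      exact smul_resolvent_apply_sub hw (x : E)
    · ext x
      exact resolvent_apply_smul_sub hw (x : E)

theorem isOpen_resolventSet_clm (T : E →L[ℂ] E) : IsOpen (resolventSet ℂ T) :=
  spectrum.isOpen_resolventSet T

theorem eventually_mem_resolventSet_clm (T : E →L[ℂ] E) :
    ∀ᶠ z in Bornology.cobounded ℂ, z ∈ resolventSet ℂ T :=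
  (spectrum.eventually_isUnit_resolvent T).mono fun _ hz => spectrum.isUnit_resolvent.2 hz

theorem isPreconnected_resolventSet {A : Type*} [Ring A] [Algebra ℂ A] {a : A}
    (ha : (spectrum ℂ a).Countable) : IsPreconnected (resolventSet ℂ a) := by
  rw [← compl_compl (resolventSet ℂ a)]
  refine (Set.Countable.isPathConnected_compl_of_one_lt_rank ?_ ha).isConnected.isPreconnected
  rw [Complex.rank_real_complex]
  exact Cardinal.one_lt_two

theorem tendsto_resolvent_apply {T : E →L[ℂ] E} {w : ℂ} (hw : w ∈ resolventSet ℂ T) {u : ℕ → ℂ}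
    (hu : Tendsto u atTop (𝓝 w)) (x : E) :
    Tendsto (fun n => resolvent T (u n) x) atTop (𝓝 (resolvent T w x)) := by
  have h1 : Tendsto (fun n => resolvent T (u n)) atTop (𝓝 (resolvent T w)) :=
    (spectrum.hasDerivAt_resolvent_const_left hw).continuousAt.tendsto.comp hu
  exact ((ContinuousLinearMap.apply ℂ E x).continuous.tendsto _).comp h1

/-- If the spectrum is countable, resolvents preserve closed invariant subspaces. -/
theorem resolvent_mem_of_countable_spectrum {Ψ : E →L[ℂ] E} (hΨ : (spectrum ℂ Ψ).Countable)
    {J : Submodule ℂ E} (hJ : IsClosed (J : Set E)) (hinv : ∀ j ∈ J, Ψ j ∈ J) {z : ℂ}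
    (hz : z ∈ resolventSet ℂ Ψ) {j : E} (hj : j ∈ J) : resolvent Ψ z j ∈ J := by
  have : CompleteSpace J := hJ.completeSpace_coe
  obtain ⟨ΨJ, hΨJ⟩ : ∃ T : J →L[ℂ] J, T = Ψ.restrict hinv := ⟨_, rfl⟩
  obtain ⟨G, hG⟩ : ∃ G : Set ℂ, G = resolventSet ℂ Ψ ∩ resolventSet ℂ ΨJ := ⟨_, rfl⟩
  have hGiff : ∀ w ∈ resolventSet ℂ Ψ, (w ∈ G ↔ ∀ j ∈ J, resolvent Ψ w j ∈ J) := by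
    intro w hw
    rw [hG, hΨJ, Set.mem_inter_iff, mem_resolventSet_restrict_iff hinv hw]
    exact and_iff_right hw
  have hconn : IsPreconnected (resolventSet ℂ Ψ) := isPreconnected_resolventSet hΨ
  have hGopen : IsOpen G := by
    rw [hG]
    exact (isOpen_resolventSet_clm Ψ).inter (isOpen_resolventSet_clm ΨJ)
  have hGsub : ∀ w ∈ G, w ∈ resolventSet ℂ Ψ := by
    rw [hG]
    exact fun w hw => hw.1
  have hne : (resolventSet ℂ Ψ ∩ G).Nonempty := by
    obtain ⟨r, h1, h2⟩ := ((eventually_mem_resolventSet_clm Ψ).and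
      (eventually_mem_resolventSet_clm ΨJ)).exists
    rw [hG]
    exact ⟨r, h1, h1, h2⟩
  have hsub := hconn.subset_of_closure_inter_subset hGopen hne (by
    rintro w ⟨hwc, hw⟩
    rw [hGiff w hw]
    intro j hj
    obtain ⟨u, hu, hlim⟩ := mem_closure_iff_seq_limit.1 hwc
    have hc := tendsto_resolvent_apply hw hlim j
    exact hJ.mem_of_tendsto hc (Eventually.of_forall fun n =>
      (hGiff _ (hGsub _ (hu n))).1 (hu n) j hj))
  exact (hGiff z hz).1 (hsub hz) j hj

theorem circleIntegral_mem {J : Submodule ℂ E} (hJ : IsClosed (J : Set E)) {f : ℂ → E} {c : ℂ}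
    {R : ℝ} (hR : 0 ≤ R) (hf : ContinuousOn f (sphere c R)) (hmem : ∀ z ∈ sphere c R, f z ∈ J) :
    (∮ z in C(c, R), f z) ∈ J := by
  have hcirc := (hf.circleIntegrable hR).out
  rw [← J.ker_mkQ, LinearMap.mem_ker]
  have : IsClosed (J : Set E) := hJ
  change J.mkQL _ = 0
  rw [circleIntegral, ← ContinuousLinearMap.intervalIntegral_comp_comm _ hcirc]
  convert intervalIntegral.integral_zero with θ
  rw [map_smul]
  convert smul_zero _
  exact (Submodule.Quotient.mk_eq_zero J).2 (hmem _ (circleMap_mem_sphere c hR θ))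

theorem clm_circleIntegral {F : Type*} [NormedAddCommGroup F] [NormedSpace ℂ F] [CompleteSpace F]
    (L : E →L[ℂ] F) {f : ℂ → E} {c : ℂ} {R : ℝ} (hf : CircleIntegrable f c R) :
    L (∮ z in C(c, R), f z) = ∮ z in C(c, R), L (f z) := by
  simp only [circleIntegral]
  rw [← ContinuousLinearMap.intervalIntegral_comp_comm _ hf.out]
  simp

/-- Splitting a vector along a circle in the resolvent set: one summand decays like `δ ^ n` under
the powers of the operator, the other has preimages growing at most like `δ ^ (-n)`. -/
theorem exists_spectral_splitting {Ψ : E →L[ℂ] E} {J : Submodule ℂ E}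
    (hJ : IsClosed (J : Set E)) {δ : ℝ} (hδ : 0 < δ)
    (hres : ∀ z : ℂ, ‖z‖ = δ → z ∈ resolventSet ℂ Ψ ∧ ∀ j ∈ J, resolvent Ψ z j ∈ J)
    {j : E} (hj : j ∈ J) :
    ∃ e ∈ J, ∃ C : ℝ, (∀ n, ‖(Ψ ^ n) e‖ ≤ C * δ ^ n) ∧
      ∀ n, ∃ y, (Ψ ^ n) y = j - e ∧ ‖y‖ * δ ^ n ≤ C := by
  have hnorm : ∀ z ∈ sphere (0 : ℂ) δ, ‖z‖ = δ := fun z hz => by simpa using hz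
  have hne : ∀ z ∈ sphere (0 : ℂ) δ, z ≠ 0 := fun z hz h => by
    have := hnorm z hz; rw [h, norm_zero] at this; exact hδ.ne this
  have hcont : ContinuousOn (fun z : ℂ => resolvent Ψ z j) (sphere 0 δ) := by
    have h1 : ContinuousOn (fun z : ℂ => resolvent Ψ z) (sphere 0 δ) :=
      (continuousOn_resolvent Ψ).mono fun z hz => (hres z (hnorm z hz)).1
    exact h1.clm_apply continuousOn_const
  obtain ⟨M, hM⟩ := (isCompact_sphere (0 : ℂ) δ).exists_bound_of_continuousOn hcont
  have hM0 : 0 ≤ M := (norm_nonneg _).trans (hM δ (by simp [abs_of_pos hδ]))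
  have hzc : ∀ m : ℤ, ContinuousOn (fun z : ℂ => z ^ m) (sphere 0 δ) := fun m z hz =>
    (continuousAt_zpow₀ z m (Or.inl (hne z hz))).continuousWithinAt
  have hfc : ∀ m : ℤ, ContinuousOn (fun z : ℂ => z ^ m • resolvent Ψ z j) (sphere 0 δ) :=
    fun m => (hzc m).smul hcont
  set κ : ℂ := (2 * Real.pi * Complex.I : ℂ)⁻¹ with hκ
  set I : ℤ → E := fun m => κ • ∮ z in C(0, δ), z ^ m • resolvent Ψ z j with hI
  have hIbound : ∀ m, ‖I m‖ ≤ δ * (δ ^ m * M) := fun m => by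
    refine circleIntegral.norm_two_pi_i_inv_smul_integral_le_of_norm_le_const hδ.le fun z hz => ?_
    rw [norm_smul, norm_zpow, hnorm z hz]
    exact mul_le_mul_of_nonneg_left (hM z hz) (by positivity)
  have hImem : ∀ m, I m ∈ J := fun m => J.smul_mem _ (circleIntegral_mem hJ hδ.le (hfc m)
    fun z hz => J.smul_mem _ ((hres z (hnorm z hz)).2 j hj))
  have hstep : ∀ m, Ψ (I m) = I (m + 1) - κ • (∮ z in C(0, δ), z ^ m) • j := fun m => by
    simp only [hI]
    rw [map_smul, clm_circleIntegral _ ((hfc m).circleIntegrable hδ.le), ← smul_sub]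
    congr 1
    rw [← circleIntegral.integral_smul_const, ← circleIntegral.integral_sub
      ((hfc _).circleIntegrable hδ.le)
      (g := fun z : ℂ => z ^ m • j)
      (((hzc m).smul continuousOn_const).circleIntegrable hδ.le)]
    refine circleIntegral.integral_congr hδ.le fun z hz => ?_
    have h2 : Ψ (resolvent Ψ z j) = z • resolvent Ψ z j - j := by
      rw [eq_sub_iff_add_eq, add_comm, ← eq_sub_iff_add_eq]
      exact (smul_resolvent_apply_sub (hres z (hnorm z hz)).1 j).symm
    simp only [map_smul, h2, smul_sub, smul_smul, zpow_add_one₀ (hne z hz)]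
  have hstep' : ∀ m : ℤ, m ≠ -1 → Ψ (I m) = I (m + 1) := fun m hm => by
    have h0 : (∮ z in C(0, δ), z ^ m) = 0 := by
      have := circleIntegral.integral_sub_zpow_of_ne hm (0 : ℂ) 0 δ
      simpa using this
    rw [hstep, h0]; simp
  have hstep1 : Ψ (I (-1)) = I 0 - j := by
    have h0 : (∮ z in C(0, δ), z ^ (-1 : ℤ)) = 2 * Real.pi * Complex.I := by
      have := circleIntegral.integral_sub_center_inv (0 : ℂ) hδ.ne'
      simpa using this
    rw [hstep, h0, smul_smul, hκ, inv_mul_cancel₀ Complex.two_pi_I_ne_zero]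
    simp
  have hpos : ∀ n : ℕ, (Ψ ^ n) (I 0) = I n := fun n => by
    induction n with
    | zero => simp
    | succ n ih =>
      rw [pow_succ', mul_apply_eq_comp, ih, hstep' _ (by omega)]
      simp
  have hneg : ∀ n : ℕ, (Ψ ^ (n + 1)) (I (-(n + 1))) = I 0 - j := fun n => by
    induction n with
    | zero => simpa using hstep1
    | succ n ih =>
      rw [pow_succ, mul_apply_eq_comp, hstep' _ (by omega)]
      convert ih using 3
      push_cast
      ring
  refine ⟨I 0, hImem 0, ‖j‖ + δ * M, fun n => ?_, fun n => ?_⟩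
  · rw [hpos]
    have := hIbound n
    rw [zpow_natCast] at this
    have h3 : 0 ≤ ‖j‖ * δ ^ n := by positivity
    nlinarith
  · rcases n with _ | n
    · refine ⟨j - I 0, by simp, ?_⟩
      have := hIbound 0
      simp only [zpow_zero, one_mul] at this
      simpa using (norm_sub_le _ _).trans (add_le_add_right this _)
    · refine ⟨-I (-(n + 1)), by rw [map_neg, hneg]; abel, ?_⟩
      have := hIbound (-(n + 1))
      rw [norm_neg]
      have h4 : δ ^ (-((n : ℤ) + 1)) * δ ^ (n + 1) = 1 := by
        rw [← zpow_natCast, ← zpow_add₀ hδ.ne']; simp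
      calc ‖I (-(n + 1))‖ * δ ^ (n + 1) ≤ δ * (δ ^ (-((n : ℤ) + 1)) * M) * δ ^ (n + 1) := by gcongr
        _ = δ * M * (δ ^ (-((n : ℤ) + 1)) * δ ^ (n + 1)) := by ring
        _ ≤ ‖j‖ + δ * M := by rw [h4]; linarith [norm_nonneg j]

end SpectralSplitting

section CompactOperators

variable {E : Type*} [NormedAddCommGroup E] [NormedSpace ℂ E]

/-- A compact operator cannot keep a bounded sequence uniformly separated. -/
theorem IsCompactOperator.false_of_separated {k : E →L[ℂ] E} (hk : IsCompactOperator k)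
    {x : ℕ → E} {R η : ℝ} (hη : 0 < η) (hx : ∀ n, ‖x n‖ ≤ R)
    (hsep : ∀ m n, m < n → η ≤ ‖k (x m) - k (x n)‖) : False := by
  obtain ⟨K, hK, hsub⟩ := hk.image_closedBall_subset_compact R
  obtain ⟨a, -, φ, hφ, hlim⟩ := hK.tendsto_subseq (x := fun n => k (x n)) fun n =>
    hsub ⟨x n, by simpa using hx n, rfl⟩
  obtain ⟨N, hN⟩ := Metric.cauchySeq_iff'.1 hlim.cauchySeq η hη
  have h1 := hN (N + 1) (Nat.le_succ N)
  rw [dist_comm, dist_eq_norm] at h1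
  exact absurd (hsep _ _ (hφ (Nat.lt_succ_self N))) (not_le.2 h1)

theorem IsCompactOperator.bound_of_injOn {k : E →L[ℂ] E} (hk : IsCompactOperator k) {μ : ℂ}
    (hμ : μ ≠ 0) {W : Submodule ℂ E} (hW : IsClosed (W : Set E))
    (hinj : ∀ w ∈ W, k w = μ • w → w = 0) :
    ∃ C : ℝ, 0 ≤ C ∧ ∀ w ∈ W, ‖w‖ ≤ C * ‖k w - μ • w‖ := by
  by_contra! H
  have hex : ∀ n : ℕ, ∃ w ∈ W, ‖w‖ = 1 ∧ ‖k w - μ • w‖ ≤ 1 / ((n : ℝ) + 1) := fun n => by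
    obtain ⟨w, hw, hlt⟩ := H (n + 1) (by positivity)
    have hw0 : 0 < ‖w‖ := lt_of_le_of_lt (by positivity) hlt
    refine ⟨((‖w‖⁻¹ : ℝ) : ℂ) • w, W.smul_mem _ hw, ?_, ?_⟩
    · rw [norm_smul, Complex.norm_real, norm_inv, norm_norm, inv_mul_cancel₀ hw0.ne']
    · rw [map_smul, smul_comm μ, ← smul_sub, norm_smul, Complex.norm_real, norm_inv, norm_norm,
        inv_mul_le_iff₀ hw0, mul_one_div, le_div_iff₀ (by positivity)]
      linarith
  choose w hwW hw1 hwk using hex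
  obtain ⟨K, hK, hsub⟩ := hk.image_closedBall_subset_compact 1
  obtain ⟨a, -, φ, hφ, hlim⟩ := hK.tendsto_subseq (x := fun n => k (w n)) fun n =>
    hsub ⟨w n, by simp [hw1 n], rfl⟩
  have h0 : Tendsto (fun n => k (w n) - μ • w n) atTop (𝓝 0) :=
    squeeze_zero_norm hwk tendsto_one_div_add_atTop_nhds_zero_nat
  have h1 : Tendsto (fun n => w (φ n)) atTop (𝓝 (μ⁻¹ • a)) := by
    have h2 := (hlim.sub (h0.comp hφ.tendsto_atTop)).const_smul μ⁻¹
    rw [sub_zero] at h2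
    refine h2.congr fun n => ?_
    simp [smul_smul, hμ]
  have h3 : μ⁻¹ • a ∈ W := hW.mem_of_tendsto h1 (Eventually.of_forall fun n => hwW _)
  have h4 : k (μ⁻¹ • a) = μ • (μ⁻¹ • a) := by
    rw [smul_smul, mul_inv_cancel₀ hμ, one_smul]
    exact tendsto_nhds_unique ((k.continuous.tendsto _).comp h1) hlim
  have h5 : ‖μ⁻¹ • a‖ = 1 := tendsto_nhds_unique h1.norm (by simp [hw1])
  rw [hinj _ h3 h4, norm_zero] at h5
  exact zero_ne_one h5

theorem IsCompactOperator.finiteDimensional_eigenspace {k : E →L[ℂ] E} (hk : IsCompactOperator k)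
    {μ : ℂ} (hμ : μ ≠ 0) {N : Submodule ℂ E} (hN : IsClosed (N : Set E))
    (h : ∀ x ∈ N, k x = μ • x) : FiniteDimensional ℂ N := by
  refine FiniteDimensional.of_isCompactOperator_id (𝕜 := ℂ) ?_
  have h1 : IsCompactOperator (fun x : N => μ⁻¹ • k (x : E)) :=
    (hk.comp_clm N.subtypeL).smul μ⁻¹
  have h2 : ∀ x : N, μ⁻¹ • k (x : E) = x := fun x => by
    rw [h x x.2, smul_smul, inv_mul_cancel₀ hμ, one_smul]
  have h3 := h1.codRestrict (V := N) (fun x => by rw [h2]; exact x.2) hN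
  have h4 : Set.codRestrict (fun x : N => μ⁻¹ • k (x : E)) N
      (fun x => by rw [h2]; exact x.2) = id :=
    funext fun x => Subtype.ext (h2 x)
  rwa [h4] at h3

variable [CompleteSpace E]

/-- A nonzero spectral value of a compact operator is an eigenvalue of its transpose. -/
theorem IsCompactOperator.exists_functional {k : E →L[ℂ] E} (hk : IsCompactOperator k) {μ : ℂ}
    (hμ : μ ≠ 0) (hspec : μ ∈ spectrum ℂ k) :
    ∃ f : E →L[ℂ] ℂ, f ≠ 0 ∧ ∀ x, f (k x) = μ * f x := by
  set T : E →L[ℂ] E := k - μ • 1 with hT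
  have hTx : ∀ x, T x = k x - μ • x := fun x => by simp [hT]
  set N : Submodule ℂ E := LinearMap.ker (T : E →ₗ[ℂ] E) with hN
  have hNmem : ∀ x, x ∈ N ↔ k x = μ • x := fun x => by
    rw [hN, LinearMap.mem_ker]
    change T x = 0 ↔ _
    rw [hTx, sub_eq_zero]
  have hNc : IsClosed (N : Set E) := T.isClosed_ker
  have hNfin : FiniteDimensional ℂ N :=
    hk.finiteDimensional_eigenspace hμ hNc fun x hx => (hNmem x).1 hx
  obtain ⟨W, hWc, hNW⟩ :=
    (Submodule.ClosedComplemented.of_finiteDimensional N).exists_isClosed_isCompl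
  have hWinj : ∀ w ∈ W, k w = μ • w → w = 0 := fun w hw h =>
    (Submodule.disjoint_def.1 hNW.disjoint) w ((hNmem w).2 h) hw
  obtain ⟨C, hC0, hC⟩ := hk.bound_of_injOn hμ hWc hWinj
  have : CompleteSpace W := hWc.completeSpace_coe
  set TW : W →L[ℂ] E := T ∘L W.subtypeL with hTW
  have hanti : AntilipschitzWith ⟨C, hC0⟩ TW :=
    ContinuousLinearMap.antilipschitz_of_bound _ fun w => by
      have := hC w w.2
      rw [← hTx] at this
      exact this
  have hrc : IsClosed (LinearMap.range (TW : W →ₗ[ℂ] E) : Set E) := by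
    rw [LinearMap.coe_range]
    exact hanti.isClosed_range TW.uniformContinuous
  set Rg := LinearMap.range (TW : W →ₗ[ℂ] E) with hRg
  have hTmem : ∀ x, T x ∈ Rg := fun x => by
    obtain ⟨p, hp, w, hw, rfl⟩ := Submodule.mem_sup.1
      (show x ∈ N ⊔ W by rw [hNW.sup_eq_top]; trivial)
    refine ⟨⟨w, hw⟩, ?_⟩
    have : T p = 0 := hp
    rw [map_add, this, zero_add]
    rfl
  by_cases htop : Rg = ⊤
  · exfalso
    let e := ContinuousLinearEquiv.ofBijective TW
      (LinearMap.ker_eq_bot.2 hanti.injective) htop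
    set R : E →L[ℂ] E := W.subtypeL ∘L (e.symm : E →L[ℂ] W) with hR
    have hTR : T * R = 1 := by
      ext x
      exact e.apply_symm_apply x
    have hTR' : ∀ x, k (R x) = x + μ • R x := fun x => by
      have := DFunLike.congr_fun hTR x
      rw [mul_apply_eq_comp, ContinuousLinearMap.comp_apply, hTx] at this
      rw [← sub_eq_iff_eq_add]
      exact this
    have hkR : IsCompactOperator (k * R) := hk.comp_clm R
    rcases hkR.hasEigenvalue_or_mem_resolventSet one_ne_zero with h | h
    · obtain ⟨x, hx⟩ := h.exists_hasEigenvector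
      have h1 : k (R x) = x := by simpa using hx.apply_eq_smul
      have h2 : R x = 0 := by
        have := hTR' x
        rw [h1, left_eq_add] at this
        exact (smul_eq_zero.1 this).resolve_left hμ
      rw [h2, map_zero] at h1
      exact hx.2 h1.symm
    · have h1 : IsUnit (-(μ • R)) := by
        have h2 : IsUnit (algebraMap ℂ (E →L[ℂ] E) 1 - k * R) := h
        convert h2 using 1
        ext x
        simp [hTR']
      have hRu : IsUnit R := by
        have h2 := h1.neg
        rw [neg_neg] at h2
        have h3 := h2.smul (Units.mk0 μ hμ)⁻¹
        simpa [Units.smul_def, smul_smul, hμ] using h3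
      obtain ⟨u, hu⟩ := hRu
      have hTu : T = ((u⁻¹ : (E →L[ℂ] E)ˣ) : E →L[ℂ] E) := by
        rw [← hu] at hTR
        exact (Units.inv_eq_of_mul_eq_one_left hTR).symm
      apply hspec
      have : IsUnit (-T) := by rw [hTu]; exact (Units.isUnit _).neg
      rw [spectrum.mem_resolventSet_iff]
      convert this using 1
      rw [hT, neg_sub]
      rfl
  · obtain ⟨x, hx⟩ : ∃ x, x ∉ Rg := by
      by_contra! h
      exact htop (Submodule.eq_top_iff'.2 h)
    have : IsClosed (Rg : Set E) := hrc
    have hx0 : Rg.mkQL x ≠ 0 := fun h => hx ((Submodule.Quotient.mk_eq_zero Rg).1 h)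
    obtain ⟨f, hf⟩ := SeparatingDual.exists_ne_zero (R := ℂ) hx0
    refine ⟨f ∘L Rg.mkQL, fun h => hf (DFunLike.congr_fun h x), fun y => ?_⟩
    have h1 : Rg.mkQL (T y) = 0 := (Submodule.Quotient.mk_eq_zero Rg).2 (hTmem y)
    rw [hTx, map_sub, sub_eq_zero, map_smul] at h1
    simp only [ContinuousLinearMap.comp_apply]
    rw [h1, map_smul, smul_eq_mul]

end CompactOperators

section Flags

variable {E : Type*} [NormedAddCommGroup E] [NormedSpace ℂ E]

/-- Subspaces obtained from the whole space by successively intersecting with kernels of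
functionals that are eigenvectors of the transpose of `k`, with eigenvalues in `B`. -/
inductive DownFlag (k : E →L[ℂ] E) (B : Set ℂ) : Submodule ℂ E → Prop
  | top : DownFlag k B ⊤
  | step {V : Submodule ℂ E} {μ : ℂ} {f : E →L[ℂ] ℂ} (hV : DownFlag k B V) (hμ : μ ∈ B)
      (hf : ∀ x ∈ V, f (k x) = μ * f x) :
      DownFlag k B (V ⊓ LinearMap.ker (f : E →ₗ[ℂ] ℂ))

/-- Subspaces obtained from zero by successively adjoining eigenvectors of `k` modulo the
previous subspace, with eigenvalues in `B`. -/
inductive UpFlag (k : E →L[ℂ] E) (B : Set ℂ) : Submodule ℂ E → Prop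
  | bot : UpFlag k B ⊥
  | step {U : Submodule ℂ E} {μ : ℂ} {x : E} (hU : UpFlag k B U) (hμ : μ ∈ B)
      (hx : k x - μ • x ∈ U) : UpFlag k B (U ⊔ Submodule.span ℂ {x})

variable {k : E →L[ℂ] E} {B : Set ℂ}

theorem DownFlag.isClosed {V : Submodule ℂ E} (h : DownFlag k B V) : IsClosed (V : Set E) := by
  induction h with
  | top => exact isClosed_univ
  | step _ _ _ ih => exact ih.inter (ContinuousLinearMap.isClosed_ker _)

theorem DownFlag.mapsTo {V : Submodule ℂ E} (h : DownFlag k B V) : ∀ x ∈ V, k x ∈ V := by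
  induction h with
  | top => exact fun _ _ => trivial
  | @step V μ f _ _ hf ih =>
    rintro x ⟨hx, hfx⟩
    refine ⟨ih x hx, ?_⟩
    have h0 : f x = 0 := hfx
    change f (k x) = 0
    rw [hf x hx, h0, mul_zero]

theorem DownFlag.coFG {V : Submodule ℂ E} (h : DownFlag k B V) : V.CoFG := by
  induction h with
  | top => exact Submodule.CoFG.top
  | step _ _ _ ih => exact ih.inf (Submodule.CoFG.ker _)

theorem UpFlag.finiteDimensional {U : Submodule ℂ E} (h : UpFlag k B U) :
    FiniteDimensional ℂ U := by
  induction h with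
  | bot => infer_instance
  | step _ _ _ ih => exact Submodule.finiteDimensional_sup _ _

theorem UpFlag.isClosed {U : Submodule ℂ E} (h : UpFlag k B U) : IsClosed (U : Set E) :=
  have := h.finiteDimensional
  U.closed_of_finiteDimensional

theorem UpFlag.mapsTo {U : Submodule ℂ E} (h : UpFlag k B U) : ∀ x ∈ U, k x ∈ U := by
  induction h with
  | bot => simp
  | @step U μ x _ _ hx ih =>
    intro y hy
    obtain ⟨u, hu, v, hv, rfl⟩ := Submodule.mem_sup.1 hy
    obtain ⟨c, rfl⟩ := Submodule.mem_span_singleton.1 hv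
    have : k (u + c • x) = (k u + c • (k x - μ • x)) + (c * μ) • x := by
      rw [map_add, map_smul, smul_sub, smul_smul]; abel
    rw [this]
    exact Submodule.add_mem_sup (U.add_mem (ih u hu) (U.smul_mem _ hx))
      (Submodule.smul_mem _ _ (Submodule.mem_span_singleton_self x))

/-- A bounded vector of a subspace at distance at least one from a smaller closed subspace. -/
theorem exists_riesz_vector {V V' : Submodule ℂ E} (hV' : IsClosed (V' : Set E)) (hlt : V' < V) :
    ∃ x ∈ V, ‖x‖ ≤ 3 ∧ ∀ y ∈ V', 1 ≤ ‖x - y‖ := by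
  obtain ⟨z, hz, hz'⟩ := SetLike.exists_of_lt hlt
  obtain ⟨x, hx, hxy⟩ := riesz_lemma_of_norm_lt (c := (2 : ℂ)) (R := 3) (by norm_num) (by norm_num)
    (F := V'.comap V.subtype) (hV'.preimage continuous_subtype_val) ⟨⟨z, hz⟩, hz'⟩
  exact ⟨x, x.2, hx, fun y hy => hxy ⟨y, hlt.le hy⟩ hy⟩

theorem exists_terminal_of_no_chain {α : Type*} {P : α → Prop} {r : α → α → Prop} (a : α)
    (ha : P a) (h : ∀ u : ℕ → α, (∀ n, P (u n)) → (∀ n, r (u n) (u (n + 1))) → False) :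
    ∃ b, P b ∧ ∀ c, P c → ¬ r b c := by
  by_contra! H
  choose! F hF hr using H
  refine h (fun n => F^[n] a) (fun n => ?_) fun n => ?_
  · induction n with
    | zero => exact ha
    | succ n ih => rw [Function.iterate_succ_apply']; exact hF _ ih
  · have hP : P (F^[n] a) := by
      induction n with
      | zero => exact ha
      | succ n ih => rw [Function.iterate_succ_apply']; exact hF _ ih
    simp only [Function.iterate_succ_apply']
    exact hr _ hP

theorem IsCompactOperator.exists_downFlag (hk : IsCompactOperator k) {η : ℝ} (hη : 0 < η)
    (hB : ∀ μ ∈ B, η ≤ ‖μ‖) :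
    ∃ V, DownFlag k B V ∧ ∀ μ ∈ B, ∀ f : E →L[ℂ] ℂ, (∀ x ∈ V, f (k x) = μ * f x) →
      ∀ x ∈ V, f x = 0 := by
  obtain ⟨V, hV, hterm⟩ := exists_terminal_of_no_chain (P := DownFlag k B)
    (r := fun V V' => V' < V ∧ ∃ μ ∈ B, ∀ x ∈ V, k x - μ • x ∈ V') ⊤ DownFlag.top (by
      intro u hu hr
      have hanti : Antitone u := antitone_nat_of_succ_le fun n => (hr n).1.le
      choose x hxV hx3 hx1 using fun n => exists_riesz_vector (hu (n + 1)).isClosed (hr n).1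
      refine hk.false_of_separated hη hx3 fun m n hmn => ?_
      obtain ⟨-, μ, hμ, hμV⟩ := hr m
      have hμ0 : μ ≠ 0 := norm_pos_iff.1 (hη.trans_le (hB μ hμ))
      have hmem : k (x n) - (k (x m) - μ • x m) ∈ u (m + 1) :=
        sub_mem ((hu _).mapsTo _ (hanti hmn (hxV n))) (hμV _ (hxV m))
      have h1 := hx1 m _ ((u (m + 1)).smul_mem μ⁻¹ hmem)
      have h2 : k (x m) - k (x n) = μ • (x m - μ⁻¹ • (k (x n) - (k (x m) - μ • x m))) := by
        rw [smul_sub, smul_smul, mul_inv_cancel₀ hμ0, one_smul]; abel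
      rw [h2, norm_smul]
      exact (hB μ hμ).trans (le_mul_of_one_le_right (norm_nonneg _) h1))
  refine ⟨V, hV, fun μ hμ f hf x hx => ?_⟩
  by_contra hfx
  refine hterm _ (hV.step hμ hf) ⟨lt_of_le_of_ne inf_le_left fun h => ?_, μ, hμ, fun y hy => ?_⟩
  · rw [← h] at hx
    exact hfx hx.2
  · refine ⟨sub_mem (hV.mapsTo y hy) (V.smul_mem _ hy), ?_⟩
    change f (k y - μ • y) = 0
    rw [map_sub, hf y hy, map_smul, smul_eq_mul, sub_self]

theorem IsCompactOperator.exists_upFlag (hk : IsCompactOperator k) {η : ℝ} (hη : 0 < η)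
    (hB : ∀ μ ∈ B, η ≤ ‖μ‖) :
    ∃ U, UpFlag k B U ∧ ∀ μ ∈ B, ∀ x, k x - μ • x ∈ U → x ∈ U := by
  obtain ⟨U, hU, hterm⟩ := exists_terminal_of_no_chain (P := UpFlag k B)
    (r := fun U U' => U < U' ∧ ∃ μ ∈ B, ∀ x ∈ U', k x - μ • x ∈ U) ⊥ UpFlag.bot (by
      intro u hu hr
      have hmono : Monotone u := monotone_nat_of_le_succ fun n => (hr n).1.le
      choose x hxV hx3 hx1 using fun n => exists_riesz_vector (hu n).isClosed (hr n).1
      refine hk.false_of_separated hη hx3 fun m n hmn => ?_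
      obtain ⟨-, μ, hμ, hμV⟩ := hr n
      have hμ0 : μ ≠ 0 := norm_pos_iff.1 (hη.trans_le (hB μ hμ))
      have hmem : k (x m) - (k (x n) - μ • x n) ∈ u n :=
        sub_mem (hmono hmn ((hu _).mapsTo _ (hxV m))) (hμV _ (hxV n))
      have h1 := hx1 n _ ((u n).smul_mem μ⁻¹ hmem)
      have h2 : k (x n) - k (x m) = μ • (x n - μ⁻¹ • (k (x m) - (k (x n) - μ • x n))) := by
        rw [smul_sub, smul_smul, mul_inv_cancel₀ hμ0, one_smul]; abel
      rw [norm_sub_rev, h2, norm_smul]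
      exact (hB μ hμ).trans (le_mul_of_one_le_right (norm_nonneg _) h1))
  refine ⟨U, hU, fun μ hμ x hx => ?_⟩
  by_contra hxU
  have hxs : x ∈ U ⊔ Submodule.span ℂ {x} :=
    Submodule.mem_sup_right (Submodule.mem_span_singleton_self x)
  refine hterm _ (hU.step hμ hx) ⟨lt_of_le_of_ne le_sup_left fun h => ?_, μ, hμ, fun y hy => ?_⟩
  · rw [← h] at hxs
    exact hxU hxs
  · obtain ⟨u, hu, v, hv, rfl⟩ := Submodule.mem_sup.1 hy
    obtain ⟨c, rfl⟩ := Submodule.mem_span_singleton.1 hv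
    have : k (u + c • x) - μ • (u + c • x) = (k u - μ • u) + c • (k x - μ • x) := by
      rw [map_add, map_smul, smul_add, smul_sub, smul_comm c μ]; abel
    rw [this]
    exact U.add_mem (sub_mem (hU.mapsTo u hu) (U.smul_mem _ hu)) (U.smul_mem _ hx)

/-- The operator induced on the quotient by an invariant subspace. -/
noncomputable def ContinuousLinearMap.quotientMap (T : E →L[ℂ] E) (U : Submodule ℂ E)
    (hU : ∀ x ∈ U, T x ∈ U) : (E ⧸ U) →L[ℂ] (E ⧸ U) :=
  U.liftQL (U.mkQL ∘L T) fun x hx => (Submodule.Quotient.mk_eq_zero U).2 (hU x hx)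

theorem IsCompactOperator.quotientMap (hk : IsCompactOperator k) {U : Submodule ℂ E}
    (hU : ∀ x ∈ U, k x ∈ U) : IsCompactOperator (k.quotientMap U hU) := by
  obtain ⟨K, hK, hV⟩ := hk.clm_comp U.mkQL
  refine ⟨K, hK, ?_⟩
  have h1 := (U.isOpenMap_mkQ).image_mem_nhds hV
  rw [map_zero] at h1
  refine mem_of_superset h1 ?_
  rintro _ ⟨x, hx, rfl⟩
  exact hx

variable [CompleteSpace E]

theorem IsCompactOperator.exists_upFlag_spectrum (hk : IsCompactOperator k) {η : ℝ} (hη : 0 < η) :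
    ∃ U, ∃ hU : UpFlag k {μ | η ≤ ‖μ‖} U,
      ∀ μ ∈ spectrum ℂ (k.quotientMap U hU.mapsTo), ‖μ‖ < η := by
  obtain ⟨U, hU, hterm⟩ := hk.exists_upFlag (B := {μ | η ≤ ‖μ‖}) hη fun μ h => h
  refine ⟨U, hU, fun μ hμ => ?_⟩
  by_contra! hle
  have hUc : IsClosed (U : Set E) := hU.isClosed
  have hμ0 : μ ≠ 0 := norm_pos_iff.1 (hη.trans_le hle)
  rcases (hk.quotientMap hU.mapsTo).hasEigenvalue_or_mem_resolventSet hμ0 with h | h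
  · obtain ⟨y, hy⟩ := h.exists_hasEigenvector
    obtain ⟨x, rfl⟩ := U.mkQ_surjective y
    have h1 : U.mkQL (k x) = μ • U.mkQL x := hy.apply_eq_smul
    refine hy.2 ((Submodule.Quotient.mk_eq_zero U).2 (hterm μ hle x ?_))
    rw [← map_smul, ← sub_eq_zero, ← map_sub] at h1
    exact (Submodule.Quotient.mk_eq_zero U).1 h1
  · exact hμ h

theorem IsCompactOperator.exists_downFlag_spectrum (hk : IsCompactOperator k) {η : ℝ} (hη : 0 < η)
    (hB : ∀ μ ∈ B, η ≤ ‖μ‖) :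
    ∃ V, ∃ hV : DownFlag k B V, ∀ μ ∈ spectrum ℂ (k.restrict hV.mapsTo : V →L[ℂ] V), μ ∉ B := by
  obtain ⟨V, hV, hterm⟩ := hk.exists_downFlag hη hB
  refine ⟨V, hV, fun μ hμ hμB => ?_⟩
  have hμ0 : μ ≠ 0 := norm_pos_iff.1 (hη.trans_le (hB μ hμB))
  have : CompleteSpace V := hV.isClosed.completeSpace_coe
  have hc : IsCompactOperator (k.restrict hV.mapsTo : V →L[ℂ] V) :=
    IsCompactOperator.restrict (f := (k : E →ₗ[ℂ] E)) hk hV.mapsTo hV.isClosed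
  obtain ⟨f, hf0, hf⟩ := hc.exists_functional hμ0 hμ
  obtain ⟨g, hg, -⟩ := exists_extension_norm_eq V f
  refine hf0 (ContinuousLinearMap.ext fun x => ?_)
  rw [← hg x]
  refine hterm μ hμB g (fun y hy => ?_) x x.2
  have := hf ⟨y, hy⟩
  rw [← hg, ← hg] at this
  exact this

theorem IsCompactOperator.countable_spectrum (hk : IsCompactOperator k) :
    (spectrum ℂ k).Countable := by
  have hfin : ∀ n : ℕ, {μ ∈ spectrum ℂ k | 1 / ((n : ℝ) + 1) ≤ ‖μ‖}.Finite := fun n => by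
    obtain ⟨U, hU, hsp⟩ := hk.exists_upFlag (B := {μ | 1 / ((n : ℝ) + 1) ≤ ‖μ‖})
      (η := 1 / ((n : ℝ) + 1)) (by positivity) fun μ h => h
    have := hU.finiteDimensional
    refine (Module.End.finite_hasEigenvalue
      ((k : E →ₗ[ℂ] E).restrict hU.mapsTo : Module.End ℂ U)).subset ?_
    rintro μ ⟨hμ, hle⟩
    have hμ0 : μ ≠ 0 := norm_pos_iff.1 (lt_of_lt_of_le (by positivity) hle)
    rcases hk.hasEigenvalue_or_mem_resolventSet hμ0 with h | h
    · obtain ⟨x, hx⟩ := h.exists_hasEigenvector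
      have h1 : k x = μ • x := hx.apply_eq_smul
      have hxU : x ∈ U := hsp μ hle x (by rw [h1, sub_self]; exact U.zero_mem)
      refine Module.End.hasEigenvalue_of_hasEigenvector (x := ⟨x, hxU⟩)
        (Module.End.hasEigenvector_iff.2 ⟨Module.End.mem_eigenspace_iff.2 (Subtype.ext h1), ?_⟩)
      exact fun h => hx.2 (congrArg Subtype.val h)
    · exact absurd h hμ
  refine ((Set.countable_iUnion fun n => (hfin n).countable).union
    (Set.countable_singleton (0 : ℂ))).mono fun μ hμ => ?_
  by_cases h0 : μ = 0
  · exact Or.inr h0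
  · obtain ⟨n, hn⟩ := exists_nat_one_div_lt (norm_pos_iff.2 h0)
    exact Or.inl (Set.mem_iUnion.2 ⟨n, hμ, hn.le⟩)

end Flags

section TwoSided

variable {Q V : Type*} [NormedAddCommGroup Q] [NormedSpace ℂ Q]
  [NormedAddCommGroup V] [NormedSpace ℂ V]

/-- The operator `R ↦ (1 + k) R (1 + l) - R`. -/
noncomputable def twoSided (k : Q →L[ℂ] Q) (l : V →L[ℂ] V) : (V →L[ℂ] Q) →L[ℂ] (V →L[ℂ] Q) :=
  ContinuousLinearMap.compL ℂ V Q Q (1 + k) * (ContinuousLinearMap.compL ℂ V V Q).flip (1 + l) - 1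

theorem twoSided_apply (k : Q →L[ℂ] Q) (l : V →L[ℂ] V) (R : V →L[ℂ] Q) :
    twoSided k l R = (1 + k) ∘L R ∘L (1 + l) - R := rfl

theorem mem_spectrum_of_compL {a : Q →L[ℂ] Q} {z : ℂ}
    (hz : z ∈ spectrum ℂ (ContinuousLinearMap.compL ℂ V Q Q a)) : z ∈ spectrum ℂ a := by
  by_contra h
  have h : z ∈ resolventSet ℂ a := not_not.1 h
  refine hz (show IsUnit _ from
    ⟨⟨_, ContinuousLinearMap.compL ℂ V Q Q (resolvent a z), ?_, ?_⟩, rfl⟩)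
  · ext R x
    exact DFunLike.congr_fun (sub_mul_resolvent h) (R x)
  · ext R x
    exact DFunLike.congr_fun (resolvent_mul_sub h) (R x)

theorem mem_spectrum_of_compL_flip {b : V →L[ℂ] V} {z : ℂ}
    (hz : z ∈ spectrum ℂ ((ContinuousLinearMap.compL ℂ V V Q).flip b)) : z ∈ spectrum ℂ b := by
  by_contra h
  have h : z ∈ resolventSet ℂ b := not_not.1 h
  refine hz (show IsUnit _ from
    ⟨⟨_, (ContinuousLinearMap.compL ℂ V V Q).flip (resolvent b z), ?_, ?_⟩, rfl⟩)
  · ext R x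
    have := congrArg R (DFunLike.congr_fun (resolvent_mul_sub h) x)
    simpa [Algebra.algebraMap_eq_smul_one] using this
  · ext R x
    have := congrArg R (DFunLike.congr_fun (sub_mul_resolvent h) x)
    simpa [Algebra.algebraMap_eq_smul_one] using this

theorem mem_spectrum_one_add {A : Type*} [Ring A] [Algebra ℂ A] {a : A} {z : ℂ}
    (hz : z ∈ spectrum ℂ (1 + a)) : z - 1 ∈ spectrum ℂ a := by
  rw [spectrum.mem_iff] at hz ⊢
  rwa [map_sub, map_one, sub_sub]

theorem commute_compL_flip (a : Q →L[ℂ] Q) (b : V →L[ℂ] V) :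
    Commute (ContinuousLinearMap.compL ℂ V Q Q a) ((ContinuousLinearMap.compL ℂ V V Q).flip b) :=
  ContinuousLinearMap.ext fun _ => rfl

theorem Commute.exists_spectrum_mul_sub_one {A : Type*} [NormedRing A] [NormedAlgebra ℂ A]
    [CompleteSpace A] {a b : A} (hab : Commute a b) {ν : ℂ} (hν : ν ∈ spectrum ℂ (a * b - 1)) :
    ∃ s ∈ spectrum ℂ a, ∃ t ∈ spectrum ℂ b, ν = s * t - 1 := by
  have h1 : ν + 1 ∈ spectrum ℂ (a * b) := by
    rw [spectrum.mem_iff] at hν ⊢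
    rw [sub_sub_eq_add_sub] at hν
    rwa [map_add, map_one]
  obtain ⟨s, hs, t, ht, hst⟩ := hab.exists_spectrum_mul h1
  exact ⟨s, hs, t, ht, eq_sub_of_add_eq hst⟩

theorem exists_mem_spectrum_of_mul_sub_one {E : Type*} [NormedAddCommGroup E] [NormedSpace ℂ E]
    [CompleteSpace E] {a b : E →L[ℂ] E} (hab : Commute a b) {ν : ℂ}
    (hν : ν ∈ spectrum ℂ (a * b - 1)) :
    ∃ s ∈ spectrum ℂ a, ∃ t ∈ spectrum ℂ b, ν = s * t - 1 :=
  hab.exists_spectrum_mul_sub_one hν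

theorem exists_mem_spectrum_twoSided [CompleteSpace Q] {k : Q →L[ℂ] Q} {l : V →L[ℂ] V} {ν : ℂ}
    (hν : ν ∈ spectrum ℂ (twoSided k l)) :
    ∃ s ∈ spectrum ℂ k, ∃ t ∈ spectrum ℂ l, ν = s + t + s * t := by
  obtain ⟨s, hs, t, ht, hst⟩ := exists_mem_spectrum_of_mul_sub_one
    (commute_compL_flip (1 + k) (1 + l)) hν
  refine ⟨s - 1, mem_spectrum_one_add (mem_spectrum_of_compL hs), t - 1,
    mem_spectrum_one_add (mem_spectrum_of_compL_flip ht), ?_⟩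
  rw [hst]; ring

theorem countable_spectrum_twoSided [CompleteSpace Q] [CompleteSpace V] {k : Q →L[ℂ] Q}
    {l : V →L[ℂ] V} (hk : IsCompactOperator k) (hl : IsCompactOperator l) :
    (spectrum ℂ (twoSided k l)).Countable :=
  (hk.countable_spectrum.image2 hl.countable_spectrum fun s t => s + t + s * t).mono
    fun _ hν => by
      obtain ⟨s, hs, t, ht, h⟩ := exists_mem_spectrum_twoSided hν
      exact ⟨s, hs, t, ht, h.symm⟩

end TwoSided

section Decay

variable {X : Type*} [NormedAddCommGroup X] [NormedSpace ℂ X]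

theorem finiteDimensional_range_of_coFG {y : X →L[ℂ] X} {V U : Submodule ℂ X} (hV : V.CoFG)
    [FiniteDimensional ℂ U] (h : ∀ x ∈ V, y x ∈ U) :
    FiniteDimensional ℂ (LinearMap.range (y : X →ₗ[ℂ] X)) := by
  obtain ⟨W, hW⟩ := Submodule.exists_isCompl V
  have hfin : Module.Finite ℂ (X ⧸ V) := hV
  have : FiniteDimensional ℂ W :=
    Module.Finite.equiv (Submodule.quotientEquivOfIsCompl V W hW)
  refine Submodule.finiteDimensional_of_le (S₂ := U ⊔ W.map (y : X →ₗ[ℂ] X)) ?_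
  rw [← Submodule.map_top, ← hW.sup_eq_top, Submodule.map_sup]
  exact sup_le_sup_right (Submodule.map_le_iff_le_comap.2 h) _

theorem comp_twoSided_pow_comp {V Q : Type*} [NormedAddCommGroup V] [NormedSpace ℂ V]
    [NormedAddCommGroup Q] [NormedSpace ℂ Q] {k l : X →L[ℂ] X} {k' : Q →L[ℂ] Q} {l' : V →L[ℂ] V}
    {q : X →L[ℂ] Q} {i : V →L[ℂ] X} (hq : ∀ x, q (k x) = k' (q x)) (hi : ∀ x, l (i x) = i (l' x))
    (n : ℕ) (R : X →L[ℂ] X) :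
    q ∘L ((twoSided k l ^ n) R) ∘L i = (twoSided k' l' ^ n) (q ∘L R ∘L i) := by
  induction n with
  | zero => rfl
  | succ n ih =>
    rw [pow_succ', pow_succ', mul_apply_eq_comp, mul_apply_eq_comp, ← ih]
    generalize (twoSided k l ^ n) R = S
    ext x
    simp [twoSided_apply, hq, hi]

theorem eq_zero_of_pow_apply {E : Type*} [NormedAddCommGroup E] [NormedSpace ℂ E]
    [CompleteSpace E] {T : E →L[ℂ] E} {c δ C : ℝ} (hc : 0 < c) (hcδ : c < δ)
    (hT : ∀ ν ∈ spectrum ℂ T, ‖ν‖ < c) {y : E}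
    (hy : ∀ n : ℕ, ∃ z, (T ^ n) z = y ∧ ‖z‖ * δ ^ n ≤ C) : y = 0 := by
  have hδ : 0 < δ := hc.trans hcδ
  have hlim : Tendsto (fun n : ℕ => (c / δ) ^ n * C) atTop (𝓝 0) := by
    simpa using (tendsto_pow_atTop_nhds_zero_of_lt_one (r := c / δ) (by positivity)
      ((div_lt_one hδ).2 hcδ)).mul_const C
  rw [← norm_le_zero_iff]
  refine ge_of_tendsto hlim ((eventually_norm_pow_lt_of_spectrum hc hT).mono fun n hn => ?_)
  obtain ⟨z, hz, hzC⟩ := hy n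
  have h2 : ‖z‖ ≤ C / δ ^ n := (le_div_iff₀ (by positivity)).2 hzC
  calc ‖y‖ = ‖(T ^ n) z‖ := by rw [hz]
    _ ≤ ‖T ^ n‖ * ‖z‖ := (T ^ n).le_opNorm z
    _ ≤ c ^ n * (C / δ ^ n) := mul_le_mul hn.le h2 (norm_nonneg _) (by positivity)
    _ = _ := by rw [div_pow]; ring

theorem comp_comp_eq_zero_of_pow_twoSided {V Q : Type*} [NormedAddCommGroup V] [NormedSpace ℂ V]
    [NormedAddCommGroup Q] [NormedSpace ℂ Q] [CompleteSpace Q] {k l : X →L[ℂ] X}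
    {k' : Q →L[ℂ] Q} {l' : V →L[ℂ] V}
    {q : X →L[ℂ] Q} {i : V →L[ℂ] X} (hq : ∀ x, q (k x) = k' (q x)) (hi : ∀ x, l (i x) = i (l' x))
    {η δ C : ℝ} (hη0 : 0 < η) (hη1 : η ≤ 1) (hηδ : 3 * η < δ)
    (hk' : ∀ s ∈ spectrum ℂ k', ‖s‖ < η) (hl' : ∀ t ∈ spectrum ℂ l', ‖t‖ < η)
    {y : X →L[ℂ] X} (hy : ∀ n, ∃ z, (twoSided k l ^ n) z = y ∧ ‖z‖ * δ ^ n ≤ C) :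
    q ∘L y ∘L i = 0 := by
  have hδ : 0 < δ := by linarith
  have hsp : ∀ ν ∈ spectrum ℂ (twoSided k' l'), ‖ν‖ < 3 * η := by
    intro ν hν
    obtain ⟨s, hs, t, ht, rfl⟩ := exists_mem_spectrum_twoSided hν
    have h1 := hk' s hs
    have h2 := hl' t ht
    have h3 : ‖s * t‖ ≤ η * 1 := by
      rw [norm_mul]; exact mul_le_mul h1.le (h2.le.trans hη1) (norm_nonneg _) hη0.le
    linarith [norm_add₃_le (a := s) (b := t) (c := s * t)]
  refine eq_zero_of_pow_apply (by positivity) hηδ hsp (C := ‖q‖ * C * ‖i‖) fun n => ?_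
  obtain ⟨z, hz, hzC⟩ := hy n
  refine ⟨q ∘L z ∘L i, by rw [← hz, comp_twoSided_pow_comp hq hi], ?_⟩
  have h1 : ‖q ∘L z ∘L i‖ ≤ ‖q‖ * (‖z‖ * ‖i‖) :=
    (q.opNorm_comp_le _).trans (mul_le_mul_of_nonneg_left (z.opNorm_comp_le i) (norm_nonneg _))
  calc _ ≤ ‖q‖ * (‖z‖ * ‖i‖) * δ ^ n := mul_le_mul_of_nonneg_right h1 (by positivity)
    _ = ‖q‖ * (‖z‖ * δ ^ n) * ‖i‖ := by ring
    _ ≤ _ := by gcongr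

theorem finiteDimensional_range_of_pow_twoSided [CompleteSpace X] {k l : X →L[ℂ] X}
    (hk : IsCompactOperator k)
    (hl : IsCompactOperator l) {δ C : ℝ} (hδ : 0 < δ) {y : X →L[ℂ] X}
    (hy : ∀ n, ∃ z, (twoSided k l ^ n) z = y ∧ ‖z‖ * δ ^ n ≤ C) :
    FiniteDimensional ℂ (LinearMap.range (y : X →ₗ[ℂ] X)) := by
  obtain ⟨η, hη⟩ : ∃ η, η = min 1 (δ / 4) := ⟨_, rfl⟩
  have hη0 : 0 < η := by rw [hη]; positivity
  have hη1 : η ≤ 1 := by rw [hη]; exact min_le_left _ _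
  have hηδ : 3 * η < δ := by
    have : η ≤ δ / 4 := by rw [hη]; exact min_le_right _ _
    linarith
  obtain ⟨U, hU, hspU⟩ := hk.exists_upFlag_spectrum hη0
  obtain ⟨V, hV, hspV⟩ := hl.exists_downFlag_spectrum (B := {μ | η ≤ ‖μ‖}) hη0 fun μ h => h
  have hUfd := hU.finiteDimensional
  have hUc : IsClosed (U : Set X) := hU.isClosed
  refine finiteDimensional_range_of_coFG (U := U) hV.coFG fun x hx => ?_
  have hzero := comp_comp_eq_zero_of_pow_twoSided (q := U.mkQL) (i := V.subtypeL)
    (fun _ => rfl) (fun _ => rfl) hη0 hη1 hηδ hspU (fun t ht => not_le.1 (hspV t ht)) hy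
  exact (Submodule.Quotient.mk_eq_zero U).1 (DFunLike.congr_fun hzero ⟨x, hx⟩)

/-- In the absence of finite-rank operators, `twoSided k l` is locally quasinilpotent. -/
theorem exists_norm_pow_twoSided_le [CompleteSpace X] {J : Submodule ℂ (X →L[ℂ] X)}
    (hJ : IsClosed (J : Set (X →L[ℂ] X)))
    (hfr : ∀ A ∈ J, FiniteDimensional ℂ (LinearMap.range (A : X →ₗ[ℂ] X)) → A = 0)
    {k l : X →L[ℂ] X} (hk : IsCompactOperator k) (hl : IsCompactOperator l)
    (hinv : ∀ j ∈ J, twoSided k l j ∈ J) {δ : ℝ} (hδ : 0 < δ) {j : X →L[ℂ] X} (hj : j ∈ J) :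
    ∃ C, ∀ n : ℕ, ‖(twoSided k l ^ n) j‖ ≤ C * δ ^ n := by
  have hcount := countable_spectrum_twoSided hk hl
  obtain ⟨ε, hε0, hεδ, hε⟩ := exists_circle_avoiding_countable hcount 0 hδ
  obtain ⟨e, he, C, hC, hy⟩ := exists_spectral_splitting (Ψ := twoSided k l) hJ hε0
    (fun z hz => by
      have hz' : z ∈ resolventSet ℂ (twoSided k l) := by
        by_contra h
        exact hε z h (by simpa using hz)
      exact ⟨hz', fun j hj => resolvent_mem_of_countable_spectrum hcount hJ hinv hz' hj⟩) hj
  have h0 : j - e = 0 := hfr _ (J.sub_mem hj he)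
    (finiteDimensional_range_of_pow_twoSided hk hl hε0 hy)
  have hC0 : 0 ≤ C := by simpa using (norm_nonneg _).trans (hC 0)
  refine ⟨C, fun n => ?_⟩
  rw [sub_eq_zero.1 h0]
  exact (hC n).trans (mul_le_mul_of_nonneg_left (pow_le_pow_left₀ hε0.le hεδ.le n) hC0)

theorem mapsTo_of_downFlag {J : Submodule ℂ (X →L[ℂ] X)} {k l : X →L[ℂ] X}
    (hinv : ∀ j ∈ J, twoSided k l j ∈ J)
    (hdecay : ∀ δ : ℝ, 0 < δ → ∀ j ∈ J, ∃ C, ∀ n : ℕ, ‖(twoSided k l ^ n) j‖ ≤ C * δ ^ n)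
    {B : Set ℂ} {V W : Submodule ℂ X} (hW : DownFlag k B W) (hV : ∀ x ∈ V, l x ∈ V)
    (hB : ∀ μ ∈ B, 1 + μ ≠ 0 ∧
      (1 + μ)⁻¹ - 1 ∉ spectrum ℂ (l.restrict hV : V →L[ℂ] V)) :
    ∀ j ∈ J, ∀ x ∈ V, j x ∈ W := by
  induction hW with
  | top => exact fun _ _ _ _ => trivial
  | @step W μ f _ hμ hf ih =>
    obtain ⟨hμ1, hμs⟩ := hB μ hμ
    obtain ⟨lV, hlV⟩ : ∃ T : V →L[ℂ] V, T = l.restrict hV := ⟨_, rfl⟩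
    rw [← hlV] at hμs
    obtain ⟨m, hm⟩ : ∃ m : V →L[ℂ] V, m = (1 + μ) • (1 + lV) - 1 := ⟨_, rfl⟩
    have hmu : IsUnit m := by
      have h1 : IsUnit (algebraMap ℂ (V →L[ℂ] V) ((1 + μ)⁻¹ - 1) - lV) := not_not.1 hμs
      have h2 : m = algebraMap ℂ (V →L[ℂ] V) (-(1 + μ)) *
          (algebraMap ℂ (V →L[ℂ] V) ((1 + μ)⁻¹ - 1) - lV) := by
        rw [mul_sub, ← map_mul, hm, Algebra.algebraMap_eq_smul_one, Algebra.algebraMap_eq_smul_one,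
          smul_mul_assoc, one_mul]
        have : -(1 + μ) * ((1 + μ)⁻¹ - 1) = (1 + μ) - 1 := by field_simp; ring
        rw [this]
        module
      rw [h2]
      exact ((neg_ne_zero.2 hμ1).isUnit.map (algebraMap ℂ (V →L[ℂ] V))).mul h1
    obtain ⟨u, hu⟩ := hmu
    have hkey : ∀ j ∈ J, ∀ x : V, f (twoSided k l j x) = f (j (m x)) := by
      intro j hj x
      have h1 : f (k (j ((1 + l) x))) = μ * f (j ((1 + l) x)) := by
        refine hf _ (ih j hj _ ?_)
        exact V.add_mem x.2 (hV _ x.2)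
      have h2 : ((m x : V) : X) = (1 + μ) • ((1 + l) (x : X)) - x := by
        rw [hm, hlV]; rfl
      have h3 : twoSided k l j x = j ((1 + l) x) + k (j ((1 + l) x)) - j x := rfl
      rw [h2, h3, map_sub, map_add, h1, map_sub, map_smul, map_sub, map_smul, smul_eq_mul]
      ring
    have hpow : ∀ n : ℕ, ∀ j ∈ J, (twoSided k l ^ n) j ∈ J ∧
        ∀ x : V, f ((twoSided k l ^ n) j x) = f (j ((m ^ n) x)) := by
      intro n
      induction n with
      | zero => exact fun j hj => ⟨hj, fun x => rfl⟩
      | succ n ihn =>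
        intro j hj
        rw [pow_succ, mul_apply_eq_comp]
        refine ⟨(ihn _ (hinv j hj)).1, fun x => ?_⟩
        rw [(ihn _ (hinv j hj)).2, hkey j hj, pow_succ', mul_apply_eq_comp]
    intro j hj x hx
    refine ⟨ih j hj x hx, ?_⟩
    change f (j x) = 0
    obtain ⟨M, hM⟩ : ∃ M, M = ‖((u⁻¹ : (V →L[ℂ] V)ˣ) : V →L[ℂ] V)‖ + 1 := ⟨_, rfl⟩
    have hM1 : 0 < M := by rw [hM]; positivity
    obtain ⟨C, hC⟩ := hdecay (1 / (2 * M)) (by positivity) j hj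
    rw [← norm_le_zero_iff]
    have hlim : Tendsto (fun n : ℕ => (1 / 2 : ℝ) ^ n * (‖f‖ * C * ‖x‖)) atTop (𝓝 0) := by
      have := tendsto_pow_atTop_nhds_zero_of_lt_one (r := (1 / 2 : ℝ)) (by norm_num) (by norm_num)
      simpa using this.mul_const (‖f‖ * C * ‖x‖)
    refine ge_of_tendsto hlim (Eventually.of_forall fun n => ?_)
    obtain ⟨z, hz⟩ : ∃ z : V, z = (((u⁻¹ : (V →L[ℂ] V)ˣ) : V →L[ℂ] V) ^ n) ⟨x, hx⟩ := ⟨_, rfl⟩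
    have hmz : (m ^ n) z = ⟨x, hx⟩ := by
      rw [hz, ← mul_apply_eq_comp, ← hu, ← Units.val_pow_eq_pow_val, ← Units.val_pow_eq_pow_val,
        ← Units.val_mul, inv_pow, mul_inv_cancel, Units.val_one]
      rfl
    have hzn : ‖z‖ ≤ M ^ n * ‖x‖ := by
      rw [hz]
      refine (ContinuousLinearMap.le_opNorm _ _).trans ?_
      refine mul_le_mul_of_nonneg_right ?_ (norm_nonneg _)
      rcases n.eq_zero_or_pos with rfl | hn
      · rw [pow_zero, pow_zero]; exact ContinuousLinearMap.norm_id_le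
      · refine (norm_pow_le' _ hn).trans (pow_le_pow_left₀ (norm_nonneg _) ?_ n)
        rw [hM]; linarith
    have hfz := (hpow n j hj).2 z
    rw [hmz] at hfz
    have hC0 : 0 ≤ C := by simpa using (norm_nonneg _).trans (hC 0)
    calc ‖f (j x)‖ = ‖f ((twoSided k l ^ n) j z)‖ := by rw [hfz]
      _ ≤ ‖f‖ * ‖(twoSided k l ^ n) j z‖ := f.le_opNorm _
      _ ≤ ‖f‖ * ((C * (1 / (2 * M)) ^ n) * (M ^ n * ‖x‖)) := by
        refine mul_le_mul_of_nonneg_left ?_ (norm_nonneg _)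
        refine (ContinuousLinearMap.le_opNorm _ _).trans ?_
        exact mul_le_mul (hC n) hzn (norm_nonneg _) (by positivity)
      _ = _ := by
        have : (1 / (2 * M)) ^ n * M ^ n = (1 / 2 : ℝ) ^ n := by
          rw [← mul_pow]; congr 1; field_simp
        linear_combination ‖f‖ * C * ‖x‖ * this

end Decay

section Words

variable {X : Type*} [NormedAddCommGroup X] [NormedSpace ℂ X] [CompleteSpace X]

theorem notMem_spectrum_of_twoSided (hX : ¬ FiniteDimensional ℂ X)
    {J : Submodule ℂ (X →L[ℂ] X)} (hJ : IsClosed (J : Set (X →L[ℂ] X)))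
    (hfr : ∀ A ∈ J, FiniteDimensional ℂ (LinearMap.range (A : X →ₗ[ℂ] X)) → A = 0)
    (hirr : ∀ M : Submodule ℂ X, IsClosed (M : Set X) → (∀ A ∈ J, ∀ x ∈ M, A x ∈ M) →
      M = ⊥ ∨ M = ⊤)
    {k l : X →L[ℂ] X} (hk : IsCompactOperator k) (hl : IsCompactOperator l)
    (hkl : ∀ j ∈ J, twoSided k l j ∈ J) (hlk : ∀ j ∈ J, twoSided l k j ∈ J)
    {α : ℂ} (hα0 : α ≠ 0) (hα1 : α ≠ 1) : α - 1 ∉ spectrum ℂ k := by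
  intro hspec
  obtain ⟨B, hB⟩ : ∃ B : Set ℂ, B = {α - 1, α⁻¹ - 1} := ⟨_, rfl⟩
  have hα : α - 1 ≠ 0 := sub_ne_zero.2 hα1
  have hα' : α⁻¹ - 1 ≠ 0 := sub_ne_zero.2 (inv_ne_one.2 hα1)
  have hη : 0 < min ‖α - 1‖ ‖α⁻¹ - 1‖ := lt_min (norm_pos_iff.2 hα) (norm_pos_iff.2 hα')
  have hBη : ∀ μ ∈ B, min ‖α - 1‖ ‖α⁻¹ - 1‖ ≤ ‖μ‖ := by
    rw [hB]
    rintro μ (rfl | rfl)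
    · exact min_le_left _ _
    · exact min_le_right _ _
  have hBinv : ∀ μ ∈ B, 1 + μ ≠ 0 ∧ (1 + μ)⁻¹ - 1 ∈ B := by
    rw [hB]
    rintro μ (rfl | rfl)
    · simpa using hα0
    · simpa using hα0
  obtain ⟨V, hV, hspV⟩ := hk.exists_downFlag_spectrum hη hBη
  obtain ⟨W, hW, hspW⟩ := hl.exists_downFlag_spectrum hη hBη
  have hWV : ∀ j ∈ J, ∀ x ∈ W, j x ∈ V :=
    mapsTo_of_downFlag hkl (fun δ hδ j hj => exists_norm_pow_twoSided_le hJ hfr hk hl hkl hδ hj)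
      hV hW.mapsTo fun μ hμ => ⟨(hBinv μ hμ).1, fun h => hspW _ h (hBinv μ hμ).2⟩
  have hVW : ∀ j ∈ J, ∀ x ∈ V, j x ∈ W :=
    mapsTo_of_downFlag hlk (fun δ hδ j hj => exists_norm_pow_twoSided_le hJ hfr hl hk hlk hδ hj)
      hW hV.mapsTo fun μ hμ => ⟨(hBinv μ hμ).1, fun h => hspV _ h (hBinv μ hμ).2⟩
  rcases hirr (V ⊓ W) (hV.isClosed.inter hW.isClosed)
    (fun A hA x hx => ⟨hWV A hA x hx.2, hVW A hA x hx.1⟩) with h | h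
  · have hfg : (⊥ : Submodule ℂ X).CoFG := h ▸ hV.coFG.inf hW.coFG
    have : Module.Finite ℂ (X ⧸ (⊥ : Submodule ℂ X)) := hfg
    exact hX (Module.Finite.equiv (Submodule.quotEquivOfEqBot _ rfl))
  · have hVtop : V = ⊤ := top_le_iff.1 (h ▸ inf_le_left)
    obtain ⟨f, hf0, hf⟩ := hk.exists_functional hα hspec
    refine hf0 (ContinuousLinearMap.ext fun x => ?_)
    have hu : IsUnit (algebraMap ℂ (V →L[ℂ] V) (α - 1) - k.restrict hV.mapsTo) := by
      have hmem : α - 1 ∈ B := by rw [hB]; exact Or.inl rfl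
      exact not_not.1 fun h => hspV _ h hmem
    obtain ⟨u, hu⟩ := hu
    have h1 : (⟨x, hVtop ▸ trivial⟩ : V) = (algebraMap ℂ (V →L[ℂ] V) (α - 1) -
        k.restrict hV.mapsTo) ((u⁻¹ : (V →L[ℂ] V)ˣ).1 ⟨x, hVtop ▸ trivial⟩) := by
      rw [← hu, ← mul_apply_eq_comp, Units.mul_inv]; rfl
    generalize (u⁻¹ : (V →L[ℂ] V)ˣ).1 ⟨x, hVtop ▸ trivial⟩ = y at h1
    have h2 : x = (α - 1) • (y : X) - k y := by
      rw [sub_apply, ContinuousLinearMap.algebraMap_apply] at h1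
      exact congrArg Subtype.val h1
    rw [h2, map_sub, map_smul, hf, smul_eq_mul, sub_self]
    rfl

omit [CompleteSpace X] in
theorem jordan_conj_mem {J : Submodule ℂ (X →L[ℂ] X)}
    (hJordan : ∀ A ∈ J, ∀ B ∈ J, A * B + B * A ∈ J) {a j : X →L[ℂ] X} (ha : a ∈ J) (hj : j ∈ J) :
    (1 + a) * j * (1 + a) ∈ J := by
  have h1 := hJordan a ha j hj
  have h2 := hJordan a ha _ h1
  have h3 := hJordan _ (hJordan a ha a ha) j hj
  have h4 := J.smul_mem (1 / 2 : ℂ) (J.sub_mem h2 (J.smul_mem (1 / 2 : ℂ) h3))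
  convert J.add_mem (J.add_mem hj h1) h4 using 1
  simp only [mul_add, add_mul, smul_add, smul_sub, one_mul, mul_one, ← mul_assoc]
  module

omit [CompleteSpace X] in
theorem exists_one_add_of_list {J : Submodule ℂ (X →L[ℂ] X)}
    (hJordan : ∀ A ∈ J, ∀ B ∈ J, A * B + B * A ∈ J) (hcompact : ∀ A ∈ J, IsCompactOperator A)
    (L : List (X →L[ℂ] X)) (hL : ∀ a ∈ L, a ∈ J) :
    ∃ k l : X →L[ℂ] X, IsCompactOperator k ∧ IsCompactOperator l ∧
      (L.map (1 + ·)).prod = 1 + k ∧ (∀ j ∈ J, (1 + k) * j * (1 + l) ∈ J) ∧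
      ∀ j ∈ J, (1 + l) * j * (1 + k) ∈ J := by
  induction L with
  | nil =>
    exact ⟨0, 0, isCompactOperator_zero, isCompactOperator_zero, by simp, by simp, by simp⟩
  | cons a L ih =>
    obtain ⟨k, l, hk, hl, hprod, h1, h2⟩ := ih fun b hb => hL b (List.mem_cons_of_mem a hb)
    have ha : a ∈ J := hL a List.mem_cons_self
    have hac := hcompact a ha
    refine ⟨k + a + a * k, l + a + l * a, (hk.add hac).add (hac.comp_clm k),
      (hl.add hac).add (hac.clm_comp l), ?_, fun j hj => ?_, fun j hj => ?_⟩
    · rw [List.map_cons, List.prod_cons, hprod]; noncomm_ring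
    · convert jordan_conj_mem hJordan ha (h1 j hj) using 1; noncomm_ring
    · convert h2 _ (jordan_conj_mem hJordan ha hj) using 1; noncomm_ring

theorem list_prod_smul_one_add {A : Type*} [Ring A] [Algebra ℂ A] {c : ℂ} (hc : c ≠ 0)
    (L : List A) :
    (L.map fun a => c • (1 : A) + a).prod = c ^ L.length • (L.map fun a => 1 + c⁻¹ • a).prod := by
  induction L with
  | nil => simp
  | cons a L ih =>
    have h : c • (1 : A) + a = c • (1 + c⁻¹ • a) := by rw [smul_add, smul_inv_smul₀ hc]
    rw [List.map_cons, List.prod_cons, List.map_cons, List.prod_cons, ih, List.length_cons, h,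
      smul_mul_smul_comm, pow_succ']

theorem spectrum_list_prod_subset (hX : ¬ FiniteDimensional ℂ X)
    {J : Submodule ℂ (X →L[ℂ] X)} (hJ : IsClosed (J : Set (X →L[ℂ] X)))
    (hJordan : ∀ A ∈ J, ∀ B ∈ J, A * B + B * A ∈ J) (hcompact : ∀ A ∈ J, IsCompactOperator A)
    (hfr : ∀ A ∈ J, FiniteDimensional ℂ (LinearMap.range (A : X →ₗ[ℂ] X)) → A = 0)
    (hirr : ∀ M : Submodule ℂ X, IsClosed (M : Set X) → (∀ A ∈ J, ∀ x ∈ M, A x ∈ M) →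
      M = ⊥ ∨ M = ⊤)
    (L : List (X →L[ℂ] X)) (hL : ∀ a ∈ L, a ∈ J) (hne : L ≠ []) :
    ∀ μ ∈ spectrum ℂ L.prod, μ = 0 := by
  intro μ hμ
  by_contra hμ0
  have hcpt : IsCompactOperator L.prod := by
    obtain ⟨a, L, rfl⟩ := List.exists_cons_of_ne_nil hne
    rw [List.prod_cons]
    exact (hcompact a (hL a List.mem_cons_self)).comp_clm L.prod
  have hμpos : 0 < ‖μ‖ / 2 := half_pos (norm_pos_iff.2 hμ0)
  have hcont : Continuous fun c : ℂ => (L.map fun a => c • (1 : X →L[ℂ] X) + a).prod :=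
    continuous_list_prod L fun a _ => by fun_prop
  have hlim : Tendsto (fun c : ℂ => (L.map fun a => c • (1 : X →L[ℂ] X) + a).prod) (𝓝 0)
      (𝓝 L.prod) := by
    simpa using hcont.tendsto 0
  have h1 := hlim.eventually (exists_mem_spectrum_near hcpt.countable_spectrum hμ hμpos)
  have h2 : ∀ᶠ c : ℂ in 𝓝 0, ‖c ^ L.length‖ < ‖μ‖ / 2 := by
    have : Continuous fun c : ℂ => ‖c ^ L.length‖ := by fun_prop
    refine this.tendsto 0 |>.eventually (gt_mem_nhds ?_)
    simpa [zero_pow (List.length_pos_iff.2 hne).ne'] using hμ0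
  obtain ⟨c, ⟨⟨ν, hν, hνμ⟩, hc⟩, hc0⟩ :=
    (((h1.and h2).filter_mono nhdsWithin_le_nhds).and self_mem_nhdsWithin :
      ∀ᶠ c : ℂ in 𝓝[≠] 0, _).exists
  have hc0 : c ≠ 0 := hc0
  have hcn : c ^ L.length ≠ 0 := pow_ne_zero _ hc0
  obtain ⟨k, l, hk, hl, hprod, hkl, hlk⟩ := exists_one_add_of_list hJordan hcompact
    (L.map fun a => c⁻¹ • a) fun b hb => by
      obtain ⟨a, ha, rfl⟩ := List.mem_map.1 hb
      exact J.smul_mem _ (hL a ha)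
  rw [List.map_map] at hprod
  have hprod' : (L.map fun a => c • (1 : X →L[ℂ] X) + a).prod = c ^ L.length • (1 + k) := by
    rw [list_prod_smul_one_add hc0, ← hprod]; rfl
  rw [hprod'] at hν
  have hα : ν / c ^ L.length ∈ spectrum ℂ (1 + k) := by
    rw [spectrum.mem_iff] at hν ⊢
    have hu := (Units.mk0 _ hcn).isUnit.map (algebraMap ℂ (X →L[ℂ] X))
    intro h
    apply hν
    convert hu.mul h using 1
    rw [mul_sub, ← map_mul, Units.val_mk0, mul_div_cancel₀ _ hcn, ← Algebra.smul_def]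
  have hgt : 1 < ‖ν / c ^ L.length‖ := by
    rw [norm_div, one_lt_div (norm_pos_iff.2 hcn)]
    have h3 : ‖μ‖ ≤ ‖ν‖ + ‖ν - μ‖ := by
      have := norm_sub_norm_le μ ν
      rw [norm_sub_rev] at this; linarith
    linarith
  refine notMem_spectrum_of_twoSided hX hJ hfr hirr hk hl (fun j hj => ?_) (fun j hj => ?_) ?_ ?_
    (mem_spectrum_one_add hα)
  · exact J.sub_mem (hkl j hj) hj
  · exact J.sub_mem (hlk j hj) hj
  · intro h; rw [h, norm_zero] at hgt; linarith
  · intro h; rw [h, norm_one] at hgt; linarith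

end Words

section Vala

variable {E : Type*} [NormedAddCommGroup E] [NormedSpace ℂ E]

theorem IsCompactOperator.totallyBounded_image_closedBall {a : E →L[ℂ] E}
    (ha : IsCompactOperator a) (r : ℝ) : TotallyBounded (a '' closedBall 0 r) := by
  obtain ⟨K, hK, hsub⟩ := ha.image_closedBall_subset_compact r
  exact hK.totallyBounded.subset hsub

/-- Vala's theorem: two-sided multiplication by compact operators is a compact map. -/
theorem IsCompactOperator.totallyBounded_mul_mul {a b : E →L[ℂ] E} (ha : IsCompactOperator a)
    (hb : IsCompactOperator b) (r : ℝ) :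
    TotallyBounded {T : E →L[ℂ] E | ∃ R : E →L[ℂ] E, ‖R‖ ≤ r ∧ T = a * R * b} := by
  refine totallyBounded_of_finite_discretization fun ε hε => ?_
  rcases lt_or_ge r 0 with hr | hr
  · refine ⟨PUnit, inferInstance, fun _ => PUnit.unit, fun x => ?_⟩
    obtain ⟨R, hR, -⟩ := x.2
    exact absurd (norm_nonneg R) (by linarith)
  obtain ⟨ρ, hρ⟩ : ∃ ρ, ρ = ε / (8 * (‖a‖ * r + 1)) := ⟨_, rfl⟩
  have hρ0 : 0 < ρ := by rw [hρ]; positivity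
  obtain ⟨t, ht, htcov⟩ := totallyBounded_iff.1 (hb.totallyBounded_image_closedBall 1) ρ hρ0
  obtain ⟨M, hM⟩ := ht.isBounded.exists_norm_le
  obtain ⟨u, hu, hucov⟩ := totallyBounded_iff.1 (ha.totallyBounded_image_closedBall (r * M))
    (ε / 16) (by positivity)
  have := ht.fintype
  have := hu.fintype
  choose R hR hTR using fun T : {T : E →L[ℂ] E | ∃ R : E →L[ℂ] E, ‖R‖ ≤ r ∧ T = a * R * b} => T.2
  have hmem : ∀ T, ∀ y : t, ∃ z : u, dist (a (R T y)) z < ε / 16 := by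
    intro T y
    have h1 : a (R T y) ∈ a '' closedBall 0 (r * M) := by
      refine ⟨R T y, ?_, rfl⟩
      rw [mem_closedBall_zero_iff]
      exact ((R T).le_opNorm _).trans (mul_le_mul (hR T) (hM y y.2) (norm_nonneg _) hr)
    obtain ⟨z, hz, hyz⟩ := Set.mem_iUnion₂.1 (hucov h1)
    exact ⟨⟨z, hz⟩, hyz⟩
  choose F hF using hmem
  classical
  refine ⟨t → u, inferInstance, F, fun T T' hTT' => ?_⟩
  rw [dist_eq_norm]
  refine lt_of_le_of_lt (ContinuousLinearMap.opNorm_le_of_unit_norm (C := ε / 2) (by positivity)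
    fun x hx => ?_) (half_lt_self hε)
  obtain ⟨y, hy, hxy⟩ := Set.mem_iUnion₂.1 (htcov ⟨x, by simp [hx], rfl⟩)
  rw [mem_ball, dist_eq_norm] at hxy
  have h1 := hF T ⟨y, hy⟩
  have h2 := hF T' ⟨y, hy⟩
  rw [← hTT', dist_eq_norm] at h2
  rw [dist_eq_norm] at h1
  have h3 : ∀ S, ‖a (R S (b x - y))‖ ≤ ε / 8 := fun S => by
    have h4 : ‖R S (b x - y)‖ ≤ r * ρ := (R S).le_of_opNorm_le_of_le (hR S) hxy.le
    refine (a.le_opNorm_of_le h4).trans ?_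
    rw [hρ, ← mul_assoc, mul_div_assoc', div_le_div_iff₀ (by positivity) (by norm_num)]
    nlinarith
  have h5 : (T.1 - T'.1) x = a (R T (b x - y)) + (a (R T y) - F T ⟨y, hy⟩) -
      (a (R T' y) - F T ⟨y, hy⟩) - a (R T' (b x - y)) := by
    have h6 : ∀ S, S.1 x = a (R S (b x)) := fun S => DFunLike.congr_fun (hTR S) x
    rw [sub_apply, h6, h6, map_sub, map_sub, map_sub, map_sub]; abel
  rw [h5]
  refine (norm_sub_le _ _).trans ?_
  refine (add_le_add_left
    ((norm_sub_le _ _).trans (add_le_add_left (norm_add_le _ _) _)) _).trans ?_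
  linarith [h3 T, h3 T']

end Vala

section Hilden

variable {E : Type*} [NormedAddCommGroup E] [NormedSpace ℂ E]

theorem exists_adjoin_apply_near {S : Set (E →L[ℂ] E)}
    (hS : ∀ M : Submodule ℂ E, IsClosed (M : Set E) → (∀ A ∈ S, ∀ x ∈ M, A x ∈ M) → M = ⊥ ∨ M = ⊤)
    {y : E} (hy : y ≠ 0) (x : E) {ε : ℝ} (hε : 0 < ε) :
    ∃ u ∈ Algebra.adjoin ℂ S, ‖u y - x‖ < ε := by
  obtain ⟨P, hP⟩ : ∃ P : Submodule ℂ E, P = (Subalgebra.toSubmodule (Algebra.adjoin ℂ S)).map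
    ((ContinuousLinearMap.apply ℂ E y : (E →L[ℂ] E) →L[ℂ] E) : (E →L[ℂ] E) →ₗ[ℂ] E) := ⟨_, rfl⟩
  have hmem : ∀ u ∈ Algebra.adjoin ℂ S, u y ∈ P := fun u hu => by
    rw [hP]; exact ⟨u, hu, rfl⟩
  have hPS : ∀ A ∈ S, ∀ z ∈ P, A z ∈ P := by
    rw [hP]
    rintro A hA _ ⟨u, hu, rfl⟩
    exact ⟨A * u, (Algebra.adjoin ℂ S).mul_mem (Algebra.subset_adjoin hA) hu, rfl⟩
  have hcl : P.topologicalClosure = ⊥ ∨ P.topologicalClosure = ⊤ :=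
    hS _ P.isClosed_topologicalClosure fun A hA z hz =>
      map_mem_closure A.continuous hz fun w hw => hPS A hA w hw
  rcases hcl with h | h
  · have : y ∈ P.topologicalClosure := P.le_topologicalClosure (hmem 1 (one_mem _))
    rw [h] at this
    exact absurd this hy
  · have : x ∈ closure (P : Set E) := by
      change x ∈ P.topologicalClosure
      rw [h]; trivial
    obtain ⟨z, hz, hxz⟩ := Metric.mem_closure_iff.1 this ε hε
    rw [SetLike.mem_coe, hP] at hz
    obtain ⟨u, hu, rfl⟩ := hz
    exact ⟨u, hu, by rwa [← dist_eq_norm, dist_comm]⟩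

/-- Hilden's argument: operators close to a given nonzero compact operator cannot be strongly
contractive, after multiplication by a suitable finite set of elements of an irreducible algebra,
for a function dominating the norm. -/
theorem IsCompactOperator.exists_finite_adjoin_not_contractive {S : Set (E →L[ℂ] E)}
    (hS : ∀ M : Submodule ℂ E, IsClosed (M : Set E) → (∀ A ∈ S, ∀ x ∈ M, A x ∈ M) → M = ⊥ ∨ M = ⊤)
    {T : E →L[ℂ] E} (hT : IsCompactOperator T) (hT0 : T ≠ 0) :
    ∃ F : Finset (E →L[ℂ] E), (∀ u ∈ F, u ∈ Algebra.adjoin ℂ S) ∧ ∃ δ > 0,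
      ∀ T' : E →L[ℂ] E, ‖T' - T‖ < δ → ∀ N : E → ℝ, (∀ x, ‖x‖ ≤ N x) →
        ¬ ∀ u ∈ F, ∀ x, N (u (T' x)) ≤ 1 / 2 * N x := by
  obtain ⟨y, hy⟩ : ∃ y, T y ≠ 0 := by
    by_contra! h
    exact hT0 (ContinuousLinearMap.ext h)
  have hy0 : y ≠ 0 := fun h => hy (by rw [h, map_zero])
  obtain ⟨c, hc⟩ := NormedField.exists_lt_norm ℂ (max ((‖T‖ + 1) / ‖T y‖) (2 / ‖y‖))
  obtain ⟨x₀, hx₀⟩ : ∃ x₀, x₀ = c • y := ⟨_, rfl⟩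
  have h1 : ‖T‖ + 1 < ‖T x₀‖ := by
    rw [hx₀, map_smul, norm_smul]
    exact (div_lt_iff₀ (norm_pos_iff.2 hy)).1 ((le_max_left _ _).trans_lt hc)
  have h2 : 2 < ‖x₀‖ := by
    rw [hx₀, norm_smul]
    exact (div_lt_iff₀ (norm_pos_iff.2 hy0)).1 ((le_max_right _ _).trans_lt hc)
  obtain ⟨K, hK, hTK⟩ := hT.image_closedBall_subset_compact (‖x₀‖ + 1)
  have hball : ∀ x ∈ closedBall x₀ 1, ‖x‖ ≤ ‖x₀‖ + 1 := fun x hx => by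
    rw [mem_closedBall, dist_eq_norm] at hx
    linarith [norm_le_norm_add_norm_sub' x x₀]
  obtain ⟨K', hK'⟩ : ∃ K', K' = closure (T '' closedBall x₀ 1) := ⟨_, rfl⟩
  have hK'c : IsCompact K' := by
    rw [hK']
    refine hK.closure_of_subset ?_
    rintro _ ⟨x, hx, rfl⟩
    exact hTK ⟨x, mem_closedBall_zero_iff.2 (hball x hx), rfl⟩
  have hK'0 : ∀ z ∈ K', z ≠ 0 := by
    have : K' ⊆ {z | 1 ≤ ‖z‖} := by
      rw [hK']
      refine closure_minimal ?_ (isClosed_le continuous_const continuous_norm)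
      rintro _ ⟨x, hx, rfl⟩
      rw [mem_closedBall, dist_eq_norm] at hx
      have h3 : ‖T (x - x₀)‖ ≤ ‖T‖ * 1 := T.le_opNorm_of_le hx
      rw [map_sub] at h3
      have := norm_le_norm_add_norm_sub (T x) (T x₀)
      change 1 ≤ ‖T x‖
      linarith
    intro z hz h0
    have h1 : 1 ≤ ‖z‖ := this hz
    rw [h0, norm_zero] at h1
    linarith
  choose! u hu hux using fun z (hz : z ∈ K') => exists_adjoin_apply_near hS (hK'0 z hz) x₀ one_pos
  obtain ⟨t, htK⟩ := hK'c.elim_nhds_subcover' (fun z _ => {w | ‖u z w - x₀‖ < 1})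
    fun z hz => (isOpen_lt (by fun_prop) continuous_const).mem_nhds (hux z hz)
  obtain ⟨ρ, hρ, hthick⟩ := hK'c.exists_thickening_subset_open
    (isOpen_biUnion fun (z : K') (_ : z ∈ t) =>
      (isOpen_lt (by fun_prop) continuous_const : IsOpen {w | ‖u z w - x₀‖ < 1})) htK
  classical
  refine ⟨t.image fun z : K' => u z, fun v hv => ?_, ρ / (‖x₀‖ + 1), by positivity, ?_⟩
  · obtain ⟨z, -, rfl⟩ := Finset.mem_image.1 hv
    exact hu z z.2
  intro T' hT' N hN hcon
  have hstep : ∀ x ∈ closedBall x₀ 1, ∃ x' ∈ closedBall x₀ 1, N x' ≤ 1 / 2 * N x := by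
    intro x hx
    have hmem : T' x ∈ thickening ρ K' := by
      rw [mem_thickening_iff]
      refine ⟨T x, by rw [hK']; exact subset_closure ⟨x, hx, rfl⟩, ?_⟩
      rw [dist_eq_norm, ← sub_apply]
      refine ((T' - T).le_opNorm_of_le (hball x hx)).trans_lt ?_
      exact (lt_div_iff₀ (by positivity)).1 hT'
    obtain ⟨z, hz, hzx⟩ := Set.mem_iUnion₂.1 (hthick hmem)
    refine ⟨u z (T' x), ?_, hcon _ (Finset.mem_image_of_mem _ hz) x⟩
    rw [mem_closedBall, dist_eq_norm]
    exact le_of_lt hzx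
  choose! g hg hgN using hstep
  have hiter : ∀ n : ℕ, g^[n] x₀ ∈ closedBall x₀ 1 ∧ N (g^[n] x₀) ≤ (1 / 2) ^ n * N x₀ := by
    intro n
    induction n with
    | zero => simp
    | succ n ih =>
      rw [Function.iterate_succ_apply', pow_succ', mul_assoc]
      exact ⟨hg _ ih.1, (hgN _ ih.1).trans (mul_le_mul_of_nonneg_left ih.2 (by norm_num))⟩
  have hlim : Tendsto (fun n : ℕ => (1 / 2 : ℝ) ^ n * N x₀) atTop (𝓝 0) := by
    simpa using (tendsto_pow_atTop_nhds_zero_of_lt_one (r := (1 / 2 : ℝ)) (by norm_num)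
      (by norm_num)).mul_const (N x₀)
  have : (1 : ℝ) ≤ 0 := by
    refine ge_of_tendsto hlim (Eventually.of_forall fun n => ?_)
    refine le_trans ?_ ((hN _).trans (hiter n).2)
    have h3 := (hiter n).1
    rw [mem_closedBall, dist_eq_norm] at h3
    linarith [norm_le_norm_add_norm_sub (g^[n] x₀) x₀]
  linarith

theorem exists_finite_bound_of_mem_adjoin {S : Set (E →L[ℂ] E)} {u : E →L[ℂ] E}
    (hu : u ∈ Algebra.adjoin ℂ S) :
    ∃ t : Set (E →L[ℂ] E), t.Finite ∧ t ⊆ S ∧ ∃ κ : ℝ, 0 ≤ κ ∧ ∀ N : Seminorm ℂ E,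
      (∀ a ∈ t, ∀ x, N (a x) ≤ 2 * N x) → ∀ x, N (u x) ≤ κ * N x := by
  induction hu using Algebra.adjoin_induction with
  | mem a ha =>
    exact ⟨{a}, Set.finite_singleton a, Set.singleton_subset_iff.2 ha, 2, by norm_num,
      fun N h => h a rfl⟩
  | algebraMap r =>
    refine ⟨∅, Set.finite_empty, Set.empty_subset _, ‖r‖, norm_nonneg r, fun N _ x => ?_⟩
    rw [ContinuousLinearMap.algebraMap_apply, map_smul_eq_mul]
  | add u v _ _ hu hv =>
    obtain ⟨t, ht, htS, κ, hκ, h⟩ := hu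
    obtain ⟨t', ht', htS', κ', hκ', h'⟩ := hv
    refine ⟨t ∪ t', ht.union ht', Set.union_subset htS htS', κ + κ', by positivity,
      fun N hN x => ?_⟩
    rw [add_mul]
    exact (map_add_le_add N _ _).trans (add_le_add (h N (fun a ha => hN a (Or.inl ha)) x)
      (h' N (fun a ha => hN a (Or.inr ha)) x))
  | mul u v _ _ hu hv =>
    obtain ⟨t, ht, htS, κ, hκ, h⟩ := hu
    obtain ⟨t', ht', htS', κ', hκ', h'⟩ := hv
    refine ⟨t ∪ t', ht.union ht', Set.union_subset htS htS', κ * κ', by positivity,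
      fun N hN x => ?_⟩
    rw [mul_assoc]
    exact (h N (fun a ha => hN a (Or.inl ha)) (v x)).trans
      (mul_le_mul_of_nonneg_left (h' N (fun a ha => hN a (Or.inr ha)) x) hκ)

theorem IsCompactOperator.exists_finite_not_contractive {S : Set (E →L[ℂ] E)}
    (hS : ∀ M : Submodule ℂ E, IsClosed (M : Set E) → (∀ A ∈ S, ∀ x ∈ M, A x ∈ M) → M = ⊥ ∨ M = ⊤)
    {T : E →L[ℂ] E} (hT : IsCompactOperator T) (hT0 : T ≠ 0) :
    ∃ t : Set (E →L[ℂ] E), t.Finite ∧ t ⊆ S ∧ ∃ κ > 0, ∃ δ > 0,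
      ∀ T' : E →L[ℂ] E, ‖T' - T‖ < δ → ∀ N : Seminorm ℂ E, (∀ x, ‖x‖ ≤ N x) →
        (∀ a ∈ t, ∀ x, N (a x) ≤ 2 * N x) → ¬ ∀ x, N (T' x) ≤ κ * N x := by
  obtain ⟨F, hF, δ, hδ, h⟩ := hT.exists_finite_adjoin_not_contractive hS hT0
  choose! t ht htS κ hκ hbound using
    fun u (hu : u ∈ F) => exists_finite_bound_of_mem_adjoin (hF u hu)
  obtain ⟨M, hM⟩ : ∃ M, M = ∑ u ∈ F, κ u := ⟨_, rfl⟩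
  have hM0 : 0 ≤ M := by rw [hM]; exact Finset.sum_nonneg hκ
  refine ⟨⋃ u ∈ F, t u, F.finite_toSet.biUnion ht, Set.iUnion₂_subset htS, 1 / (2 * (M + 1)),
    by positivity, δ, hδ, fun T' hT' N hN hNt hNT => h T' hT' N hN fun u hu x => ?_⟩
  have h1 := hbound u hu N (fun a ha => hNt a (Set.mem_biUnion hu ha)) (T' x)
  have h2 : κ u ≤ M := by rw [hM]; exact Finset.single_le_sum hκ hu
  have h0 := apply_nonneg N x
  calc N (u (T' x)) ≤ κ u * N (T' x) := h1
    _ ≤ (M + 1) * (1 / (2 * (M + 1)) * N x) :=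
      mul_le_mul (by linarith) (hNT x) (apply_nonneg N _) (by positivity)
    _ = _ := by field_simp

end Hilden

section WordNorms

variable {E : Type*} [NormedAddCommGroup E] [NormedSpace ℂ E] {ι : Type*} {b : ι → E →L[ℂ] E}

theorem norm_list_prod_append_le (l l' : List ι) :
    ‖((l ++ l').map b).prod‖ ≤ ‖(l.map b).prod‖ * ‖(l'.map b).prod‖ := by
  rw [List.map_append, List.prod_append]; exact norm_mul_le _ _

theorem exists_seminorm_of_bounded_words {c C : ℝ} (hc : 0 < c)
    (hC : ∀ l : List ι, ‖(l.map b).prod‖ ≤ C * c ^ l.length) :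
    ∃ N : Seminorm ℂ E, (∀ x, ‖x‖ ≤ N x) ∧
      ∀ (l : List ι) (x : E), N ((l.map b).prod x) ≤ c ^ l.length * N x := by
  have hbdd : ∀ x,
      BddAbove (Set.range fun l : List ι => (c ^ l.length)⁻¹ * ‖(l.map b).prod x‖) := by
    refine fun x => ⟨C * ‖x‖, ?_⟩
    rintro _ ⟨l, rfl⟩
    have h := (l.map b).prod.le_of_opNorm_le (hC l) x
    change (c ^ l.length)⁻¹ * ‖(l.map b).prod x‖ ≤ C * ‖x‖
    rw [inv_mul_le_iff₀ (by positivity)]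
    linarith
  have hle : ∀ (l : List ι) x, (c ^ l.length)⁻¹ * ‖(l.map b).prod x‖ ≤
      ⨆ l : List ι, (c ^ l.length)⁻¹ * ‖(l.map b).prod x‖ := fun l x => le_ciSup (hbdd x) l
  refine ⟨Seminorm.ofSMulLE (fun x => ⨆ l : List ι, (c ^ l.length)⁻¹ * ‖(l.map b).prod x‖)
    (by simp) (fun x y => ciSup_le fun l => ?_) (fun r x => ciSup_le fun l => ?_),
    fun x => ?_, fun l x => ciSup_le fun l' => ?_⟩
  · refine le_trans ?_ (add_le_add (hle l x) (hle l y))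
    rw [map_add, ← mul_add]
    exact mul_le_mul_of_nonneg_left (norm_add_le _ _) (by positivity)
  · rw [map_smul, norm_smul, mul_left_comm]
    exact mul_le_mul_of_nonneg_left (hle l x) (norm_nonneg _)
  · exact le_trans (by simp) (hle [] x)
  · have h := hle (l' ++ l) x
    rw [List.map_append, List.prod_append, List.length_append, pow_add, mul_inv] at h
    change _ ≤ c ^ l.length * ⨆ l : List ι, (c ^ l.length)⁻¹ * ‖(l.map b).prod x‖
    rw [← inv_mul_le_iff₀ (by positivity)]
    refine le_trans (le_of_eq ?_) h
    rw [mul_apply_eq_comp]; ring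

theorem exists_bound_words [Finite ι] {c : ℝ} (hc : 0 < c) {n : ℕ} (hn : n ≠ 0)
    (h : ∀ l : List ι, l.length = n → ‖(l.map b).prod‖ ≤ c ^ n) :
    ∃ C, ∀ l : List ι, ‖(l.map b).prod‖ ≤ C * c ^ l.length := by
  have hfin : {l : List ι | l.length < n}.Finite := List.finite_length_lt ι n
  obtain ⟨C, hC⟩ := (hfin.image fun l : List ι => ‖(l.map b).prod‖ / c ^ l.length).bddAbove
  refine ⟨C, fun l => ?_⟩
  induction hm : l.length using Nat.strong_induction_on generalizing l with
  | _ m ih =>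
    rcases lt_or_ge m n with hmn | hmn
    · have := hC ⟨l, hm.trans_lt hmn, rfl⟩
      rw [← hm]
      exact (div_le_iff₀ (by positivity)).1 this
    · have h1 := ih (m - n) (by omega) (l.drop n) (by simp [hm])
      have h2 := h (l.take n) (by simp [hm, hmn])
      rw [← List.take_append_drop n l]
      refine (norm_list_prod_append_le _ _).trans
        ((mul_le_mul h2 h1 (norm_nonneg _) (by positivity)).trans (le_of_eq ?_))
      rw [mul_left_comm, ← pow_add, Nat.add_sub_cancel' hmn]

end WordNorms

section WordCompactness

theorem TotallyBounded.exists_tendsto_subseq {α : Type*} [PseudoMetricSpace α] [CompleteSpace α]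
    {s : Set α} (hs : TotallyBounded s) {u : ℕ → α} (hu : ∀ n, u n ∈ s) :
    ∃ a, ∃ φ : ℕ → ℕ, StrictMono φ ∧ Tendsto (u ∘ φ) atTop (𝓝 a) := by
  obtain ⟨a, -, φ, hφ, h⟩ := (hs.closure.isCompact_of_isClosed isClosed_closure).tendsto_subseq
    fun n => subset_closure (hu n)
  exact ⟨a, φ, hφ, h⟩

theorem List.exists_eq_cons_append_singleton {ι : Type*} {l : List ι} (hl : 2 ≤ l.length) :
    ∃ i l' j, l = i :: (l' ++ [j]) := by
  cases l with
  | nil => simp at hl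
  | cons i l =>
    have hne : l ≠ [] := by rintro rfl; simp at hl
    exact ⟨i, l.dropLast, l.getLast hne, by rw [List.dropLast_append_getLast hne]⟩

variable {E : Type*} [NormedAddCommGroup E] [NormedSpace ℂ E] {ι : Type*} {b : ι → E →L[ℂ] E}

theorem isCompactOperator_word (hb : ∀ i, IsCompactOperator (b i)) {l : List ι} (hl : l ≠ []) :
    IsCompactOperator ((l.map b).prod) := by
  cases l with
  | nil => exact absurd rfl hl
  | cons i l =>
    rw [List.map_cons, List.prod_cons]
    exact (hb i).comp_clm _

theorem word_cons_append_singleton (i j : ι) (l : List ι) :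
    ((i :: (l ++ [j])).map b).prod = b i * (l.map b).prod * b j := by
  simp [mul_assoc]

variable [Finite ι]

theorem totallyBounded_words (hb : ∀ i, IsCompactOperator (b i)) {C : ℝ}
    (hC : ∀ l : List ι, ‖(l.map b).prod‖ ≤ C) :
    TotallyBounded {T | ∃ l : List ι, l ≠ [] ∧ T = (l.map b).prod} := by
  have hTB : TotallyBounded (Set.range b ∪ ⋃ p : ι × ι, {T : E →L[ℂ] E | ∃ R : E →L[ℂ] E,
      ‖R‖ ≤ C ∧ T = b p.1 * R * b p.2}) :=
    (Set.finite_range b).totallyBounded.union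
      (totallyBounded_iUnion.2 fun p => (hb p.1).totallyBounded_mul_mul (hb p.2) C)
  refine hTB.subset ?_
  rintro _ ⟨l, hl, rfl⟩
  rcases lt_or_ge l.length 2 with h | h
  · left
    rcases l with - | ⟨i, - | ⟨j, l⟩⟩
    · exact absurd rfl hl
    · exact ⟨i, by simp⟩
    · simp at h
  · right
    obtain ⟨i, l', j, rfl⟩ := List.exists_eq_cons_append_singleton h
    exact Set.mem_iUnion.2 ⟨(i, j), _, hC l', word_cons_append_singleton i j l'⟩

theorem exists_words_mul_near (hb : ∀ i, IsCompactOperator (b i)) {C : ℝ}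
    (hC : ∀ l : List ι, ‖(l.map b).prod‖ ≤ C)
    (hlong : ∀ n : ℕ, n ≠ 0 → ∃ l : List ι, l.length = n ∧ 1 ≤ ‖(l.map b).prod‖)
    {ε : ℝ} (hε : 0 < ε) :
    ∃ q v : List ι, q ≠ [] ∧ v ≠ [] ∧ ‖(q.map b).prod * (v.map b).prod - (v.map b).prod‖ < ε ∧
      1 ≤ C * ‖(v.map b).prod‖ := by
  obtain ⟨t, ht, hcov⟩ := totallyBounded_iff.1 (totallyBounded_words hb hC) (ε / 2) (by positivity)
  have := ht.fintype
  obtain ⟨l, hl, hl1⟩ := hlong (Fintype.card t + 1) (by omega)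
  have hnear : ∀ p : Fin (Fintype.card t + 1), ∃ z : t, dist ((l.drop p).map b).prod z < ε / 2 := by
    intro p
    obtain ⟨z, hz, h⟩ := Set.mem_iUnion₂.1 (hcov ⟨l.drop p, by
      rw [Ne, List.drop_eq_nil_iff]; omega, rfl⟩)
    exact ⟨⟨z, hz⟩, h⟩
  choose F hF using hnear
  obtain ⟨p, p', hne, hpp⟩ := Fintype.exists_ne_map_eq_of_card_lt F (by simp)
  wlog hlt : p < p' generalizing p p'
  · exact this p' p hne.symm hpp.symm (lt_of_le_of_ne (not_lt.1 hlt) hne.symm)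
  have hlt' : (p : ℕ) < p' := hlt
  have hdrop : l.drop p = (l.drop p).take (p' - p) ++ l.drop p' := by
    conv_lhs => rw [← List.take_append_drop (p' - p) (l.drop p), List.drop_drop]
    rw [Nat.add_sub_cancel' hlt'.le]
  refine ⟨(l.drop p).take (p' - p), l.drop p', ?_, ?_, ?_, ?_⟩
  · rw [Ne, List.take_eq_nil_iff, List.drop_eq_nil_iff]; omega
  · rw [Ne, List.drop_eq_nil_iff]; omega
  · rw [← List.prod_append, ← List.map_append, ← hdrop, ← dist_eq_norm]
    have h1 := hF p
    have h2 := hF p'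
    rw [hpp] at h1
    linarith [dist_triangle_right ((l.drop p).map b).prod ((l.drop p').map b).prod
      ((F p' : E →L[ℂ] E))]
  · refine hl1.trans ?_
    conv_lhs => rw [← List.take_append_drop p' l]
    exact (norm_list_prod_append_le _ _).trans
      (mul_le_mul_of_nonneg_right (hC _) (norm_nonneg _))

variable [CompleteSpace E]

/-- If the joint spectral radius of an irreducible finite family of compact operators is at most
one, then the products of its members are uniformly bounded. -/
theorem exists_bound_words_of_irreducible (hb : ∀ i, IsCompactOperator (b i))
    (hirr : ∀ M : Submodule ℂ E, IsClosed (M : Set E) → (∀ i, ∀ x ∈ M, b i x ∈ M) → M = ⊥ ∨ M = ⊤)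
    (ha : ∀ c : ℝ, 1 < c → ∃ C, ∀ l : List ι, ‖(l.map b).prod‖ ≤ C * c ^ l.length) :
    ∃ C, ∀ l : List ι, ‖(l.map b).prod‖ ≤ C := by
  by_contra! hunb
  obtain ⟨M, hM1, hM⟩ : ∃ M : ℝ, 1 ≤ M ∧ ∀ i, ‖b i‖ ≤ M := by
    obtain ⟨M, hM⟩ := (Set.finite_range fun i => ‖b i‖).bddAbove
    exact ⟨max 1 M, le_max_left _ _, fun i => (hM ⟨i, rfl⟩).trans (le_max_right _ _)⟩
  have hmin : ∀ k : ℕ, ∃ (i : ι) (l : List ι) (j : ι), (k : ℝ) + M < ‖b i * (l.map b).prod * b j‖ ∧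
      ‖(l.map b).prod‖ ≤ k + M := by
    intro k
    obtain ⟨l, hl, hlm⟩ := (measure (List.length (α := ι))).wf.has_min
      {l | (k : ℝ) + M < ‖(l.map b).prod‖} (hunb _)
    have hl' : (k : ℝ) + M < ‖(l.map b).prod‖ := hl
    have hk : (0 : ℝ) ≤ k := k.cast_nonneg
    have h2 : 2 ≤ l.length := by
      by_contra! h
      rcases l with - | ⟨i, - | ⟨j, l⟩⟩
      · rw [List.map_nil, List.prod_nil] at hl'
        have : ‖(1 : E →L[ℂ] E)‖ ≤ 1 := ContinuousLinearMap.norm_id_le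
        linarith
      · simp only [List.map_cons, List.map_nil, List.prod_cons, List.prod_nil, mul_one] at hl'
        linarith [hM i]
      · simp at h
    obtain ⟨i, l', j, rfl⟩ := List.exists_eq_cons_append_singleton h2
    rw [word_cons_append_singleton] at hl'
    refine ⟨i, l', j, hl', not_lt.1 fun h => hlm l' h ?_⟩
    change l'.length < _
    simp
  choose i l j hbig hsmall using hmin
  obtain ⟨W, hW⟩ : ∃ W : ℕ → E →L[ℂ] E, ∀ k, W k = b (i k) * ((l k).map b).prod * b (j k) :=
    ⟨_, fun k => rfl⟩
  have hWbig : ∀ k : ℕ, (k : ℝ) + 1 < ‖W k‖ := fun k => by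
    rw [hW]; linarith [hbig k]
  have hWpos : ∀ k, 0 < ‖W k‖ := fun k => by
    have : (0 : ℝ) ≤ k := k.cast_nonneg
    linarith [hWbig k]
  obtain ⟨T, hT⟩ : ∃ T : ℕ → E →L[ℂ] E, ∀ k, T k = ((‖W k‖ : ℂ)⁻¹) • W k := ⟨_, fun k => rfl⟩
  have hTnorm : ∀ k, ‖T k‖ = 1 := fun k => by
    rw [hT, norm_smul, norm_inv, Complex.norm_real, norm_norm, inv_mul_cancel₀ (hWpos k).ne']
  have hTcomp : ∀ k, IsCompactOperator (T k) := fun k => by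
    rw [hT, hW, mul_assoc]
    exact ((hb (i k)).comp_clm _).smul _
  have hTB : TotallyBounded (⋃ p : ι × ι, {T : E →L[ℂ] E | ∃ R : E →L[ℂ] E, ‖R‖ ≤ 1 ∧
      T = b p.1 * R * b p.2}) :=
    totallyBounded_iUnion.2 fun p => (hb p.1).totallyBounded_mul_mul (hb p.2) 1
  obtain ⟨T₀, φ, hφ, hlim⟩ := hTB.exists_tendsto_subseq (u := T) fun k => by
    refine Set.mem_iUnion.2 ⟨(i k, j k), ((‖W k‖ : ℂ)⁻¹) • ((l k).map b).prod, ?_, ?_⟩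
    · rw [norm_smul, norm_inv, Complex.norm_real, norm_norm, inv_mul_le_one₀ (hWpos k), hW]
      exact (hsmall k).trans (hbig k).le
    · rw [hT, hW, mul_smul_comm, smul_mul_assoc]
  have hT₀ : ‖T₀‖ = 1 := tendsto_nhds_unique hlim.norm (by simp [hTnorm])
  have hT₀c : IsCompactOperator T₀ := isClosed_setOfPred_isCompactOperator.mem_of_tendsto hlim
    (Eventually.of_forall fun k => hTcomp (φ k))
  obtain ⟨t, -, htb, κ, hκ, δ, hδ, hcon⟩ := hT₀c.exists_finite_not_contractive (S := Set.range b)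
    (fun N hN h => hirr N hN fun i => h _ ⟨i, rfl⟩) (fun h => by simp [h] at hT₀)
  obtain ⟨k, hk1, hk2⟩ := ((hlim.eventually (ball_mem_nhds T₀ hδ)).and
    ((tendsto_natCast_atTop_atTop (R := ℝ)).eventually_ge_atTop (2 / κ))).exists
  rw [dist_eq_norm] at hk1
  obtain ⟨w, hw⟩ : ∃ w, w = i (φ k) :: (l (φ k) ++ [j (φ k)]) := ⟨_, rfl⟩
  have hwW : (w.map b).prod = W (φ k) := by rw [hw, hW, word_cons_append_singleton]
  obtain ⟨c, hc1, hc2⟩ : ∃ c : ℝ, 1 < c ∧ c ^ w.length ≤ 2 ∧ c ≤ 2 := by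
    have h1 : Tendsto (fun c : ℝ => c ^ w.length) (𝓝[>] 1) (𝓝 1) := by
      have : Continuous fun c : ℝ => c ^ w.length := by fun_prop
      simpa using (this.tendsto 1).mono_left nhdsWithin_le_nhds
    have h2 : Tendsto (fun c : ℝ => c) (𝓝[>] 1) (𝓝 1) := nhdsWithin_le_nhds
    obtain ⟨c, ⟨h3, h4⟩, h5⟩ := (((h1.eventually_le_const one_lt_two).and
      (h2.eventually_le_const one_lt_two)).and self_mem_nhdsWithin).exists
    exact ⟨c, h5, h3, h4⟩
  obtain ⟨C, hC⟩ := ha c hc1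
  obtain ⟨N, hN1, hN2⟩ := exists_seminorm_of_bounded_words (by linarith) hC
  refine hcon (T (φ k)) hk1 N hN1 ?_ fun x => ?_
  · intro a hat x
    obtain ⟨i, rfl⟩ := htb hat
    have h1 := hN2 [i] x
    simp only [List.map_cons, List.map_nil, List.prod_cons, List.prod_nil, mul_one,
      List.length_cons, List.length_nil, zero_add, pow_one] at h1
    exact h1.trans (mul_le_mul_of_nonneg_right hc2.2 (apply_nonneg N x))
  · have h1 := hN2 w x
    rw [hwW] at h1
    have hkφ : (k : ℝ) ≤ φ k := Nat.cast_le.2 (hφ.id_le k)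
    have h2 : 2 ≤ κ * ‖W (φ k)‖ := by
      rw [mul_comm, ← div_le_iff₀ hκ]
      linarith [hWbig (φ k)]
    rw [hT, smul_apply, map_smul_eq_mul, norm_inv, Complex.norm_real, norm_norm,
      inv_mul_le_iff₀ (hWpos _)]
    have h0 := apply_nonneg N x
    refine h1.trans ((mul_le_mul_of_nonneg_right (hc2.1.trans h2) h0).trans (le_of_eq (by ring)))

theorem one_mem_spectrum_of_mul_eq {A : Type*} [Ring A] [Algebra ℂ A] {S V : A} (h : S * V = V)
    (hV : V ≠ 0) : (1 : ℂ) ∈ spectrum ℂ S := by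
  intro hu
  refine hV ((hu.mul_right_eq_zero).1 ?_)
  rw [map_one, sub_mul, one_mul, h, sub_self]

theorem false_of_bounded_words (hb : ∀ i, IsCompactOperator (b i)) {C : ℝ}
    (hC : ∀ l : List ι, ‖(l.map b).prod‖ ≤ C)
    (hlong : ∀ n : ℕ, n ≠ 0 → ∃ l : List ι, l.length = n ∧ 1 ≤ ‖(l.map b).prod‖)
    (hqn : ∀ l : List ι, l ≠ [] → ∀ c : ℝ, 0 < c → ∃ n : ℕ, n ≠ 0 ∧ ‖(l.map b).prod ^ n‖ < c ^ n) :
    False := by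
  choose q v hq hv hqv hvC using fun k : ℕ =>
    exists_words_mul_near hb hC hlong (Nat.one_div_pos_of_nat (α := ℝ) (n := k))
  obtain ⟨S, φ, hφ, hS⟩ := (totallyBounded_words hb hC).exists_tendsto_subseq
    (u := fun k => ((q k).map b).prod) fun k => ⟨_, hq k, rfl⟩
  obtain ⟨V, ψ, hψ, hV⟩ := (totallyBounded_words hb hC).exists_tendsto_subseq
    (u := fun k => ((v (φ k)).map b).prod) fun k => ⟨_, hv _, rfl⟩
  have hS' := hS.comp hψ.tendsto_atTop
  have hSV : S * V = V := by
    have h0 : Tendsto (fun k => ((q (φ (ψ k))).map b).prod * ((v (φ (ψ k))).map b).prod -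
        ((v (φ (ψ k))).map b).prod) atTop (𝓝 0) :=
      squeeze_zero_norm (fun k => (hqv _).le)
        (tendsto_one_div_add_atTop_nhds_zero_nat.comp (hφ.comp hψ).tendsto_atTop)
    exact sub_eq_zero.1 (tendsto_nhds_unique ((hS'.mul hV).sub hV) h0)
  have hV0 : V ≠ 0 := by
    rintro rfl
    have h1 : (1 : ℝ) ≤ C * ‖(0 : E →L[ℂ] E)‖ :=
      ge_of_tendsto (hV.norm.const_mul C) (Eventually.of_forall fun k => hvC _)
    simp at h1
    linarith
  have hSc : IsCompactOperator S := isClosed_setOfPred_isCompactOperator.mem_of_tendsto hS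
    (Eventually.of_forall fun k => isCompactOperator_word hb (hq (φ k)))
  obtain ⟨k, ν, hν, hν1⟩ := (hS.eventually (exists_mem_spectrum_near hSc.countable_spectrum
    (one_mem_spectrum_of_mul_eq hSV hV0) one_half_pos)).exists
  obtain ⟨n, hn, hlt⟩ := hqn _ (hq (φ k)) (1 / 2) one_half_pos
  have h1 : ‖ν ^ n‖ ≤ ‖((q (φ k)).map b).prod ^ n‖ * ‖(1 : E →L[ℂ] E)‖ :=
    spectrum.norm_le_norm_mul_of_mem (spectrum.pow_mem_pow _ n hν)
  have h2 : ‖(1 : E →L[ℂ] E)‖ ≤ 1 := ContinuousLinearMap.norm_id_le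
  have h3 : 1 / 2 ≤ ‖ν‖ := by
    have := norm_sub_norm_le (1 : ℂ) ν
    rw [norm_one, norm_sub_rev] at this
    linarith
  have h4 : (1 / 2 : ℝ) ^ n ≤ ‖ν‖ ^ n := pow_le_pow_left₀ (by norm_num) h3 n
  rw [norm_pow] at h1
  have h5 := mul_le_mul_of_nonneg_left h2 (norm_nonneg (((q (φ k)).map b).prod ^ n))
  linarith

end WordCompactness

section JointSpectralRadius

theorem list_prod_map_const_smul {A : Type*} [Ring A] [Algebra ℂ A] {ι : Type*} (c : ℂ)
    (b : ι → A) (l : List ι) : (l.map fun i => c • b i).prod = c ^ l.length • (l.map b).prod := by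
  induction l with
  | nil => simp
  | cons i l ih =>
    rw [List.map_cons, List.prod_cons, ih, List.map_cons, List.prod_cons, List.length_cons,
      smul_mul_smul_comm, pow_succ']

variable {E : Type*} [NormedAddCommGroup E] [NormedSpace ℂ E] [CompleteSpace E]
  {ι : Type*} [Finite ι] {b : ι → E →L[ℂ] E}

/-- For an irreducible finite family of compact operators all of whose products are quasinilpotent,
long products are small in norm. -/
theorem exists_norm_words_le_half (hb : ∀ i, IsCompactOperator (b i))
    (hirr : ∀ M : Submodule ℂ E, IsClosed (M : Set E) → (∀ i, ∀ x ∈ M, b i x ∈ M) → M = ⊥ ∨ M = ⊤)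
    (hqn : ∀ l : List ι, l ≠ [] → ∀ c : ℝ, 0 < c → ∃ n : ℕ, n ≠ 0 ∧ ‖(l.map b).prod ^ n‖ < c ^ n) :
    ∃ n : ℕ, n ≠ 0 ∧ ∀ l : List ι, l.length = n → ‖(l.map b).prod‖ ≤ 1 / 2 := by
  by_contra! hns
  obtain ⟨S, hS⟩ : ∃ S : Set ℝ, S = {c : ℝ | 0 < c ∧ ∃ n : ℕ, n ≠ 0 ∧
    ∀ l : List ι, l.length = n → ‖(l.map b).prod‖ < c ^ n} := ⟨_, rfl⟩
  have hbound : ∀ c ∈ S, ∃ C, ∀ l : List ι, ‖(l.map b).prod‖ ≤ C * c ^ l.length := by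
    intro c hc
    rw [hS] at hc
    obtain ⟨hc0, n, hn, h⟩ := hc
    exact exists_bound_words hc0 hn fun l hl => (h l hl).le
  have hS1 : ∀ c ∈ S, 1 ≤ c := by
    intro c hc
    by_contra! hlt
    obtain ⟨C, hC⟩ := hbound c hc
    rw [hS] at hc
    have hlim : Tendsto (fun n : ℕ => C * c ^ n) atTop (𝓝 (C * 0)) :=
      (tendsto_pow_atTop_nhds_zero_of_lt_one hc.1.le hlt).const_mul C
    obtain ⟨n, hn, hn0⟩ := ((hlim.eventually_lt_const (u := 1 / 2) (by norm_num)).and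
      (eventually_ne_atTop 0)).exists
    obtain ⟨l, hl, hl2⟩ := hns n hn0
    have := hC l
    rw [hl] at this
    linarith
  have hSne : S.Nonempty := by
    obtain ⟨M, hM⟩ := (Set.finite_range fun i => ‖b i‖).bddAbove
    refine ⟨|M| + 1, ?_⟩
    rw [hS]
    refine ⟨by positivity, 1, one_ne_zero, fun l hl => ?_⟩
    obtain ⟨i, rfl⟩ := List.length_eq_one_iff.1 hl
    have : ‖b i‖ ≤ M := hM ⟨i, rfl⟩
    simp only [List.map_cons, List.map_nil, List.prod_cons, List.prod_nil, mul_one, pow_one]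
    linarith [le_abs_self M]
  obtain ⟨r, hr⟩ : ∃ r, r = sInf S := ⟨_, rfl⟩
  have hSbdd : BddBelow S := ⟨1, hS1⟩
  have hr1 : 1 ≤ r := hr ▸ le_csInf hSne hS1
  have hr0 : 0 < r := by linarith
  have hrc : (r : ℂ) ≠ 0 := Complex.ofReal_ne_zero.2 hr0.ne'
  have hword : ∀ l : List ι, ‖(l.map fun i => (r : ℂ)⁻¹ • b i).prod‖ =
      (r ^ l.length)⁻¹ * ‖(l.map b).prod‖ := fun l => by
    rw [list_prod_map_const_smul, norm_smul, norm_pow, norm_inv, Complex.norm_real,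
      Real.norm_of_nonneg hr0.le, inv_pow]
  have hb' : ∀ i, IsCompactOperator ((r : ℂ)⁻¹ • b i) := fun i => (hb i).smul _
  have hirr' : ∀ M : Submodule ℂ E, IsClosed (M : Set E) →
      (∀ i, ∀ x ∈ M, ((r : ℂ)⁻¹ • b i) x ∈ M) → M = ⊥ ∨ M = ⊤ := by
    refine fun M hM h => hirr M hM fun i x hx => ?_
    have := M.smul_mem (r : ℂ) (h i x hx)
    rwa [smul_apply, smul_inv_smul₀ hrc] at this
  obtain ⟨C, hC⟩ := exists_bound_words_of_irreducible hb' hirr' fun c hc => by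
    obtain ⟨c', hc', hlt⟩ := exists_lt_of_csInf_lt hSne
      (hr.symm.trans_lt (lt_mul_of_one_lt_right hr0 hc))
    obtain ⟨C, hC⟩ := hbound c' hc'
    refine ⟨C, fun l => ?_⟩
    have hC0 : 0 ≤ C := by simpa using (norm_nonneg _).trans (hC [])
    rw [hword, inv_mul_le_iff₀ (by positivity), mul_left_comm, ← mul_pow]
    refine (hC l).trans (mul_le_mul_of_nonneg_left (pow_le_pow_left₀ ?_ hlt.le _) hC0)
    linarith [hS1 c' hc']
  refine false_of_bounded_words hb' hC (fun n hn => ?_) fun l hl c hc => ?_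
  · by_contra! h
    have hfin : {l : List ι | l.length = n}.Finite := List.finite_length_eq ι n
    have hcont : Tendsto (fun c : ℝ => c ^ n) (𝓝[<] r) (𝓝 (r ^ n)) :=
      (continuous_pow n).continuousAt.tendsto.mono_left nhdsWithin_le_nhds
    have hev : ∀ᶠ c in 𝓝[<] r, ∀ l ∈ {l : List ι | l.length = n}, ‖(l.map b).prod‖ < c ^ n := by
      refine (eventually_all_finite hfin).2 fun l hl => hcont.eventually_const_lt ?_
      have hl' : l.length = n := hl
      have := h l hl'
      rwa [hword, inv_mul_lt_iff₀ (by positivity), mul_one, hl'] at this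
    have hpos : ∀ᶠ c in 𝓝[<] r, 0 < c := nhdsWithin_le_nhds (lt_mem_nhds hr0)
    obtain ⟨c, ⟨hc, hc0⟩, hcr⟩ := ((hev.and hpos).and self_mem_nhdsWithin).exists
    have hcS : c ∈ S := by rw [hS]; exact ⟨hc0, n, hn, hc⟩
    have hcr' : c < r := hcr
    linarith [csInf_le hSbdd hcS]
  · obtain ⟨n, hn, hlt⟩ := hqn l hl c hc
    refine ⟨n, hn, lt_of_le_of_lt ?_ hlt⟩
    rw [list_prod_map_const_smul, smul_pow, norm_smul, norm_pow, norm_pow, norm_inv,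
      Complex.norm_real,
      Real.norm_of_nonneg hr0.le]
    refine mul_le_of_le_one_left (norm_nonneg _) (pow_le_one₀ (by positivity)
      (pow_le_one₀ (by positivity) (inv_le_one_of_one_le₀ hr1)))

end JointSpectralRadius

section Gap

variable {X : Type*} [NormedAddCommGroup X] [NormedSpace ℂ X]

theorem Submodule.norm_mkQL_le (Y : Submodule ℂ X) (x : X) : ‖Y.mkQL x‖ ≤ ‖x‖ :=
  Submodule.Quotient.norm_mk_le Y x

theorem Submodule.mkQL_add_of_mem {Y : Submodule ℂ X} {y : X} (hy : y ∈ Y) (x : X) :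
    Y.mkQL (x + y) = Y.mkQL x := by
  have : Y.mkQL y = 0 := (Submodule.Quotient.mk_eq_zero Y).2 hy
  rw [map_add, this, add_zero]

theorem Submodule.norm_mkQL_lt_iff {Y : Submodule ℂ X} {x : X} {r : ℝ} :
    ‖Y.mkQL x‖ < r ↔ ∃ y ∈ Y, ‖x - y‖ < r := by
  constructor
  · intro h
    obtain ⟨m, hm, hlt⟩ := Submodule.Quotient.norm_mk_lt (Y.mkQL x) (sub_pos.2 h)
    refine ⟨x - m, (Submodule.Quotient.eq Y).1 hm.symm, ?_⟩
    rw [sub_sub_cancel]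
    linarith
  · rintro ⟨y, hy, hlt⟩
    rw [← sub_add_cancel x y, Submodule.mkQL_add_of_mem hy]
    exact (Y.norm_mkQL_le _).trans_lt hlt

theorem Submodule.norm_mkQL_anti {Y Y' : Submodule ℂ X} (h : Y ≤ Y') (x : X) :
    ‖Y'.mkQL x‖ ≤ ‖Y.mkQL x‖ := by
  refine le_of_forall_gt_imp_ge_of_dense fun r hr => ?_
  obtain ⟨y, hy, hlt⟩ := Submodule.norm_mkQL_lt_iff.1 hr
  exact (Submodule.norm_mkQL_lt_iff.2 ⟨y, h hy, hlt⟩).le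

variable {ι : Type*} {b : ι → X →L[ℂ] X}

theorem word_mapsTo {Z : Submodule ℂ X} (hZ : ∀ i, ∀ x ∈ Z, b i x ∈ Z) (l : List ι) :
    ∀ x ∈ Z, (l.map b).prod x ∈ Z := by
  induction l with
  | nil => simp
  | cons i l ih =>
    intro x hx
    rw [List.map_cons, List.prod_cons, mul_apply_eq_comp]
    exact hZ i _ (ih x hx)

theorem word_append_apply (l l' : List ι) (x : X) :
    ((l ++ l').map b).prod x = (l.map b).prod ((l'.map b).prod x) := by
  rw [List.map_append, List.prod_append, mul_apply_eq_comp]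

theorem word_apply_le_pow {Z : Submodule ℂ X} (hZ : ∀ i, ∀ x ∈ Z, b i x ∈ Z) {p : X → ℝ}
    {θ : ℝ} (hθ : 0 ≤ θ) {n : ℕ}
    (h : ∀ l : List ι, l.length = n → ∀ x ∈ Z, p ((l.map b).prod x) ≤ θ * p x) (m : ℕ) :
    ∀ l : List ι, l.length = n * m → ∀ x ∈ Z, p ((l.map b).prod x) ≤ θ ^ m * p x := by
  induction m with
  | zero =>
    intro l hl x _
    obtain rfl : l = [] := List.length_eq_zero_iff.1 (by simpa using hl)
    simp
  | succ m ih =>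
    intro l hl x hx
    rw [Nat.mul_succ] at hl
    rw [← List.take_append_drop n l, word_append_apply, pow_succ', mul_assoc]
    exact (h _ (by simp [hl]) _ (word_mapsTo hZ _ x hx)).trans
      (mul_le_mul_of_nonneg_left (ih _ (by simp [hl]) x hx) hθ)

/-- Long products of members of the family `b` are contractive on the subquotient `Z / Y`. -/
def WordContractive (b : ι → X →L[ℂ] X) (Y Z : Submodule ℂ X) : Prop :=
  ∃ n : ℕ, n ≠ 0 ∧ ∀ l : List ι, l.length = n → ∀ x ∈ Z,
    ‖Y.mkQL ((l.map b).prod x)‖ ≤ 1 / 2 * ‖Y.mkQL x‖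

theorem WordContractive.of_norm {Y Z : Submodule ℂ X} (hYZ : Y ≤ Z)
    (hY : ∀ i, ∀ x ∈ Y, b i x ∈ Y) {n : ℕ} (hn : n ≠ 0)
    (h : ∀ l : List ι, l.length = n → ∀ x ∈ Z, ‖Y.mkQL ((l.map b).prod x)‖ ≤ 1 / 2 * ‖x‖) :
    WordContractive b Y Z := by
  refine ⟨n, hn, fun l hl x hx => ?_⟩
  by_contra! hlt
  obtain ⟨y, hy, hxy⟩ := Submodule.norm_mkQL_lt_iff.1
    (show ‖Y.mkQL x‖ < 2 * ‖Y.mkQL ((l.map b).prod x)‖ by linarith)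
  have h1 := h l hl (x - y) (Z.sub_mem hx (hYZ hy))
  have h2 : Y.mkQL ((l.map b).prod x) = Y.mkQL ((l.map b).prod (x - y)) := by
    rw [← Submodule.mkQL_add_of_mem (word_mapsTo hY l y hy) ((l.map b).prod (x - y)), ← map_add,
      sub_add_cancel]
  rw [h2] at hxy
  linarith

variable [Finite ι]

theorem exists_bound_words_length (b : ι → X →L[ℂ] X) (n : ℕ) :
    ∃ K : ℝ, 0 ≤ K ∧ ∀ l : List ι, l.length = n → ‖(l.map b).prod‖ ≤ K := by
  obtain ⟨K, hK⟩ := ((List.finite_length_eq ι n).image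
    fun l : List ι => ‖(l.map b).prod‖).bddAbove
  exact ⟨max 0 K, le_max_left _ _, fun l hl => (hK ⟨l, hl, rfl⟩).trans (le_max_right _ _)⟩

theorem WordContractive.trans {Y W Z : Submodule ℂ X} (hYW : Y ≤ W)
    (hW : ∀ i, ∀ x ∈ W, b i x ∈ W) (hZ : ∀ i, ∀ x ∈ Z, b i x ∈ Z)
    (h : WordContractive b Y W) (h' : WordContractive b W Z) : WordContractive b Y Z := by
  obtain ⟨n₁, hn₁, h₁⟩ := h
  obtain ⟨n₂, hn₂, h₂⟩ := h'
  have hpow : ∀ m : ℕ, m ≠ 0 → (1 / 2 : ℝ) ^ m ≤ 1 / 2 := fun m hm =>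
    pow_le_of_le_one (by norm_num) (by norm_num) hm
  obtain ⟨K, hK0, hK⟩ := exists_bound_words_length b (n₁ * n₂)
  have hYn : ∀ l : List ι, l.length = n₁ * n₂ → ∀ x ∈ W,
      ‖Y.mkQL ((l.map b).prod x)‖ ≤ 1 / 2 * ‖Y.mkQL x‖ := fun l hl x hx =>
    (word_apply_le_pow (p := fun x => ‖Y.mkQL x‖) hW (by norm_num) h₁ n₂ l hl x hx).trans
      (mul_le_mul_of_nonneg_right (hpow n₂ hn₂) (norm_nonneg _))
  have hWn : ∀ l : List ι, l.length = n₁ * n₂ → ∀ x ∈ Z,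
      ‖W.mkQL ((l.map b).prod x)‖ ≤ 1 / 2 * ‖W.mkQL x‖ := fun l hl x hx =>
    (word_apply_le_pow (p := fun x => ‖W.mkQL x‖) hZ (by norm_num) h₂ n₁ l
      (by rw [hl, mul_comm]) x hx).trans
      (mul_le_mul_of_nonneg_right (hpow n₁ hn₁) (norm_nonneg _))
  have hmix : ∀ l : List ι, l.length = n₁ * n₂ → ∀ x,
      ‖Y.mkQL ((l.map b).prod x)‖ ≤ 1 / 2 * ‖Y.mkQL x‖ + (K + 1 / 2) * ‖W.mkQL x‖ := by
    intro l hl x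
    by_contra! hlt
    have hlt' : ‖W.mkQL x‖ <
        (‖Y.mkQL ((l.map b).prod x)‖ - 1 / 2 * ‖Y.mkQL x‖) / (K + 1 / 2) := by
      rw [lt_div_iff₀ (by positivity)]; linarith
    obtain ⟨w, hw, hxw⟩ := Submodule.norm_mkQL_lt_iff.1 hlt'
    rw [lt_div_iff₀ (by positivity)] at hxw
    have e1 : ‖Y.mkQL ((l.map b).prod x)‖ ≤
        ‖Y.mkQL ((l.map b).prod w)‖ + ‖Y.mkQL ((l.map b).prod (x - w))‖ := by
      rw [map_sub (l.map b).prod, map_sub]; exact norm_le_norm_add_norm_sub' _ _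
    have e2 := hYn l hl w hw
    have e3 : ‖Y.mkQL ((l.map b).prod (x - w))‖ ≤ K * ‖x - w‖ :=
      (Y.norm_mkQL_le _).trans ((l.map b).prod.le_of_opNorm_le (hK l hl) _)
    have e4 : ‖Y.mkQL w‖ ≤ ‖Y.mkQL x‖ + ‖x - w‖ := by
      refine (norm_le_norm_add_norm_sub (Y.mkQL x) (Y.mkQL w)).trans ?_
      rw [← map_sub]
      exact add_le_add_right (Y.norm_mkQL_le _) _
    nlinarith
  obtain ⟨A, hA⟩ : ∃ A, A = 4 * (K + 1 / 2) := ⟨_, rfl⟩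
  have hA0 : 0 ≤ A := by rw [hA]; positivity
  have hG : ∀ l : List ι, l.length = n₁ * n₂ → ∀ x ∈ Z,
      ‖Y.mkQL ((l.map b).prod x)‖ + A * ‖W.mkQL ((l.map b).prod x)‖ ≤
        3 / 4 * (‖Y.mkQL x‖ + A * ‖W.mkQL x‖) := by
    intro l hl x hx
    have e1 := hmix l hl x
    have e2 := mul_le_mul_of_nonneg_left (hWn l hl x hx) hA0
    have e3 : (K + 1 / 2) * ‖W.mkQL x‖ = A / 4 * ‖W.mkQL x‖ := by rw [hA]; ring
    have e4 := norm_nonneg (Y.mkQL x)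
    linarith
  have hlim : Tendsto (fun m : ℕ => (3 / 4 : ℝ) ^ m * (1 + A)) atTop (𝓝 (0 * (1 + A))) :=
    (tendsto_pow_atTop_nhds_zero_of_lt_one (by norm_num) (by norm_num)).mul_const _
  rw [zero_mul] at hlim
  obtain ⟨m, hm, hm0⟩ := ((hlim.eventually_le_const one_half_pos).and
    (eventually_ne_atTop 0)).exists
  refine ⟨n₁ * n₂ * m, by positivity, fun l hl x hx => ?_⟩
  have e1 := word_apply_le_pow (p := fun x => ‖Y.mkQL x‖ + A * ‖W.mkQL x‖) hZ (by norm_num)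
    hG m l hl x hx
  have e2 : ‖Y.mkQL x‖ + A * ‖W.mkQL x‖ ≤ (1 + A) * ‖Y.mkQL x‖ := by
    linarith [mul_le_mul_of_nonneg_left (Submodule.norm_mkQL_anti hYW x) hA0]
  have e3 := mul_le_mul_of_nonneg_left e2 (show (0 : ℝ) ≤ (3 / 4) ^ m by positivity)
  have e4 := mul_le_mul_of_nonneg_right hm (norm_nonneg (Y.mkQL x))
  have e5 := mul_nonneg hA0 (norm_nonneg (W.mkQL ((l.map b).prod x)))
  linarith

theorem WordContractive.exists_of_limit (hb : ∀ i, IsCompactOperator (b i)) {κ : Type*}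
    [Preorder κ] [IsDirectedOrder κ] [Nonempty κ] {Y Z : κ → Submodule ℂ X} (hYm : Monotone Y)
    (hZm : Antitone Z) (hYZ : ∀ a, Y a ≤ Z a) (hZc : ∀ a, IsClosed (Z a : Set X))
    (hY : ∀ a i, ∀ x ∈ Y a, b i x ∈ Y a) (hZ : ∀ a i, ∀ x ∈ Z a, b i x ∈ Z a)
    (h : WordContractive b (⨆ a, Y a).topologicalClosure (⨅ a, Z a)) :
    ∃ a, WordContractive b (Y a) (Z a) := by
  obtain ⟨Y', hY'⟩ : ∃ Y', Y' = (⨆ a, Y a).topologicalClosure := ⟨_, rfl⟩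
  obtain ⟨Z', hZ'⟩ : ∃ Z', Z' = ⨅ a, Z a := ⟨_, rfl⟩
  rw [← hY', ← hZ'] at h
  have hZ'inv : ∀ i, ∀ x ∈ Z', b i x ∈ Z' := by
    intro i x hx
    rw [hZ', Submodule.mem_iInf] at hx ⊢
    exact fun a => hZ a i x (hx a)
  have hYlim : ∀ x r, ‖Y'.mkQL x‖ < r → ∃ a, ‖(Y a).mkQL x‖ < r := by
    intro x r hr
    obtain ⟨y, hy, hlt⟩ := Submodule.norm_mkQL_lt_iff.1 hr
    rw [hY'] at hy
    obtain ⟨z, hz, hyz⟩ := Metric.mem_closure_iff.1 hy _ (sub_pos.2 hlt)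
    obtain ⟨a, ha⟩ := (Submodule.mem_iSup_of_directed Y hYm.directed_le).1 hz
    refine ⟨a, Submodule.norm_mkQL_lt_iff.2 ⟨z, ha, ?_⟩⟩
    rw [dist_eq_norm] at hyz
    linarith [norm_sub_le_norm_sub_add_norm_sub x y z]
  obtain ⟨n, hn, hcontr⟩ := h
  have hfin : ∀ k, {l : List ι | l.length = k}.Finite := List.finite_length_eq ι
  have hcomp : ∀ l : List ι, l.length = n → IsCompactOperator (l.map b).prod := fun l hl =>
    isCompactOperator_word hb (by rintro rfl; exact hn hl.symm)
  obtain ⟨K, hK⟩ : ∃ K : Set X, K = ⋃ l ∈ {l : List ι | l.length = n},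
    closure ((l.map b).prod '' closedBall 0 1) := ⟨_, rfl⟩
  have hKc : IsCompact K := by
    rw [hK]
    refine (hfin n).isCompact_biUnion fun l hl => ?_
    obtain ⟨K, hKc, hsub⟩ := (hcomp l hl).image_closedBall_subset_compact 1
    exact hKc.closure_of_subset hsub
  obtain ⟨R, hR⟩ := hKc.isBounded.exists_norm_le
  obtain ⟨m, hm⟩ : ∃ m : ℕ, (1 / 2 : ℝ) ^ m * R < 1 / 2 := by
    have hlim : Tendsto (fun m : ℕ => (1 / 2 : ℝ) ^ m * R) atTop (𝓝 (0 * R)) :=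
      (tendsto_pow_atTop_nhds_zero_of_lt_one (by norm_num) (by norm_num)).mul_const _
    rw [zero_mul] at hlim
    exact (hlim.eventually_lt_const one_half_pos).exists
  obtain ⟨a, ha⟩ := hKc.elim_directed_cover
    (fun a => (Z a : Set X)ᶜ ∪ ⋂ l ∈ {l : List ι | l.length = n * m},
      {z | ‖(Y a).mkQL ((l.map b).prod z)‖ < 1 / 2})
    (fun a => (hZc a).isOpen_compl.union ((hfin _).isOpen_biInter fun l _ =>
      isOpen_lt (by fun_prop) continuous_const)) (fun z hz => by
      by_cases hzZ : z ∈ Z'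
      · have hex : ∀ l : List ι, l.length = n * m →
            ∃ a, ‖(Y a).mkQL ((l.map b).prod z)‖ < 1 / 2 := by
          intro l hl
          refine hYlim _ _ (lt_of_le_of_lt (word_apply_le_pow (p := fun x => ‖Y'.mkQL x‖) hZ'inv
            (by norm_num) hcontr m l hl z hzZ) (lt_of_le_of_lt ?_ hm))
          exact mul_le_mul_of_nonneg_left ((Y'.norm_mkQL_le z).trans (hR z hz)) (by positivity)
        choose! A hA using hex
        classical
        obtain ⟨a, ha⟩ := ((hfin (n * m)).toFinset.image A).exists_le
        refine Set.mem_iUnion.2 ⟨a, Or.inr (Set.mem_iInter₂.2 fun l hl => ?_)⟩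
        exact (Submodule.norm_mkQL_anti (hYm (ha _ (Finset.mem_image_of_mem A
          ((hfin (n * m)).mem_toFinset.2 hl)))) _).trans_lt (hA l hl)
      · rw [hZ', Submodule.mem_iInf] at hzZ
        push Not at hzZ
        obtain ⟨a, ha⟩ := hzZ
        exact Set.mem_iUnion.2 ⟨a, Or.inl ha⟩)
    (Monotone.directed_le fun a a' haa' => Set.union_subset_union
      (Set.compl_subset_compl.2 (hZm haa')) (Set.iInter₂_mono fun l _ z hz =>
        (Submodule.norm_mkQL_anti (hYm haa') _).trans_lt hz))
  refine ⟨a, WordContractive.of_norm (hYZ a) (hY a) (n := n * m + n) (by omega)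
    fun l hl x hx => ?_⟩
  rcases eq_or_ne x 0 with rfl | hx0
  · simp
  have hx0' : 0 < ‖x‖ := norm_pos_iff.2 hx0
  have hxc : (‖x‖ : ℂ) ≠ 0 := Complex.ofReal_ne_zero.2 hx0'.ne'
  obtain ⟨u, hu⟩ : ∃ u, u = (‖x‖ : ℂ)⁻¹ • x := ⟨_, rfl⟩
  have hxu : x = (‖x‖ : ℂ) • u := by rw [hu, smul_inv_smul₀ hxc]
  have huZ : u ∈ Z a := by rw [hu]; exact (Z a).smul_mem _ hx
  have hu1 : ‖u‖ ≤ 1 := by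
    rw [hu, norm_smul, norm_inv, Complex.norm_real, norm_norm, inv_mul_cancel₀ hx0'.ne']
  have hmemK : ((l.drop (n * m)).map b).prod u ∈ K := by
    rw [hK]
    refine Set.mem_iUnion₂.2 ⟨l.drop (n * m), ?_, subset_closure
      ⟨u, mem_closedBall_zero_iff.2 hu1, rfl⟩⟩
    change (l.drop (n * m)).length = n
    simp [hl]
  rcases ha hmemK with h1 | h1
  · exact absurd (word_mapsTo (hZ a) _ u huZ) h1
  · have h2 := Set.mem_iInter₂.1 h1 (l.take (n * m)) (by
      change (l.take (n * m)).length = n * m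
      simp [hl])
    have h3 : ‖(Y a).mkQL ((l.map b).prod u)‖ < 1 / 2 := by
      rw [← List.take_append_drop (n * m) l, word_append_apply]; exact h2
    rw [hxu, map_smul, map_smul, norm_smul, norm_smul, Complex.norm_real, norm_norm]
    have h4 : ‖u‖ = 1 := by
      rw [hu, norm_smul, norm_inv, Complex.norm_real, norm_norm, inv_mul_cancel₀ hx0'.ne']
    rw [h4]
    linarith [mul_le_mul_of_nonneg_left h3.le hx0'.le]

end Gap

section Subquotient

theorem map_word_apply {V W : Type*} [NormedAddCommGroup V] [NormedSpace ℂ V]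
    [SeminormedAddCommGroup W] [NormedSpace ℂ W] {ι : Type*} (f : V →L[ℂ] W) {T : ι → V →L[ℂ] V}
    {S : ι → W →L[ℂ] W} (h : ∀ i v, f (T i v) = S i (f v)) (l : List ι) (v : V) :
    f ((l.map T).prod v) = (l.map S).prod (f v) := by
  induction l with
  | nil => simp
  | cons i l ih =>
    rw [List.map_cons, List.prod_cons, List.map_cons, List.prod_cons, mul_apply_eq_comp,
      mul_apply_eq_comp, h, ih]

theorem map_pow_apply {V W : Type*} [NormedAddCommGroup V] [NormedSpace ℂ V]
    [SeminormedAddCommGroup W] [NormedSpace ℂ W] (f : V →L[ℂ] W) {T : V →L[ℂ] V}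
    {S : W →L[ℂ] W} (h : ∀ v, f (T v) = S (f v)) (n : ℕ) (v : V) :
    f ((T ^ n) v) = (S ^ n) (f v) := by
  induction n with
  | zero => simp
  | succ n ih => rw [pow_succ', pow_succ', mul_apply_eq_comp, mul_apply_eq_comp, h, ih]

theorem norm_le_of_isometry_intertwine {V W : Type*} [NormedAddCommGroup V] [NormedSpace ℂ V]
    [NormedAddCommGroup W] [NormedSpace ℂ W] {f : V →L[ℂ] W} (hf : ∀ v, ‖f v‖ = ‖v‖)
    {T : V →L[ℂ] V} {S : W →L[ℂ] W} (h : ∀ v, f (T v) = S (f v)) : ‖T‖ ≤ ‖S‖ :=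
  T.opNorm_le_bound (norm_nonneg S) fun v => by
    rw [← hf, h, ← hf v]; exact S.le_opNorm _

theorem norm_le_of_mkQL_intertwine {V : Type*} [NormedAddCommGroup V] [NormedSpace ℂ V]
    {Y : Submodule ℂ V} {T : V →L[ℂ] V} {S : (V ⧸ Y) →L[ℂ] (V ⧸ Y)}
    (h : ∀ v, Y.mkQL (T v) = S (Y.mkQL v)) : ‖S‖ ≤ ‖T‖ := by
  refine S.opNorm_le_bound (norm_nonneg T) fun ξ => ?_
  have hξ : ∀ ε > 0, ‖S ξ‖ ≤ ‖T‖ * (‖ξ‖ + ε) := by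
    intro ε hε
    obtain ⟨v, rfl, hv⟩ := Submodule.Quotient.norm_mk_lt ξ hε
    change ‖S (Y.mkQL v)‖ ≤ _
    rw [← h]
    exact (Y.norm_mkQL_le _).trans (T.le_opNorm_of_le hv.le)
  have hlim : Tendsto (fun ε : ℝ => ‖T‖ * (‖ξ‖ + ε)) (𝓝[>] 0) (𝓝 (‖T‖ * (‖ξ‖ + 0))) :=
    (by fun_prop : Continuous fun ε : ℝ => ‖T‖ * (‖ξ‖ + ε)).continuousAt.tendsto.mono_left
      nhdsWithin_le_nhds
  rw [add_zero] at hlim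
  exact ge_of_tendsto hlim (eventually_mem_nhdsWithin.mono fun ε hε => hξ ε hε)

variable {ι : Type*} [Finite ι]

/-- A version of `exists_norm_words_le_half` for a quotient by a closed invariant subspace. -/
theorem exists_norm_mkQL_words_le_half {V : Type*} [NormedAddCommGroup V] [NormedSpace ℂ V]
    [CompleteSpace V] {b : ι → V →L[ℂ] V} (hb : ∀ i, IsCompactOperator (b i))
    {Y : Submodule ℂ V} (hYc : IsClosed (Y : Set V)) (hY : ∀ i, ∀ x ∈ Y, b i x ∈ Y)
    (hirr : ∀ M : Submodule ℂ V, IsClosed (M : Set V) → Y ≤ M → (∀ i, ∀ x ∈ M, b i x ∈ M) →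
      M = Y ∨ M = ⊤)
    (hqn : ∀ l : List ι, l ≠ [] → ∀ c : ℝ, 0 < c → ∃ n : ℕ, n ≠ 0 ∧ ‖(l.map b).prod ^ n‖ < c ^ n) :
    ∃ n : ℕ, n ≠ 0 ∧ ∀ l : List ι, l.length = n → ∀ x,
      ‖Y.mkQL ((l.map b).prod x)‖ ≤ 1 / 2 * ‖Y.mkQL x‖ := by
  obtain ⟨S, hS, hSc⟩ : ∃ S : ι → (V ⧸ Y) →L[ℂ] (V ⧸ Y),
      (∀ i v, Y.mkQL (b i v) = S i (Y.mkQL v)) ∧ ∀ i, IsCompactOperator (S i) :=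
    ⟨fun i => (b i).quotientMap Y (hY i), fun i v => rfl, fun i => (hb i).quotientMap (hY i)⟩
  obtain ⟨n, hn, h⟩ := exists_norm_words_le_half hSc (fun M hM hMS => by
      have hM' := hirr (M.comap (Y.mkQL : V →ₗ[ℂ] V ⧸ Y)) (hM.preimage Y.mkQL.continuous)
        (fun y hy => by
          have : Y.mkQL y = 0 := (Submodule.Quotient.mk_eq_zero Y).2 hy
          change Y.mkQL y ∈ M
          rw [this]
          exact M.zero_mem)
        (fun i x hx => by
          change Y.mkQL (b i x) ∈ M
          rw [hS]
          exact hMS i _ hx)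
      rcases hM' with h | h
      · left
        refine (Submodule.eq_bot_iff M).2 fun ξ hξ => ?_
        obtain ⟨v, rfl⟩ := Y.mkQ_surjective ξ
        have : v ∈ M.comap (Y.mkQL : V →ₗ[ℂ] V ⧸ Y) := hξ
        rw [h] at this
        exact (Submodule.Quotient.mk_eq_zero Y).2 this
      · right
        refine Submodule.eq_top_iff'.2 fun ξ => ?_
        obtain ⟨v, rfl⟩ := Y.mkQ_surjective ξ
        have : v ∈ M.comap (Y.mkQL : V →ₗ[ℂ] V ⧸ Y) := by rw [h]; trivial
        exact this) fun l hl c hc => by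
      obtain ⟨n, hn, hlt⟩ := hqn l hl c hc
      exact ⟨n, hn, (norm_le_of_mkQL_intertwine
        (map_pow_apply Y.mkQL (map_word_apply Y.mkQL hS l) n)).trans_lt hlt⟩
  refine ⟨n, hn, fun l hl x => ?_⟩
  rw [map_word_apply Y.mkQL hS]
  exact ((l.map S).prod).le_of_opNorm_le (h l hl) _

variable {X : Type*} [NormedAddCommGroup X] [NormedSpace ℂ X] {b : ι → X →L[ℂ] X}

/-- A pair `Y ≤ Z` of closed invariant subspaces such that the family `b` does not have
contractive long products on `Z / Y`. -/
structure NoncontractiveInterval (b : ι → X →L[ℂ] X) (Y Z : Submodule ℂ X) : Prop where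
  le : Y ≤ Z
  isClosed_left : IsClosed (Y : Set X)
  isClosed_right : IsClosed (Z : Set X)
  mapsTo_left : ∀ i, ∀ x ∈ Y, b i x ∈ Y
  mapsTo_right : ∀ i, ∀ x ∈ Z, b i x ∈ Z
  not_wordContractive : ¬ WordContractive b Y Z

theorem NoncontractiveInterval.of_limit (hb : ∀ i, IsCompactOperator (b i)) {κ : Type*}
    [Preorder κ] [IsDirectedOrder κ] [Nonempty κ] {Y Z : κ → Submodule ℂ X} (hYm : Monotone Y)
    (hZm : Antitone Z) (h : ∀ a, NoncontractiveInterval b (Y a) (Z a)) :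
    NoncontractiveInterval b (⨆ a, Y a).topologicalClosure (⨅ a, Z a) where
  le := by
    have hZc : IsClosed ((⨅ a, Z a : Submodule ℂ X) : Set X) := by
      rw [Submodule.coe_iInf]
      exact isClosed_iInter fun a => (h a).isClosed_right
    refine Submodule.topologicalClosure_minimal _ (iSup_le fun a => le_iInf fun a' => ?_) hZc
    obtain ⟨c, hac, ha'c⟩ := exists_ge_ge a a'
    exact (hYm hac).trans ((h c).le.trans (hZm ha'c))
  isClosed_left := Submodule.isClosed_topologicalClosure _
  isClosed_right := by
    rw [Submodule.coe_iInf]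
    exact isClosed_iInter fun a => (h a).isClosed_right
  mapsTo_left i x hx := map_mem_closure (b i).continuous hx fun y hy => by
    obtain ⟨a, ha⟩ := (Submodule.mem_iSup_of_directed Y hYm.directed_le).1 hy
    exact le_iSup Y a ((h a).mapsTo_left i y ha)
  mapsTo_right i x hx := by
    rw [Submodule.mem_iInf] at hx ⊢
    exact fun a => (h a).mapsTo_right i x (hx a)
  not_wordContractive hcon := by
    obtain ⟨a, ha⟩ := WordContractive.exists_of_limit hb hYm hZm (fun a => (h a).le)
      (fun a => (h a).isClosed_right) (fun a => (h a).mapsTo_left) (fun a => (h a).mapsTo_right)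
      hcon
    exact (h a).not_wordContractive ha

theorem NoncontractiveInterval.exists_minimal (hb : ∀ i, IsCompactOperator (b i))
    {Y₀ Z₀ : Submodule ℂ X} (h₀ : NoncontractiveInterval b Y₀ Z₀) :
    ∃ Y Z, NoncontractiveInterval b Y Z ∧ ∀ Y' Z', Y ≤ Y' → Z' ≤ Z →
      NoncontractiveInterval b Y' Z' → Y' = Y ∧ Z' = Z := by
  obtain ⟨⟨Y, Z⟩, -, hmem, hmax⟩ := zorn_le_nonempty₀
    {p : Submodule ℂ X × (Submodule ℂ X)ᵒᵈ | NoncontractiveInterval b p.1 (OrderDual.ofDual p.2)}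
    (fun c hcs hc p₀ hp₀ => by
      have : Nonempty c := ⟨⟨p₀, hp₀⟩⟩
      have : IsDirectedOrder c := ⟨hc.directed⟩
      exact ⟨((⨆ p : c, p.1.1).topologicalClosure,
        OrderDual.toDual (⨅ p : c, OrderDual.ofDual p.1.2)),
        NoncontractiveInterval.of_limit hb (fun p q (h : p.1 ≤ q.1) => h.1)
          (fun p q (h : p.1 ≤ q.1) => h.2)
          fun p => hcs p.2,
        fun p hp => ⟨(le_iSup (fun p : c => p.1.1) ⟨p, hp⟩).trans
          (Submodule.le_topologicalClosure _),
          iInf_le (fun p : c => OrderDual.ofDual p.1.2) ⟨p, hp⟩⟩⟩)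
    (Y₀, OrderDual.toDual Z₀) h₀
  refine ⟨Y, OrderDual.ofDual Z, hmem, fun Y' Z' hY hZ h => ?_⟩
  have hle := hmax (y := (Y', OrderDual.toDual Z')) h ⟨hY, hZ⟩
  exact ⟨le_antisymm hle.1 hY, le_antisymm hZ hle.2⟩

variable [CompleteSpace X]

theorem wordContractive_of_irreducible (hb : ∀ i, IsCompactOperator (b i))
    {Y Z : Submodule ℂ X} (hYZ : Y ≤ Z) (hYc : IsClosed (Y : Set X)) (hZc : IsClosed (Z : Set X))
    (hY : ∀ i, ∀ x ∈ Y, b i x ∈ Y) (hZ : ∀ i, ∀ x ∈ Z, b i x ∈ Z)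
    (hirr : ∀ M : Submodule ℂ X, IsClosed (M : Set X) → Y ≤ M → M ≤ Z →
      (∀ i, ∀ x ∈ M, b i x ∈ M) → M = Y ∨ M = Z)
    (hqn : ∀ l : List ι, l ≠ [] → ∀ c : ℝ, 0 < c → ∃ n : ℕ, n ≠ 0 ∧ ‖(l.map b).prod ^ n‖ < c ^ n) :
    WordContractive b Y Z := by
  have : CompleteSpace Z := hZc.completeSpace_coe
  obtain ⟨T, hT, hTc⟩ : ∃ T : ι → Z →L[ℂ] Z,
      (∀ i v, Z.subtypeL (T i v) = b i (Z.subtypeL v)) ∧ ∀ i, IsCompactOperator (T i) :=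
    ⟨fun i => (b i).restrict (hZ i), fun i v => rfl, fun i =>
      IsCompactOperator.restrict (f := (b i : X →ₗ[ℂ] X)) (hb i) (hZ i) hZc⟩
  obtain ⟨n, hn, h⟩ := exists_norm_mkQL_words_le_half hTc (Y := Y.comap Z.subtype)
    (hYc.preimage continuous_subtype_val)
    (fun i x hx => by
      have := hY i _ hx
      change Z.subtypeL (T i x) ∈ Y
      rw [hT]
      exact this)
    (fun M hM hYM hMT => by
      have hM' := hirr (M.map Z.subtype) (hZc.isClosedEmbedding_subtypeVal.isClosedMap _ hM)
        (fun y hy => ⟨⟨y, hYZ hy⟩, hYM hy, rfl⟩)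
        (by rintro _ ⟨z, -, rfl⟩; exact z.2)
        (by
          rintro i _ ⟨z, hz, rfl⟩
          exact ⟨T i z, hMT i z hz, hT i z⟩)
      rcases hM' with h | h
      · left
        rw [← h, Submodule.comap_map_eq_of_injective Z.injective_subtype]
      · right
        refine Submodule.eq_top_iff'.2 fun z => ?_
        have hz : (z : X) ∈ M.map Z.subtype := by rw [h]; exact z.2
        obtain ⟨z', hz', hzz⟩ := hz
        exact Subtype.ext hzz ▸ hz')
    (fun l hl c hc => by
      obtain ⟨n, hn, hlt⟩ := hqn l hl c hc
      exact ⟨n, hn, (norm_le_of_isometry_intertwine (f := Z.subtypeL) (fun v => rfl)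
        (map_pow_apply Z.subtypeL (map_word_apply Z.subtypeL hT l) n)).trans_lt hlt⟩)
  have hnorm : ∀ z : Z, ‖Y.mkQL (z : X)‖ ≤ ‖(Y.comap Z.subtype).mkQL z‖ := by
    intro z
    refine le_of_forall_gt_imp_ge_of_dense fun r hr => ?_
    obtain ⟨y, hy, hlt⟩ := Submodule.norm_mkQL_lt_iff.1 hr
    exact (Submodule.norm_mkQL_lt_iff.2 ⟨(y : X), hy, hlt⟩).le
  refine WordContractive.of_norm hYZ hY hn fun l hl x hx => ?_
  have h1 := map_word_apply Z.subtypeL hT l ⟨x, hx⟩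
  have h2 := hnorm ((l.map T).prod ⟨x, hx⟩)
  have h3 := h l hl ⟨x, hx⟩
  have h4 : ‖(Y.comap Z.subtype).mkQL ⟨x, hx⟩‖ ≤ ‖x‖ := Submodule.norm_mkQL_le _ (⟨x, hx⟩ : Z)
  have h5 : ‖Y.mkQL ((l.map b).prod x)‖ = ‖Y.mkQL ((l.map T).prod ⟨x, hx⟩ : X)‖ := by
    congr 2; exact h1.symm
  rw [h5]
  linarith

/-- For a finite family of compact operators all of whose products are quasinilpotent, long
products are small in norm. -/
theorem exists_norm_words_le_half_of_quasinilpotent (hb : ∀ i, IsCompactOperator (b i))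
    (hqn : ∀ l : List ι, l ≠ [] → ∀ c : ℝ, 0 < c → ∃ n : ℕ, n ≠ 0 ∧ ‖(l.map b).prod ^ n‖ < c ^ n) :
    ∃ n : ℕ, n ≠ 0 ∧ ∀ l : List ι, l.length = n → ‖(l.map b).prod‖ ≤ 1 / 2 := by
  have hcontr : WordContractive b ⊥ ⊤ := by
    by_contra hnot
    obtain ⟨Y, Z, h, hmin⟩ := NoncontractiveInterval.exists_minimal hb (Y₀ := ⊥) (Z₀ := ⊤)
      ⟨bot_le, isClosed_singleton, isClosed_univ, fun i x hx => by
        rw [(Submodule.mem_bot ℂ).1 hx, map_zero]; exact Submodule.zero_mem _,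
        fun i x hx => trivial, hnot⟩
    refine h.not_wordContractive (wordContractive_of_irreducible hb h.le h.isClosed_left
      h.isClosed_right h.mapsTo_left h.mapsTo_right (fun M hM hYM hMZ hinv => ?_) hqn)
    by_contra! hne
    have h1 : WordContractive b Y M := by
      by_contra hcon
      exact hne.2 (hmin Y M le_rfl hMZ ⟨hYM, h.isClosed_left, hM, h.mapsTo_left, hinv, hcon⟩).2
    have h2 : WordContractive b M Z := by
      by_contra hcon
      exact hne.1 (hmin M Z hYM le_rfl ⟨hMZ, hM, h.isClosed_right, hinv, h.mapsTo_right, hcon⟩).1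
    exact h.not_wordContractive (h1.trans hYM hinv h.mapsTo_right h2)
  obtain ⟨n, hn, h⟩ := hcontr
  refine ⟨n, hn, fun l hl => (l.map b).prod.opNorm_le_bound (by norm_num) fun x => ?_⟩
  have hnorm : ∀ x : X, ‖(⊥ : Submodule ℂ X).mkQL x‖ = ‖x‖ := fun x => by
    refine le_antisymm (Submodule.norm_mkQL_le _ x) (le_of_forall_gt_imp_ge_of_dense fun r hr => ?_)
    obtain ⟨y, hy, hlt⟩ := Submodule.norm_mkQL_lt_iff.1 hr
    rw [(Submodule.mem_bot ℂ).1 hy, sub_zero] at hlt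
    exact hlt.le
  simpa only [hnorm] using h l hl x trivial

end Subquotient

theorem exists_isClosed_ne_bot_ne_top {X : Type*} [NormedAddCommGroup X] [NormedSpace ℂ X]
    (hdim : 2 ≤ Module.rank ℂ X) :
    ∃ M : Submodule ℂ X, IsClosed (M : Set X) ∧ M ≠ ⊥ ∧ M ≠ ⊤ := by
  have : Nontrivial X := by
    refine (rank_pos_iff_nontrivial (R := ℂ)).1 (lt_of_lt_of_le ?_ hdim)
    norm_num
  obtain ⟨x, hx⟩ := exists_ne (0 : X)
  refine ⟨Submodule.span ℂ {x}, Submodule.closed_of_finiteDimensional _, ?_, fun h => ?_⟩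
  · rwa [Ne, Submodule.span_singleton_eq_bot]
  · have h1 : Module.rank ℂ (Submodule.span ℂ {x}) ≤ 1 := by
      simpa using rank_span_le (R := ℂ) ({x} : Set X)
    rw [h, rank_top] at h1
    exact absurd (hdim.trans h1) (by norm_num)

/-- A uniformly closed Jordan algebra of compact operators (on a space of dimension
at least 2) containing no nonzero finite-rank operator is reducible. -/
theorem jordan_algebra_no_finite_rank_reducible
    {X : Type*} [NormedAddCommGroup X] [NormedSpace ℂ X] [CompleteSpace X]
    (hdim : 2 ≤ Module.rank ℂ X)
    (J : Submodule ℂ (X →L[ℂ] X))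
    (hclosed : IsClosed (J : Set (X →L[ℂ] X)))
    (hJordan : ∀ A ∈ J, ∀ B ∈ J, A * B + B * A ∈ J)
    (hcompact : ∀ A ∈ J, IsCompactOperator A)
    (hfr : ∀ A ∈ J, FiniteDimensional ℂ (LinearMap.range (A : X →ₗ[ℂ] X)) → A = 0) :
    ∃ M : Submodule ℂ X, IsClosed (M : Set X) ∧ M ≠ ⊥ ∧ M ≠ ⊤ ∧
      ∀ A ∈ J, ∀ x ∈ M, A x ∈ M := by
  by_contra hcon
  have hirr : ∀ M : Submodule ℂ X, IsClosed (M : Set X) →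
      (∀ A ∈ (J : Set (X →L[ℂ] X)), ∀ x ∈ M, A x ∈ M) → M = ⊥ ∨ M = ⊤ := by
    intro M hM hinv
    by_contra! h
    exact hcon ⟨M, hM, h.1, h.2, hinv⟩
  obtain ⟨K, hKJ, hK0⟩ : ∃ K ∈ J, K ≠ 0 := by
    by_contra! h
    obtain ⟨M, hM, hbot, htop⟩ := exists_isClosed_ne_bot_ne_top hdim
    exact hcon ⟨M, hM, hbot, htop, fun A hA x _ => by simp [h A hA]⟩
  have hX : ¬ FiniteDimensional ℂ X := fun h => hK0 (hfr K hKJ inferInstance)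
  obtain ⟨t, ht, htJ, κ, hκ, δ, hδ, hnot⟩ :=
    (hcompact K hKJ).exists_finite_not_contractive hirr hK0
  obtain ⟨s, hs⟩ : ∃ s : Set (X →L[ℂ] X), s = insert K t := ⟨_, rfl⟩
  have hfin : Finite s := hs ▸ ht.insert K
  have hJ : ∀ a : s, (a : X →L[ℂ] X) ∈ J := by
    rintro ⟨a, ha⟩
    obtain rfl | ha : a = K ∨ a ∈ t := by simpa [hs] using ha
    exacts [hKJ, htJ ha]
  obtain ⟨c, hc⟩ : ∃ c : ℝ, c = max 1 κ⁻¹ := ⟨_, rfl⟩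
  have hc1 : 1 ≤ c := hc ▸ le_max_left _ _
  have hcκ : κ⁻¹ ≤ c := hc ▸ le_max_right _ _
  have hc0 : 0 < c := by linarith
  obtain ⟨b, hb⟩ : ∃ b : s → X →L[ℂ] X,
      ∀ a, b a = (c : ℂ) • (a : X →L[ℂ] X) := ⟨_, fun a => rfl⟩
  have hbJ : ∀ a, b a ∈ J := fun a => by rw [hb]; exact J.smul_mem _ (hJ a)
  obtain ⟨n, hn, hwords⟩ := exists_norm_words_le_half_of_quasinilpotent
    (fun a => hcompact _ (hbJ a)) fun l hl r hr => by
      have hspec := spectrum_list_prod_subset hX hclosed hJordan hcompact hfr hirr (l.map b)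
        (by simp only [List.mem_map]; rintro _ ⟨a, -, rfl⟩; exact hbJ a) (by simpa using hl)
      obtain ⟨n, h, hn⟩ := ((eventually_norm_pow_lt_of_spectrum hr fun z hz => by
        rw [hspec z hz, norm_zero]; exact hr).and (eventually_ne_atTop 0)).exists
      exact ⟨n, hn, h⟩
  obtain ⟨C, hC⟩ := exists_bound_words one_pos hn fun l hl => by
    rw [one_pow]; linarith [hwords l hl]
  obtain ⟨N, hN1, hN2⟩ := exists_seminorm_of_bounded_words one_pos hC
  have hN : ∀ a ∈ s, ∀ x, c * N (a x) ≤ N x := by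
    intro a ha x
    have h := hN2 [⟨a, ha⟩] x
    have hNc : N ((c : ℂ) • a x) = c * N (a x) := by
      rw [map_smul_eq_mul, Complex.norm_real, Real.norm_of_nonneg hc0.le]
    rw [← hNc]
    simpa [hb] using h
  refine hnot K (by simpa using hδ) N hN1 (fun a ha x => ?_) fun x => ?_
  · have h1 := hN a (hs ▸ Set.mem_insert_of_mem K ha) x
    nlinarith [apply_nonneg N x, apply_nonneg N (a x)]
  · have h1 := hN K (hs ▸ Set.mem_insert K t) x
    rw [← inv_mul_le_iff₀ hκ]
    exact (mul_le_mul_of_nonneg_right hcκ (apply_nonneg N _)).trans h1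
end

section
/- Let n ≥ 2 and let J ⊆ Mₙ(ℂ) be a Jordan algebra of matrices, i.e. a linear subspace closed under the Jordan product {A,B} = AB + BA. If J contains a nonzero element A with the property that tr(AF) = 0 for every F ∈ J, then J is reducible: there exists a linear subspace W of ℂⁿ with W ≠ {0} and W ≠ ℂⁿ such that F(W) ⊆ W for every F ∈ J. -/
open Polynomial in
/-- Over a field of characteristic zero, a matrix all of whose powers of exponent at least two
have trace zero is nilpotent. -/
theorem Matrix.isNilpotent_of_forall_trace_pow_eq_zero {K ι : Type*} [Field K] [CharZero K]
    [Fintype ι] [DecidableEq ι] {A : Matrix ι ι K}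
    (h : ∀ k, (A ^ (k + 2)).trace = 0) : IsNilpotent A := by
  obtain ⟨q, hq, hXq⟩ :=
    A.charpoly.exists_eq_pow_rootMultiplicity_mul_and_not_dvd A.charpoly_monic.ne_zero 0
  set r := A.charpoly.rootMultiplicity 0
  rw [C_0, sub_zero] at hq hXq
  obtain ⟨a, b, hab⟩ : IsCoprime (X ^ (r + 2)) q :=
    ((irreducible_X (R := K)).coprime_iff_not_dvd.2 hXq).pow_left
  have haeval : aeval A (X ^ r * q) = 0 := hq ▸ A.aeval_self_charpoly
  set e := aeval A (a * X ^ (r + 2))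
  have he : IsIdempotentElem e := by
    have hpoly : a * X ^ (r + 2) * (a * X ^ (r + 2))
        = a * X ^ (r + 2) - a * b * X ^ 2 * (X ^ r * q) := by
      linear_combination (a * X ^ (r + 2)) * hab
    rw [IsIdempotentElem, ← map_mul, hpoly, map_sub, map_mul _ _ (X ^ r * q), haeval, mul_zero,
      sub_zero]
  have htrace (p : K[X]) : (aeval A (p * X ^ 2)).trace = 0 := by
    induction p using Polynomial.induction_on' with
    | add p q hp hq => rw [add_mul, map_add, Matrix.trace_add, hp, hq, add_zero]
    | monomial k c =>
      rw [← C_mul_X_pow_eq_monomial, mul_assoc, ← pow_add, map_mul, aeval_C, map_pow, aeval_X,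
        ← Algebra.smul_def, Matrix.trace_smul, h, smul_zero]
  have he0 : e = 0 := by
    have hlin : IsIdempotentElem (Matrix.toLin' e) := by
      rw [IsIdempotentElem, Module.End.mul_eq_comp, ← Matrix.toLin'_mul, he.eq]
    have := LinearMap.IsIdempotentElem.eq_zero_of_trace_eq_zero hlin <| by
      rw [Matrix.trace_toLin'_eq, ← htrace (a * X ^ r), mul_assoc, ← pow_add]
    exact Matrix.toLin'.map_eq_zero_iff.1 this
  refine ⟨r, ?_⟩
  have hpoly : X ^ r = a * X ^ (r + 2) * X ^ r + b * (X ^ r * q) := by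
    linear_combination (-X ^ r) * hab
  rw [← aeval_X_pow (R := K) A, hpoly, map_add, map_mul _ _ (X ^ r), map_mul _ b, haeval]
  change e * _ + _ = 0
  rw [he0, zero_mul, mul_zero, add_zero]

namespace Submodule

variable {K A : Type*} [Field K] [Ring A] [Algebra K A]

/-- If `S` is a nilpotent subspace of an algebra and `x` is a nilpotent element with
`x * s + s * x ∈ S` for all `s ∈ S`, then the span of `S` and `x` is nilpotent. -/
theorem isNilpotent_sup_span_singleton {S : Submodule K A} (hS : IsNilpotent S) {x : A}
    (hx : IsNilpotent x) (hxS : ∀ s ∈ S, x * s + s * x ∈ S) :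
    IsNilpotent (S ⊔ span K {x}) := by
  obtain ⟨m, hm⟩ := hS
  obtain ⟨p, hp⟩ := hx
  set T := span K {x}
  have hTp : T ^ p = ⊥ := by rw [span_pow, Set.singleton_pow, hp, span_zero_singleton]
  have hTS : T * S ≤ S * T ⊔ S := by
    refine mul_le.2 fun t ht s hs => ?_
    obtain ⟨c, rfl⟩ := mem_span_singleton.1 ht
    have : c • x * s = -(s * (c • x)) + c • (x * s + s * x) := by
      simp only [smul_mul_assoc, mul_smul_comm, smul_add]; abel
    rw [this]
    exact add_mem (mem_sup_left <| neg_mem <| mul_mem_mul hs ht)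
      (mem_sup_right <| S.smul_mem c (hxS s hs))
  have hT (j : ℕ) : T * (S ^ j * ⊤) ≤ S ^ j * ⊤ := by
    induction j with
    | zero => simp
    | succ j ih =>
      calc T * (S ^ (j + 1) * ⊤) = T * S * (S ^ j * ⊤) := by simp only [pow_succ', mul_assoc]
        _ ≤ (S * T ⊔ S) * (S ^ j * ⊤) := mul_le_mul' hTS le_rfl
        _ = S * (T * (S ^ j * ⊤)) ⊔ S * (S ^ j * ⊤) := by rw [sup_mul, mul_assoc]
        _ ≤ S * (S ^ j * ⊤) := sup_le (mul_le_mul' le_rfl ih) le_rfl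
        _ = S ^ (j + 1) * ⊤ := by rw [pow_succ', mul_assoc]
  have hTpow (j k : ℕ) : T ^ k * (S ^ j * ⊤) ≤ S ^ j * ⊤ := by
    induction k with
    | zero => simp
    | succ k ih =>
      rw [pow_succ', mul_assoc]
      exact (mul_le_mul' le_rfl ih).trans (hT j)
  have hsucc (j : ℕ) : S ^ (j + 1) * ⊤ ≤ S ^ j * (⊤ : Submodule K A) := by
    rw [pow_succ, mul_assoc]
    exact mul_le_mul' le_rfl le_top
  have hstep (j k : ℕ) :
      (S ⊔ T) ^ k * (S ^ j * ⊤) ≤ T ^ k * (S ^ j * ⊤) ⊔ S ^ (j + 1) * ⊤ := by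
    induction k with
    | zero => simp
    | succ k ih =>
      have hS {I : Submodule K A} (hI : I ≤ S ^ j * ⊤) : S * I ≤ S ^ (j + 1) * ⊤ := by
        rw [pow_succ', mul_assoc]
        exact mul_le_mul' le_rfl hI
      rw [pow_succ', mul_assoc, pow_succ' T, mul_assoc T]
      refine (mul_le_mul' le_rfl ih).trans ?_
      rw [sup_mul, mul_sup, mul_sup]
      exact sup_le (sup_le (le_sup_of_le_right (hS (hTpow j k)))
        (le_sup_of_le_right (hS (hsucc j)))) (sup_le_sup le_rfl (hT (j + 1)))
  have hsup (j : ℕ) : (S ⊔ T) ^ (p * j) * ⊤ ≤ S ^ j * (⊤ : Submodule K A) := by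
    induction j with
    | zero => simp
    | succ j ih =>
      rw [mul_add_one, add_comm, pow_add, mul_assoc]
      refine (mul_le_mul' le_rfl ih).trans ((hstep j p).trans ?_)
      rw [hTp, bot_mul, bot_sup_eq]
  refine ⟨p * m, le_bot_iff.1 ?_⟩
  calc (S ⊔ T) ^ (p * m) = (S ⊔ T) ^ (p * m) * 1 := (mul_one _).symm
    _ ≤ (S ⊔ T) ^ (p * m) * ⊤ := mul_le_mul' le_rfl le_top
    _ ≤ S ^ m * ⊤ := hsup m
    _ = ⊥ := by rw [hm, zero_eq_bot, bot_mul]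

/-- If `S` is a nilpotent proper subspace of a subspace `R` closed under the Jordan product, then
some `x ∈ R` outside `S` has all its Jordan products with elements of `S` in `S`. -/
theorem exists_notMem_forall_jordan_mem {R S : Submodule K A}
    (hR : ∀ a ∈ R, ∀ b ∈ R, a * b + b * a ∈ R) (hS : IsNilpotent S) (hSR : S < R) :
    ∃ x ∈ R, x ∉ S ∧ ∀ s ∈ S, x * s + s * x ∈ S := by
  by_contra! hcon
  obtain ⟨m, hm⟩ := hS
  have hpow {a : ℕ} (ha : m ≤ a) {u : A} (hu : u ∈ S ^ a) : u = 0 := by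
    rwa [pow_eq_zero_of_le ha hm] at hu
  have hchain (k : ℕ) : ∃ y ∈ R, y ∉ S ∧
      ∀ a b, 2 * m ≤ a + b + k → ∀ u ∈ S ^ a, ∀ v ∈ S ^ b, u * y * v = 0 := by
    induction k with
    | zero =>
      obtain ⟨y, hyR, hyS⟩ := SetLike.exists_of_lt hSR
      refine ⟨y, hyR, hyS, fun a b hab u hu v hv => ?_⟩
      obtain ha | hb : m ≤ a ∨ m ≤ b := by omega
      · rw [hpow ha hu, zero_mul, zero_mul]
      · rw [hpow hb hv, mul_zero]
    | succ k ih =>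
      obtain ⟨y, hyR, hyS, hy⟩ := ih
      obtain ⟨s, hs, hys⟩ := hcon y hyR hyS
      refine ⟨_, hR y hyR s (hSR.le hs), hys, fun a b hab u hu v hv => ?_⟩
      have h₁ := hy a (b + 1) (by omega) u hu (s * v) (pow_succ' S b ▸ mul_mem_mul hs hv)
      have h₂ := hy (a + 1) b (by omega) (u * s) (pow_succ S a ▸ mul_mem_mul hu hs) v hv
      calc u * (y * s + s * y) * v = u * y * (s * v) + u * s * y * v := by noncomm_ring
        _ = 0 := by rw [h₁, h₂, add_zero]
  obtain ⟨y, -, hyS, hy⟩ := hchain (2 * m)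
  have := hy 0 0 (by omega) 1 (one_le.1 (pow_zero S).ge) 1 (one_le.1 (pow_zero S).ge)
  rw [one_mul, mul_one] at this
  exact hyS (this ▸ S.zero_mem)

/-- **Jacobson's theorem** for special Jordan algebras: a subspace of a finite-dimensional
associative algebra which is closed under the Jordan product and consists of nilpotent elements
is nilpotent. -/
theorem isNilpotent_of_jordan_closed [FiniteDimensional K A] {R : Submodule K A}
    (hR : ∀ a ∈ R, ∀ b ∈ R, a * b + b * a ∈ R) (hnil : ∀ a ∈ R, IsNilpotent a) :
    IsNilpotent R := by
  obtain ⟨S, ⟨hSR, hS⟩, hmax⟩ := WellFounded.has_min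
    (wellFounded_gt : WellFounded ((· > ·) : Submodule K A → Submodule K A → Prop))
    {S | S ≤ R ∧ IsNilpotent S} ⟨⊥, bot_le, IsNilpotent.zero⟩
  obtain rfl | hlt := hSR.eq_or_lt
  · exact hS
  obtain ⟨x, hxR, hxS, hx⟩ := exists_notMem_forall_jordan_mem hR hS hlt
  refine absurd ?_ (hmax (S ⊔ span K {x})
    ⟨sup_le hSR (by simpa using hxR), isNilpotent_sup_span_singleton hS (hnil x hxR) hx⟩)
  exact left_lt_sup.2 fun h => hxS (h (mem_span_singleton_self x))

/-- A nilpotent subspace of matrices has a nonzero common null vector. -/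
theorem exists_ne_zero_forall_mulVec_eq_zero {ι : Type*} [Fintype ι] [DecidableEq ι] [Nonempty ι]
    {R : Submodule K (Matrix ι ι K)} (hR : IsNilpotent R) :
    ∃ v : ι → K, v ≠ 0 ∧ ∀ B ∈ R, B.mulVec v = 0 := by
  by_contra! hcon
  obtain ⟨m, hm⟩ := hR
  have hinj (k : ℕ) (v : ι → K) (hv : ∀ B ∈ R ^ k, B.mulVec v = 0) : v = 0 := by
    induction k with
    | zero => simpa using hv 1 (by simp)
    | succ k ih =>
      refine ih fun B hB => ?_
      by_contra hBv
      obtain ⟨C, hC, hCv⟩ := hcon _ hBv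
      exact hCv (by rw [Matrix.mulVec_mulVec, hv _ (pow_succ' R k ▸ mul_mem_mul hC hB)])
  refine one_ne_zero (α := ι → K) (hinj m 1 fun B hB => ?_)
  rw [hm] at hB
  rw [(mem_bot K).1 hB, Matrix.zero_mulVec]

end Submodule

/-- A matrix Jordan algebra containing a nonzero element `A` with `tr(AF) = 0`
for every `F` in the algebra is reducible. -/
theorem jordan_algebra_trace_zero_reducible
    {n : ℕ} (hn : 2 ≤ n) (J : Submodule ℂ (Matrix (Fin n) (Fin n) ℂ))
    (hJordan : ∀ A ∈ J, ∀ B ∈ J, A * B + B * A ∈ J)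
    (A : Matrix (Fin n) (Fin n) ℂ) (hA : A ∈ J) (hA0 : A ≠ 0)
    (htr : ∀ F ∈ J, Matrix.trace (A * F) = 0) :
    ∃ W : Submodule ℂ (Fin n → ℂ), W ≠ ⊥ ∧ W ≠ ⊤ ∧
      ∀ F ∈ J, ∀ x ∈ W, F.mulVec x ∈ W := by
  have : Nonempty (Fin n) := ⟨⟨0, by omega⟩⟩
  let R : Submodule ℂ (Matrix (Fin n) (Fin n) ℂ) :=
    { carrier := {B | B ∈ J ∧ ∀ F ∈ J, (B * F).trace = 0}
      zero_mem' := ⟨J.zero_mem, by simp⟩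
      add_mem' := fun {B C} hB hC => ⟨J.add_mem hB.1 hC.1, fun F hF => by
        rw [add_mul, Matrix.trace_add, hB.2 F hF, hC.2 F hF, add_zero]⟩
      smul_mem' := fun c B hB => ⟨J.smul_mem c hB.1, fun F hF => by
        rw [smul_mul_assoc, Matrix.trace_smul, hB.2 F hF, smul_zero]⟩ }
  have hideal {B : Matrix (Fin n) (Fin n) ℂ} (hB : B ∈ R) {F} (hF : F ∈ J) :
      B * F + F * B ∈ R := by
    refine ⟨hJordan B hB.1 F hF, fun G hG => ?_⟩
    rw [← hB.2 _ (hJordan F hF G hG), add_mul, mul_add, Matrix.trace_add, Matrix.trace_add,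
      mul_assoc, ← mul_assoc B G F, Matrix.trace_mul_comm (B * G) F, mul_assoc]
  have hpow {B : Matrix (Fin n) (Fin n) ℂ} (hB : B ∈ J) (k : ℕ) : B ^ (k + 1) ∈ J := by
    induction k with
    | zero => simpa using hB
    | succ k ih =>
      have := hJordan B hB _ ih
      rw [← pow_succ, ← pow_succ', ← two_smul ℂ] at this
      exact (J.smul_mem_iff two_ne_zero).1 this
  have hnil : ∀ B ∈ R, IsNilpotent B := fun B hB =>
    Matrix.isNilpotent_of_forall_trace_pow_eq_zero fun k => by
      rw [pow_succ']; exact hB.2 _ (hpow hB.1 k)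
  obtain ⟨v, hv0, hv⟩ := Submodule.exists_ne_zero_forall_mulVec_eq_zero
    (Submodule.isNilpotent_of_jordan_closed (fun B hB C hC => hideal hB hC.1) hnil)
  refine ⟨⨅ B ∈ R, LinearMap.ker (Matrix.toLin' B), fun hbot => hv0 ?_, fun htop => hA0 ?_,
    fun F hF x hx => ?_⟩
  · rw [← Submodule.mem_bot ℂ, ← hbot]
    simpa using hv
  · have hle := htop.ge.trans (iInf₂_le A ⟨hA, htr⟩)
    exact Matrix.toLin'.map_eq_zero_iff.1 (LinearMap.ker_eq_top.1 (top_le_iff.1 hle))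
  · simp only [Submodule.mem_iInf, LinearMap.mem_ker, Matrix.toLin'_apply] at hx ⊢
    intro B hB
    have h := hx _ (hideal hB hF)
    rwa [Matrix.add_mulVec, ← Matrix.mulVec_mulVec, ← Matrix.mulVec_mulVec, hx B hB,
      Matrix.mulVec_zero, add_zero] at h
end

section
/- Let J be a Jordan algebra of compact operators on a complex Banach space X (a linear subspace of B(X), closed under the Jordan product {A,B} = AB + BA, all of whose elements are compact), and let T ∈ J. If every element of J has T-stable spectrum, then AT is quasinilpotent, i.e. r(AT) = 0, for every A ∈ J. -/
open Filter Topology Metric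

section BanachAlgebra

variable {𝔸 : Type*} [NormedRing 𝔸] [NormedAlgebra ℂ 𝔸] [CompleteSpace 𝔸]

/-- If an affine pencil is invertible on a circle and is a limit of affine pencils which are
invertible on the whole closed disc, then it is invertible on the whole closed disc. -/
theorem isUnit_sub_smul_of_approx {p q : 𝔸} {M : ℝ} (hM : 0 < M)
    (hsphere : ∀ μ : ℂ, ‖μ‖ = M → IsUnit (p - μ • q))
    (happrox : ∀ ε > 0, ∃ p' q' : 𝔸, ‖p' - p‖ < ε ∧ ‖q' - q‖ < ε ∧
      ∀ μ : ℂ, ‖μ‖ ≤ M → IsUnit (p' - μ • q'))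
    {μ : ℂ} (hμ : ‖μ‖ ≤ M) : IsUnit (p - μ • q) := by
  obtain ⟨C₀, hC₀⟩ : ∃ C, ∀ μ ∈ sphere (0 : ℂ) M, ‖Ring.inverse (p - μ • q)‖ ≤ C := by
    refine (isCompact_sphere (0 : ℂ) M).exists_bound_of_continuousOn fun μ hμ => ?_
    obtain ⟨u, hu⟩ := hsphere μ (by simpa using hμ)
    have h1 : ContinuousAt Ring.inverse (p - μ • q) := hu ▸ NormedRing.inverse_continuousAt u
    exact (h1.comp (f := fun μ : ℂ => p - μ • q)
      (by fun_prop : Continuous fun μ : ℂ => p - μ • q).continuousAt).continuousWithinAt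
  obtain ⟨C, hC0, hC⟩ : ∃ C > 0, ∀ μ : ℂ, ‖μ‖ = M → ‖Ring.inverse (p - μ • q)‖ ≤ C :=
    ⟨max C₀ 1, by positivity, fun μ hμ => (hC₀ μ (by simpa using hμ)).trans (le_max_left _ _)⟩
  obtain ⟨p', q', hp, hq, hu⟩ := happrox (1 / (2 * C * (1 + M))) (by positivity)
  have hdist : ∀ μ : ℂ, ‖μ‖ ≤ M → ‖(p' - μ • q') - (p - μ • q)‖ < 1 / (2 * C) := by
    intro μ hμ
    calc ‖(p' - μ • q') - (p - μ • q)‖ = ‖(p' - p) - μ • (q' - q)‖ := by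
          congr 1; rw [smul_sub]; abel
      _ ≤ ‖p' - p‖ + ‖μ‖ * ‖q' - q‖ := (norm_sub_le _ _).trans_eq (by rw [norm_smul])
      _ ≤ ‖p' - p‖ + M * ‖q' - q‖ := by gcongr
      _ < 1 / (2 * C * (1 + M)) + M * (1 / (2 * C * (1 + M))) :=
          add_lt_add hp (mul_lt_mul_of_pos_left hq hM)
      _ = 1 / (2 * C) := by field_simp
  have hbound : ∀ μ : ℂ, ‖μ‖ = M → ‖Ring.inverse (p' - μ • q')‖ ≤ 2 * C := by
    intro μ hμ
    have hx := hsphere μ hμ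
    have hx' := hu μ hμ.le
    have hd := hdist μ hμ.le
    have hCμ := hC μ hμ
    set x := p - μ • q
    set x' := p' - μ • q'
    have key : Ring.inverse x' = Ring.inverse x - Ring.inverse x * (x' - x) * Ring.inverse x' := by
      rw [mul_sub, sub_mul, mul_assoc, Ring.mul_inverse_cancel _ hx', Ring.inverse_mul_cancel _ hx]
      simp
    have h1 : ‖Ring.inverse x'‖ ≤ C + C * (1 / (2 * C)) * ‖Ring.inverse x'‖ := by
      calc ‖Ring.inverse x'‖
          = ‖Ring.inverse x - Ring.inverse x * (x' - x) * Ring.inverse x'‖ := by rw [← key]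
        _ ≤ ‖Ring.inverse x‖ + ‖Ring.inverse x * (x' - x) * Ring.inverse x'‖ := norm_sub_le _ _
        _ ≤ ‖Ring.inverse x‖ + ‖Ring.inverse x‖ * ‖x' - x‖ * ‖Ring.inverse x'‖ := by
            gcongr
            exact (norm_mul_le _ _).trans (by gcongr; exact norm_mul_le _ _)
        _ ≤ _ := by gcongr
    have h2 : C * (1 / (2 * C)) = 1 / 2 := by field_simp
    rw [h2] at h1
    linarith
  have hball : ‖Ring.inverse (p' - μ • q')‖ ≤ 2 * C := by
    refine Complex.norm_le_of_forall_mem_frontier_norm_le (U := ball (0 : ℂ) M)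
      (f := fun μ : ℂ => Ring.inverse (p' - μ • q')) isBounded_ball ?_ ?_ ?_
    · refine DifferentiableOn.diffContOnCl fun μ hμ => ?_
      rw [closure_ball _ hM.ne'] at hμ
      obtain ⟨u, hu⟩ := hu μ (by simpa using hμ)
      have h1 : DifferentiableAt ℂ Ring.inverse (p' - μ • q') :=
        hu ▸ differentiableAt_inverse (𝕜 := ℂ) u.isUnit
      exact (h1.comp (f := fun μ : ℂ => p' - μ • q') μ
        (by fun_prop)).differentiableWithinAt
    · intro z hz
      rw [frontier_ball _ hM.ne'] at hz
      exact hbound z (by simpa using hz)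
    · rw [closure_ball _ hM.ne']
      simpa using hμ
  have hx' := hu μ hμ
  have hd := hdist μ hμ
  set x := p - μ • q
  set x' := p' - μ • q'
  have hfac : x = x' * (1 - Ring.inverse x' * (x' - x)) := by
    rw [mul_sub, ← mul_assoc, Ring.mul_inverse_cancel _ hx']
    simp
  rw [hfac]
  refine hx'.mul (isUnit_one_sub_of_norm_lt_one ?_)
  calc ‖Ring.inverse x' * (x' - x)‖ ≤ ‖Ring.inverse x'‖ * ‖x' - x‖ := norm_mul_le _ _
    _ ≤ 2 * C * ‖x' - x‖ := by gcongr
    _ < 2 * C * (1 / (2 * C)) := by gcongr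
    _ = 1 := by field_simp

/-- If `t + z • l` is quasinilpotent for all small `z`, then `l` is quasinilpotent. -/
theorem isUnit_one_sub_smul_of_forall_add_smul {t l : 𝔸} {δ : ℝ} (hδ : 0 < δ)
    (h : ∀ z : ℂ, ‖z‖ < δ → ∀ μ : ℂ, IsUnit (1 - μ • (t + z • l))) (ν : ℂ) :
    IsUnit (1 - ν • l) := by
  obtain ⟨M, hM, hνM⟩ : ∃ M > 0, ‖ν‖ < δ * M := by
    refine ⟨(‖ν‖ + 1) / δ, by positivity, ?_⟩
    rw [mul_div_cancel₀ _ hδ.ne']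
    exact lt_add_one _
  let U : Set ℂ := {s | ∀ μ ∈ closedBall (0 : ℂ) M, IsUnit ((1 - s • l) - μ • t)}
  have hU : IsOpen U := by
    rw [isOpen_iff_mem_nhds]
    intro s hs
    refine (isCompact_closedBall (0 : ℂ) M).eventually_forall_of_forall_eventually
      fun μ hμ => ?_
    have hcont : Continuous fun x : ℂ × ℂ => (1 - x.1 • l) - x.2 • t := by fun_prop
    exact hcont.continuousAt.eventually_mem (x := (s, μ)) (s := {x : 𝔸 | IsUnit x})
      (Units.isOpen.mem_nhds (hs μ hμ))
  have hsub : ball (0 : ℂ) (δ * M) ⊆ U := by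
    refine (convex_ball (0 : ℂ) (δ * M)).isPreconnected.subset_of_closure_inter_subset hU
      ⟨0, by simpa using by positivity, fun μ _ => ?_⟩ ?_
    · simpa using h 0 (by simpa using hδ) μ
    · rintro s ⟨hs, hsM⟩ μ hμ
      refine isUnit_sub_smul_of_approx hM (fun μ hμ => ?_) (fun ε hε => ?_) (by simpa using hμ)
      · have hμ0 : μ ≠ 0 := by rintro rfl; simp at hμ; exact hM.ne hμ
        have := h (s / μ) (by
          rw [norm_div, hμ, div_lt_iff₀ hM]; simpa using hsM) μ
        rw [smul_add, smul_smul, mul_div_cancel₀ _ hμ0] at this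
        convert this using 1
        abel
      · have hcont : ContinuousAt (fun s' : ℂ => ‖(1 - s' • l) - (1 - s • l)‖) s := by fun_prop
        obtain ⟨s', hs', hs'U⟩ := ((mem_closure_iff_frequently.1 hs).and_eventually
          (hcont.eventually_lt continuousAt_const (show _ < ε by simpa using hε))).exists
        exact ⟨1 - s' • l, t, hs'U, by simpa using hε, fun μ hμ => hs' μ (by simpa using hμ)⟩
  simpa using hsub (by simpa using hνM) 0 (by simpa using hM.le)

end BanachAlgebra

theorem spectralRadius_eq_zero_of_isUnit_one_sub_smul {𝔸 : Type*} [NormedRing 𝔸]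
    [NormedAlgebra ℂ 𝔸] {a : 𝔸}
    (h : ∀ μ : ℂ, IsUnit (1 - μ • a)) : spectralRadius ℂ a = 0 := by
  simp only [spectralRadius, ENNReal.iSup_eq_zero]
  intro σ hσ
  by_contra hne
  have hσ0 : σ ≠ 0 := by simpa using hne
  refine hσ (spectrum.mem_resolventSet_iff.2 ?_)
  have := (h σ⁻¹).smul (Units.mk0 σ hσ0)
  simpa [Units.smul_def, smul_sub, smul_smul, hσ0, Algebra.algebraMap_eq_smul_one] using this

namespace IsCompactOperator

variable {X : Type*} [NormedAddCommGroup X] [NormedSpace ℂ X]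

open Module End in
/-- A compact operator has finitely many eigenvalues outside any disc around zero. -/
theorem finite_setOf_hasEigenvalue {K : X →L[ℂ] X} (hK : IsCompactOperator K) {ε : ℝ}
    (hε : 0 < ε) : {μ : ℂ | ε ≤ ‖μ‖ ∧ HasEigenvalue (K : End ℂ X) μ}.Finite := by
  by_contra hinf
  let e := Set.Infinite.natEmbedding _ hinf
  have hnorm : ∀ n, ε ≤ ‖(e n : ℂ)‖ := fun n => (e n).2.1
  choose v hv using fun n => (e n).2.2.exists_hasEigenvector
  have hli : LinearIndependent ℂ v := eigenvectors_linearIndependent' (K : End ℂ X)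
    (fun n => (e n : ℂ)) (Subtype.val_injective.comp e.injective) v hv
  have hKv : ∀ n, K (v n) = (e n : ℂ) • v n := fun n => (hv n).apply_eq_smul
  let V : ℕ → Submodule ℂ X := fun n => Submodule.span ℂ (v '' Set.Iio n)
  have hVmono : Monotone V := fun m n hmn =>
    Submodule.span_mono (Set.image_mono (Set.Iio_subset_Iio hmn))
  have hvV : ∀ n, v n ∈ V (n + 1) := fun n =>
    Submodule.subset_span ⟨n, by simp, rfl⟩
  have hvnV : ∀ n, v n ∉ V n := fun n => hli.notMem_span_image (by simp)
  have hKV : ∀ n, ∀ x ∈ V n, K x ∈ V n := by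
    intro n x hx
    have : V n ≤ (V n).comap (K : X →ₗ[ℂ] X) := by
      refine Submodule.span_le.2 ?_
      rintro _ ⟨k, hk, rfl⟩
      change K (v k) ∈ V n
      rw [hKv]
      exact (V n).smul_mem _ (Submodule.subset_span ⟨k, hk, rfl⟩)
    exact this hx
  have hKsub : ∀ n, ∀ x ∈ V (n + 1), K x - (e n : ℂ) • x ∈ V n := by
    intro n x hx
    have : V (n + 1) ≤ (V n).comap ((K : X →ₗ[ℂ] X) - (e n : ℂ) • LinearMap.id) := by
      refine Submodule.span_le.2 ?_
      rintro _ ⟨k, hk, rfl⟩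
      change K (v k) - (e n : ℂ) • v k ∈ V n
      rw [hKv, ← sub_smul]
      rcases (Nat.lt_succ_iff.1 hk).lt_or_eq with h | rfl
      · exact (V n).smul_mem _ (Submodule.subset_span ⟨k, h, rfl⟩)
      · simp
    exact this hx
  have hriesz : ∀ n, ∃ y ∈ V (n + 1), ‖y‖ ≤ 3 ∧ ∀ x ∈ V n, 1 ≤ ‖y - x‖ := by
    intro n
    have : FiniteDimensional ℂ (V n) :=
      FiniteDimensional.span_of_finite ℂ ((Set.finite_Iio n).image v)
    have hclosed : IsClosed (V n : Set X) := (V n).closed_of_finiteDimensional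
    obtain ⟨y, hy, hyV⟩ := riesz_lemma_of_norm_lt (𝕜 := ℂ) (c := 2) (R := 3)
      (F := (V n).comap (V (n + 1)).subtype) (by norm_num) (by norm_num)
      (hclosed.preimage continuous_subtype_val) ⟨⟨v n, hvV n⟩, hvnV n⟩
    exact ⟨y, y.2, hy, fun x hx => hyV ⟨x, hVmono n.le_succ hx⟩ hx⟩
  choose y hyV hy3 hyd using hriesz
  have hsep : ∀ m n, m < n → ε ≤ ‖K (y n) - K (y m)‖ := by
    intro m n hmn
    have he0 : (e n : ℂ) ≠ 0 := norm_pos_iff.1 (hε.trans_le (hnorm n))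
    have hmem : K (y m) - (K (y n) - (e n : ℂ) • y n) ∈ V n :=
      (V n).sub_mem (hKV n _ (hVmono hmn (hyV m))) (hKsub n _ (hyV n))
    have h1 := hyd n _ ((V n).smul_mem (e n : ℂ)⁻¹ hmem)
    have h2 : K (y n) - K (y m) = (e n : ℂ) •
        (y n - (e n : ℂ)⁻¹ • (K (y m) - (K (y n) - (e n : ℂ) • y n))) := by
      rw [smul_sub, smul_inv_smul₀ he0]
      abel
    rw [h2, norm_smul]
    exact (hnorm n).trans (le_mul_of_one_le_right (norm_nonneg _) h1)
  obtain ⟨S, hS, hS'⟩ := hK.image_closedBall_subset_compact 3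
  obtain ⟨w, -, φ, hφ, hφw⟩ := hS.tendsto_subseq (x := fun n => K (y n))
    fun n => hS' ⟨y n, by simpa using hy3 n, rfl⟩
  obtain ⟨N, hN⟩ := Metric.cauchySeq_iff'.1 hφw.cauchySeq ε hε
  have := hN (N + 1) N.le_succ
  rw [dist_eq_norm] at this
  exact (hsep _ _ (hφ N.lt_succ_self)).not_gt this

variable [CompleteSpace X]

/-- Arbitrarily large circles avoid the inverses of the eigenvalues of a compact operator. -/
theorem exists_circle_isUnit_one_sub_smul {K : X →L[ℂ] X} (hK : IsCompactOperator K) {R : ℝ}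
    (hR : 0 < R) : ∃ M ≥ R, ∀ μ : ℂ, ‖μ‖ = M → IsUnit (1 - μ • K) := by
  have hfin := (hK.finite_setOf_hasEigenvalue (ε := (R + 1)⁻¹) (by positivity)).image
    fun σ : ℂ => ‖σ‖⁻¹
  obtain ⟨M, hM, hMn⟩ := (Set.Icc_infinite (lt_add_one R)).exists_notMem_finite hfin
  refine ⟨M, hM.1, fun μ hμ => ?_⟩
  have hM0 : 0 < M := hR.trans_le hM.1
  have hμ0 : μ ≠ 0 := norm_pos_iff.1 (hμ ▸ hM0)
  rcases hK.hasEigenvalue_or_mem_resolventSet (inv_ne_zero hμ0) with h | h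
  · refine absurd ⟨μ⁻¹, ⟨?_, h⟩, by simp [hμ]⟩ hMn
    rw [norm_inv, hμ]
    exact inv_anti₀ hM0 hM.2
  · have := IsUnit.smul (Units.mk0 μ hμ0) (spectrum.mem_resolventSet_iff.1 h)
    simpa [Units.smul_def, smul_sub, smul_smul, hμ0, Algebra.algebraMap_eq_smul_one] using this

/-- A compact operator which is a norm limit of quasinilpotent operators is quasinilpotent. -/
theorem isUnit_one_sub_smul_of_approx {K : X →L[ℂ] X} (hK : IsCompactOperator K)
    (h : ∀ ε > 0, ∃ K' : X →L[ℂ] X, ‖K' - K‖ < ε ∧ ∀ μ : ℂ, IsUnit (1 - μ • K')) (μ : ℂ) :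
    IsUnit (1 - μ • K) := by
  obtain ⟨M, hM, hunit⟩ := hK.exists_circle_isUnit_one_sub_smul (R := ‖μ‖ + 1) (by positivity)
  refine isUnit_sub_smul_of_approx (by linarith [norm_nonneg μ]) hunit (fun ε hε => ?_)
    (by linarith : ‖μ‖ ≤ M)
  obtain ⟨K', hK', hu⟩ := h ε hε
  exact ⟨1, K', by simpa using hε, hK', fun μ _ => hu μ⟩

end IsCompactOperator

/-- A subspace closed under the Jordan product contains the positive powers of its elements. -/
theorem Submodule.pow_succ_mem_of_jordan {𝔸 : Type*} [Ring 𝔸] [Algebra ℂ 𝔸] {J : Submodule ℂ 𝔸}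
    (hJordan : ∀ a ∈ J, ∀ b ∈ J, a * b + b * a ∈ J) {a : 𝔸} (ha : a ∈ J) (n : ℕ) :
    a ^ (n + 1) ∈ J := by
  induction n with
  | zero => simpa using ha
  | succ n ih =>
    have h := J.smul_mem (1 / 2 : ℂ) (hJordan _ ih _ ha)
    rw [← pow_succ, ← pow_succ', ← two_smul ℂ (a ^ (n + 1 + 1)), smul_smul] at h
    simpa using h

/-- The quasi-inverse of a small element of a Jordan algebra lies in its closure. -/
theorem Submodule.one_sub_inverse_mem_closure {𝔸 : Type*} [NormedRing 𝔸] [NormedAlgebra ℂ 𝔸]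
    [CompleteSpace 𝔸] {J : Submodule ℂ 𝔸} (hJordan : ∀ a ∈ J, ∀ b ∈ J, a * b + b * a ∈ J)
    {a : 𝔸} (ha : a ∈ J) (hnorm : ‖a‖ < 1) : 1 - Ring.inverse (1 - a) ∈ closure (J : Set 𝔸) := by
  have hsum : Summable fun n : ℕ => a ^ n := summable_geometric_of_norm_lt_one hnorm
  have hinv : Ring.inverse (1 - a) = ∑' n : ℕ, a ^ n :=
    NormedRing.inverse_one_sub a hnorm
  have h1 : 1 - Ring.inverse (1 - a) = -∑' n : ℕ, a ^ (n + 1) := by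
    rw [hinv, hsum.tsum_eq_zero_add]
    simp
  rw [h1]
  refine J.topologicalClosure.neg_mem ?_
  have hs := (summable_nat_add_iff 1).2 hsum
  refine mem_closure_of_tendsto hs.hasSum.tendsto_sum_nat (Eventually.of_forall fun n => ?_)
  exact J.sum_mem fun k _ => J.pow_succ_mem_of_jordan hJordan ha k

/-- If a Jordan algebra of compact operators has `T`-stable spectrum for some `T`
in the algebra, then `AT` is quasinilpotent for every `A` in the algebra. -/
theorem jordan_algebra_stable_spectrum_quasinilpotent
    {X : Type*} [NormedAddCommGroup X] [NormedSpace ℂ X] [CompleteSpace X]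
    (J : Submodule ℂ (X →L[ℂ] X))
    (hJordan : ∀ A ∈ J, ∀ B ∈ J, A * B + B * A ∈ J)
    (hcompact : ∀ A ∈ J, IsCompactOperator A)
    (T : X →L[ℂ] X) (hT : T ∈ J)
    (hstable : ∀ A ∈ J, ∀ lam : ℂ, spectralRadius ℂ (A + lam • T) ≤ spectralRadius ℂ A) :
    ∀ A ∈ J, spectralRadius ℂ (A * T) = 0 := by
  intro A hA
  apply spectralRadius_eq_zero_of_isUnit_one_sub_smul
  rcases subsingleton_or_nontrivial X with hX | hX
  · exact fun μ => isUnit_of_subsingleton _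
  have hstable' : ∀ B ∈ J, ‖B‖ < 1 → ∀ μ : ℂ, IsUnit (1 - μ • (Ring.inverse (1 - B) * T)) := by
    intro B hB hB1 μ
    have hr : spectralRadius ℂ (B + μ • T) < ‖(1 : ℂ)‖₊ := by
      refine (hstable B hB μ).trans_lt ((spectrum.spectralRadius_le_nnnorm B).trans_lt ?_)
      rw [nnnorm_one]
      exact_mod_cast hB1
    have hunit := spectrum.mem_resolventSet_iff.1
      (spectrum.mem_resolventSet_of_spectralRadius_lt hr)
    have hB' : IsUnit (1 - B) := isUnit_one_sub_of_norm_lt_one hB1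
    have hfac : 1 - μ • (Ring.inverse (1 - B) * T) =
        Ring.inverse (1 - B) * (algebraMap ℂ _ 1 - (B + μ • T)) := by
      rw [map_one, ← sub_sub, mul_sub, Ring.inverse_mul_cancel _ hB', mul_smul_comm]
    rw [hfac]
    exact hB'.ringInverse.mul hunit
  have hcont : ContinuousAt (fun z : ℂ => ‖1 - Ring.inverse (1 - (-z) • A)‖) 0 := by
    have h1 : ContinuousAt Ring.inverse (1 - (-(0 : ℂ)) • A) := by
      simpa using NormedRing.inverse_continuousAt (1 : (X →L[ℂ] X)ˣ)
    have h2 : ContinuousAt (fun z : ℂ => Ring.inverse (1 - (-z) • A)) 0 :=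
      h1.comp (f := fun z : ℂ => 1 - (-z) • A) (by fun_prop)
    fun_prop
  have hcont' : ContinuousAt (fun z : ℂ => ‖(-z) • A‖) 0 := by fun_prop
  obtain ⟨δ, hδ, hsmall⟩ := Metric.eventually_nhds_iff.1
    ((hcont.eventually_lt continuousAt_const (show _ < (1 : ℝ) by simp)).and
      (hcont'.eventually_lt continuousAt_const (show _ < (1 : ℝ) by simp)))
  refine isUnit_one_sub_smul_of_forall_add_smul (t := T) hδ fun z hz => ?_
  obtain ⟨hz1, hz2⟩ := hsmall (y := z) (by simpa using hz)
  have hunit : IsUnit (1 - (-z) • A) := isUnit_one_sub_of_norm_lt_one hz2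
  refine IsCompactOperator.isUnit_one_sub_smul_of_approx ?_ fun ε hε => ?_
  · have hAT : IsCompactOperator (A * T) := (hcompact T hT).clm_comp A
    exact (hcompact T hT).add (hAT.smul z)
  have hb := J.one_sub_inverse_mem_closure hJordan (J.smul_mem (-z) hA) hz2
  set b := 1 - Ring.inverse (1 - (-z) • A) with hbdef
  have hb1 : 1 - b = Ring.inverse (1 - (-z) • A) := by rw [hbdef, sub_sub_cancel]
  have hbinv : Ring.inverse (1 - b) * T = T + z • (A * T) := by
    rw [hb1, Ring.inverse_inverse hunit, sub_mul, neg_smul, neg_mul, smul_mul_assoc]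
    simp
  have hcontb : ContinuousAt
      (fun B : X →L[ℂ] X => ‖Ring.inverse (1 - B) * T - (T + z • (A * T))‖) b := by
    obtain ⟨u, hu⟩ : IsUnit (1 - b) := hb1 ▸ hunit.ringInverse
    have h1 : ContinuousAt Ring.inverse (1 - b) := hu ▸ NormedRing.inverse_continuousAt u
    have h2 : ContinuousAt (fun B : X →L[ℂ] X => Ring.inverse (1 - B)) b :=
      h1.comp (f := fun B : X →L[ℂ] X => 1 - B) (by fun_prop)
    fun_prop
  obtain ⟨B, hBJ, hB1, hBε⟩ := ((mem_closure_iff_frequently.1 hb).and_eventually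
    ((continuous_norm.continuousAt.eventually_lt continuousAt_const hz1).and
      (hcontb.eventually_lt continuousAt_const
        (show _ < ε by rw [hbinv]; simpa using hε)))).exists
  exact ⟨Ring.inverse (1 - B) * T, hBε, hstable' B hBJ hB1⟩
end
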